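/- Let W be a d-dimensional fractional Brownian motion with Hurst parameter H ∈ [1/2, 1), let α > −1/(2H), let b ∈ FL^{α+1} and x₀ ∈ ℝ^d. Then there exists a measurable set N (depending on b and x₀) of paths with P(W ∈ N) = 0 such that for every continuous path w ∉ N the integral equation x_t = x₀ + ∫₀^t b(s, x_s) ds + w_t, t ∈ [0,1], admits exactly one solution x ∈ C([0,1], ℝ^d). -/

import Mathlib

open MeasureTheory Filter Topology
open scoped ENNReal NNReal

noncomputable section

abbrev Euc (d : ℕ) : Type := EuclideanSpace ℝ (Fin d)

/-- `Y^w_{s,t}(ω,ξ) = ∫_s^t exp(i ξ·w_u + i ω u) du`. -/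
def Yint {d : ℕ} (w : ℝ → Euc d) (s t ω : ℝ) (ξ : Euc d) : ℂ :=
  ∫ u in s..t, Complex.exp (Complex.I * Complex.ofReal (inner ℝ ξ (w u) + ω * u))

/-- The averaging constant `K^w_{α,γ}`. -/
def avgK {d : ℕ} (w : ℝ → Euc d) (α γ : ℝ) : ℝ≥0∞ :=
  ⨆ (s : ℝ) (t : ℝ) (_ : 0 ≤ s) (_ : s < t) (_ : t ≤ 1) (ω : ℝ) (ξ : Euc d),
    ENNReal.ofReal (‖Yint w s t ω ξ‖ /
      ((1 + ‖ξ‖) ^ α * (1 + Real.sqrt (Real.log (1 + |ω|))) * (t - s) ^ γ))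

/-- The norm `N_α` of a space-time vector field given through its Fourier transform `bhat`. -/
def FLnorm (d : ℕ) (α : ℝ) (bhat : ℝ × Euc d → Fin d → ℂ) : ℝ≥0∞ :=
  ∫⁻ p : ℝ × Euc d, ENNReal.ofReal (‖bhat p‖ * (1 + ‖p.2‖) ^ α *
    (1 + Real.sqrt (Real.log (1 + |p.1|))))

/-- The vector field `b(t,x)` recovered from its space-time Fourier transform. -/
def fieldOf {d : ℕ} (bhat : ℝ × Euc d → Fin d → ℂ) (t : ℝ) (x : Euc d) : Euc d :=
  (EuclideanSpace.equiv (Fin d) ℝ).symm fun i =>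
    ∫ p : ℝ × Euc d, (bhat p i * Complex.exp (Complex.I * Complex.ofReal (p.1 * t + inner ℝ p.2 x))).re

/-- The averaged vector field `σ^w_{[s,t]} b`, defined through the Fourier representation. -/
def sigmaAvg {d : ℕ} (w : ℝ → Euc d) (bhat : ℝ × Euc d → Fin d → ℂ) (s t : ℝ) (x : Euc d) :
    Euc d :=
  (EuclideanSpace.equiv (Fin d) ℝ).symm fun i =>
    ∫ p : ℝ × Euc d, (bhat p i * Yint w s t p.1 p.2 *
      Complex.exp (Complex.I * Complex.ofReal (inner ℝ p.2 x))).re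

/-- Partitions of the interval `[s,t]`. -/
structure IntervalPartition (s t : ℝ) where
  n : ℕ
  pts : ℕ → ℝ
  first : pts 0 = s
  last : pts n = t
  mono : ∀ i, i < n → pts i ≤ pts (i + 1)

/-- The mesh of the partition is smaller than `δ`. -/
def IntervalPartition.MeshLt {s t : ℝ} (P : IntervalPartition s t) (δ : ℝ) : Prop :=
  ∀ i, i < P.n → P.pts (i + 1) - P.pts i < δ

/-- Riemann sums `Σ_i (G_{t_{i+1}} - G_{t_i})(f_{t_i})` of the nonlinear Young integral. -/
def RiemannSum {V W : Type*} [AddCommGroup W] (G : ℝ → V → W) (f : ℝ → V)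
    {s t : ℝ} (P : IntervalPartition s t) : W :=
  ∑ i ∈ Finset.range P.n, (G (P.pts (i + 1)) (f (P.pts i)) - G (P.pts i) (f (P.pts i)))

/-- `L` is the nonlinear Young integral `∫_s^t G_{du}(f_u)`: the Riemann sums converge to `L`
as the mesh of the partition tends to `0`. -/
def HasYoungIntegral {V W : Type*} [NormedAddCommGroup W] (G : ℝ → V → W) (f : ℝ → V)
    (s t : ℝ) (L : W) : Prop :=
  ∀ ε > 0, ∃ δ > 0, ∀ P : IntervalPartition s t, P.MeshLt δ → ‖RiemannSum G f P - L‖ < ε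

/-- Riemann sums `Σ_i (σ^w_{[t_i,t_{i+1}]} b)(θ_{t_i})`. -/
def sigmaRiemannSum {d : ℕ} (w : ℝ → Euc d) (bhat : ℝ × Euc d → Fin d → ℂ)
    (θ : ℝ → Euc d) {s t : ℝ} (P : IntervalPartition s t) : Euc d :=
  ∑ i ∈ Finset.range P.n, sigmaAvg w bhat (P.pts i) (P.pts (i + 1)) (θ (P.pts i))

/-- `L = ∫_s^t (σ^w_{du} b)(θ_u)` as a limit of Riemann sums. -/
def HasSigmaIntegral {d : ℕ} (w : ℝ → Euc d) (bhat : ℝ × Euc d → Fin d → ℂ)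
    (θ : ℝ → Euc d) (s t : ℝ) (L : Euc d) : Prop :=
  ∀ ε > 0, ∃ δ > 0, ∀ P : IntervalPartition s t, P.MeshLt δ → ‖sigmaRiemannSum w bhat θ P - L‖ < ε

/-- `θ` solves the Young equation `θ_t = x₀ + ∫_0^t (σ^w_{du} b)(θ_u)` on `[0,1]`. -/
def SolvesSigmaYoung {d : ℕ} (w : ℝ → Euc d) (bhat : ℝ × Euc d → Fin d → ℂ)
    (x₀ : Euc d) (θ : ℝ → Euc d) : Prop :=
  θ 0 = x₀ ∧ ∀ t ∈ Set.Icc (0 : ℝ) 1, HasSigmaIntegral w bhat θ 0 t (θ t - x₀)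

/-- `γ`-Hölder continuity on `[0,1]`. -/
def HolderOnIcc {E : Type*} [NormedAddCommGroup E] (γ : ℝ) (f : ℝ → E) : Prop :=
  ∃ C : ℝ, ∀ s ∈ Set.Icc (0 : ℝ) 1, ∀ t ∈ Set.Icc (0 : ℝ) 1, ‖f t - f s‖ ≤ C * |t - s| ^ γ

/-- Covariance of the fractional Brownian motion of Hurst index `H`. -/
def fbmCov (H : ℝ) (s t : ℝ) : ℝ := (s ^ (2 * H) + t ^ (2 * H) - |t - s| ^ (2 * H)) / 2

/-- `W` is a `d`-dimensional fractional Brownian motion of Hurst parameter `H` with continuous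
sample paths: the coordinates are independent centered Gaussian processes with the fBm
covariance, expressed by asking every finite linear combination to be Gaussian. -/
def IsFBM {Ω : Type*} [MeasureSpace Ω] (d : ℕ) (H : ℝ) (W : Ω → ℝ → Euc d) : Prop :=
  (∀ ω, ContinuousOn (W ω) (Set.Icc 0 1)) ∧
  (∀ t, Measurable fun ω => W ω t) ∧
  (∀ ω, W ω 0 = 0) ∧
  ∀ (n : ℕ) (c : Fin n → ℝ) (t : Fin n → ℝ) (j : Fin n → Fin d),
    (∀ k, t k ∈ Set.Icc (0 : ℝ) 1) →
    Measure.map (fun ω => ∑ k, c k * W ω (t k) (j k)) (volume : Measure Ω) =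
      ProbabilityTheory.gaussianReal 0
        (Real.toNNReal (∑ k, ∑ l, c k * c l *
          (if j k = j l then fbmCov H (t k) (t l) else 0)))

/-- `R^w_λ = (∫_0^1 exp(λ |w_u|²) du)^{1/λ}`. -/
def Rconst {d : ℕ} (lam : ℝ) (w : ℝ → Euc d) : ℝ≥0∞ :=
  (∫⁻ u in Set.Icc (0 : ℝ) 1, ENNReal.ofReal (Real.exp (lam * ‖w u‖ ^ 2))) ^ (1 / lam)

/-- `S^w_λ`. -/
def Sconst {d : ℕ} (H lam : ℝ) (w : ℝ → Euc d) : ℝ≥0∞ :=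
  (∑' n : ℕ, ∑' m : ℕ, ∑ k ∈ Finset.range (2 ^ n), ∑' q : ℤ × (Fin d → ℤ),
    ENNReal.ofReal (
      (2 : ℝ) ^ (-(2 * (n : ℝ)) - (m : ℝ) * ((d : ℝ) + 2)) *
      (1 + |(q.1 : ℝ) / 2 ^ m|) ^ (-(2 : ℝ)) *
      (1 + ‖(EuclideanSpace.equiv (Fin d) ℝ).symm (fun i => (q.2 i : ℝ) / 2 ^ m)‖) ^
        (-((d : ℝ) + 1)) *
      Real.exp (lam * 2 ^ n *
        (1 + ‖(EuclideanSpace.equiv (Fin d) ℝ).symm (fun i => (q.2 i : ℝ) / 2 ^ m)‖) ^ (1 / H) *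
        ‖Yint w ((k : ℝ) / 2 ^ n) (((k : ℝ) + 1) / 2 ^ n) ((q.1 : ℝ) / 2 ^ m)
          ((EuclideanSpace.equiv (Fin d) ℝ).symm (fun i => (q.2 i : ℝ) / 2 ^ m))‖ ^ 2))) ^
  (1 / lam)

/-- `Q^w_λ = √(log S^w_λ) + √(log R^w_λ)`. -/
def Qconst {d : ℕ} (H lam : ℝ) (w : ℝ → Euc d) : ℝ :=
  Real.sqrt (Real.log (Sconst H lam w).toReal) + Real.sqrt (Real.log (Rconst lam w).toReal)

namespace FBMReg

/-- The kernel `y ↦ (-y)_+^p` of the moving average representation. -/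
def mvnKernel (p y : ℝ) : ℝ := if y < 0 then (-y) ^ p else 0

lemma measurable_mvnKernel (p : ℝ) : Measurable (mvnKernel p) := by
  unfold mvnKernel
  exact Measurable.ite measurableSet_Iio (by fun_prop) measurable_const

lemma mvnKernel_mul {p t : ℝ} (ht : 0 < t) (y : ℝ) :
    mvnKernel p (t * y) = t ^ p * mvnKernel p y := by
  unfold mvnKernel
  by_cases hy : y < 0
  · have h1 : t * y < 0 := mul_neg_of_pos_of_neg ht hy
    rw [if_pos h1, if_pos hy, ← mul_neg, Real.mul_rpow ht.le (by linarith)]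
  · have h1 : ¬ t * y < 0 := by
      push Not at hy ⊢
      positivity
    rw [if_neg h1, if_neg hy, mul_zero]

/-- Unit increment of the kernel is square integrable. -/
lemma memLp_mvnKernel_one {p : ℝ} (hp0 : 0 ≤ p) (hp : p < 1 / 2) :
    MemLp (fun y => mvnKernel p (y - 1) - mvnKernel p y) 2 := by
  have hmeas : Measurable (fun y => mvnKernel p (y - 1) - mvnKernel p y) :=
    ((measurable_mvnKernel p).comp (measurable_id.sub_const 1)).sub (measurable_mvnKernel p)
  rw [memLp_two_iff_integrable_sq hmeas.aestronglyMeasurable]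
  have hI : Integrable (fun y : ℝ => (Set.indicator (Set.Icc (-1) 1) (fun _ => (1 : ℝ)) y) +
      (Set.indicator (Set.Ioi 1) (fun z : ℝ => z ^ (2 * p - 2)) (-y))) := by
    refine Integrable.add ?_ ?_
    · exact (integrable_indicator_iff measurableSet_Icc).2 (by simp)
    · have : Integrable (Set.indicator (Set.Ioi (1 : ℝ)) (fun z : ℝ => z ^ (2 * p - 2))) := by
        rw [integrable_indicator_iff measurableSet_Ioi]
        exact integrableOn_Ioi_rpow_of_lt (by linarith) one_pos
      exact this.comp_neg
  refine hI.mono' (hmeas.pow_const 2).aestronglyMeasurable (ae_of_all _ fun y => ?_)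
  rw [Real.norm_eq_abs, abs_of_nonneg (sq_nonneg _)]
  have hb : 0 ≤ Set.indicator (Set.Ioi 1) (fun z : ℝ => z ^ (2 * p - 2)) (-y) := by
    refine Set.indicator_nonneg (fun z hz => ?_) _
    have : (0 : ℝ) < z := lt_trans one_pos hz
    positivity
  have ha : 0 ≤ Set.indicator (Set.Icc (-1 : ℝ) 1) (fun _ => (1 : ℝ)) y :=
    Set.indicator_nonneg (fun z hz => zero_le_one) _
  have key : ∀ z : ℝ, 0 ≤ z → (1 + z) ^ p - z ^ p ≤ 1 ∧ 0 ≤ (1 + z) ^ p - z ^ p := by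
    intro z hz
    constructor
    · have := Real.rpow_add_le_add_rpow zero_le_one hz hp0 (by linarith : p ≤ 1)
      rw [Real.one_rpow] at this; linarith
    · have := Real.rpow_le_rpow hz (by linarith : z ≤ 1 + z) hp0
      linarith
  unfold mvnKernel
  rcases le_or_gt 1 y with h1 | h1
  · rw [if_neg (by linarith), if_neg (by linarith)]
    rw [sub_self, zero_pow two_ne_zero]; exact add_nonneg ha hb
  rcases le_or_gt 0 y with h2 | h2
  · rw [if_pos (by linarith), if_neg (by linarith), sub_zero]
    have : (-(y - 1)) ^ p ≤ 1 := Real.rpow_le_one (by linarith) (by linarith) hp0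
    have h0 : 0 ≤ (-(y - 1)) ^ p := Real.rpow_nonneg (by linarith) _
    have hy : y ∈ Set.Icc (-1 : ℝ) 1 := ⟨by linarith, h1.le⟩
    rw [Set.indicator_of_mem hy]
    nlinarith
  rw [if_pos (by linarith), if_pos h2]
  rcases le_or_gt (-1) y with h3 | h3
  · have hy : y ∈ Set.Icc (-1 : ℝ) 1 := ⟨by linarith, h1.le⟩
    rw [Set.indicator_of_mem hy]
    obtain ⟨k1, k2⟩ := key (-y) (by linarith)
    have : -(y - 1) = 1 + -y := by ring
    rw [this]
    nlinarith
  · have hy : -y ∈ Set.Ioi (1 : ℝ) := by simp only [Set.mem_Ioi]; linarith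
    rw [Set.indicator_of_mem hy]
    set z := -y with hz
    have hz1 : 1 < z := hy
    obtain ⟨k1, k2⟩ := key z (by linarith)
    have e : -(y - 1) = 1 + z := by rw [hz]; ring
    rw [e]
    have hle : (1 + z) ^ p - z ^ p ≤ z ^ (p - 1) := by
      have e2 : (1 + z) ^ p = z ^ p * (1 + z⁻¹) ^ p := by
        rw [← Real.mul_rpow (by linarith) (by positivity)]
        congr 1
        field_simp
        ring
      have e3 : (1 + z⁻¹) ^ p ≤ 1 + z⁻¹ := by
        have : (1 + z⁻¹) ^ p ≤ (1 + z⁻¹) ^ (1 : ℝ) :=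
          Real.rpow_le_rpow_of_exponent_le (by simp; linarith) (by linarith)
        rwa [Real.rpow_one] at this
      have e4 : z ^ (p - 1) = z ^ p * z⁻¹ := by
        rw [Real.rpow_sub_one (by linarith)]; rfl
      rw [e2, e4]
      have : 0 ≤ z ^ p := Real.rpow_nonneg (by linarith) _
      nlinarith
    have e5 : z ^ (2 * p - 2) = (z ^ (p - 1)) ^ 2 := by
      rw [← Real.rpow_natCast, ← Real.rpow_mul (by linarith)]
      congr 1; push_cast; ring
    rw [e5]
    have : ((1 + z) ^ p - z ^ p) ^ 2 ≤ (z ^ (p - 1)) ^ 2 := pow_le_pow_left₀ k2 hle 2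
    linarith

lemma memLp_mvnKernel_pos {p : ℝ} (hp0 : 0 ≤ p) (hp : p < 1 / 2) {t : ℝ} (ht : 0 < t) :
    MemLp (fun y => mvnKernel p (y - t) - mvnKernel p y) 2 := by
  have hmeas : Measurable (fun y => mvnKernel p (y - t) - mvnKernel p y) :=
    ((measurable_mvnKernel p).comp (measurable_id.sub_const t)).sub (measurable_mvnKernel p)
  rw [memLp_two_iff_integrable_sq hmeas.aestronglyMeasurable]
  have h1 := (memLp_two_iff_integrable_sq
    (memLp_mvnKernel_one hp0 hp).aestronglyMeasurable).1 (memLp_mvnKernel_one hp0 hp)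
  have h2 := (h1.comp_mul_left' (inv_ne_zero ht.ne')).const_mul ((t ^ p) ^ 2)
  refine h2.congr (ae_of_all _ fun y => ?_)
  have e1 : mvnKernel p (y - t) = t ^ p * mvnKernel p (t⁻¹ * y - 1) := by
    rw [← mvnKernel_mul ht]; congr 1; field_simp
  have e2 : mvnKernel p y = t ^ p * mvnKernel p (t⁻¹ * y) := by
    rw [← mvnKernel_mul ht]; congr 1; field_simp
  simp only [e1, e2]
  ring

lemma integral_mvnKernel_pos {p : ℝ} {t : ℝ} (ht : 0 < t) :
    ∫ y, (mvnKernel p (y - t) - mvnKernel p y) ^ 2 =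
      t ^ (2 * p + 1) * ∫ y, (mvnKernel p (y - 1) - mvnKernel p y) ^ 2 := by
  have h := Measure.integral_comp_mul_left
    (fun y => (mvnKernel p (y - 1) - mvnKernel p y) ^ 2) t⁻¹
  have e : ∀ y, (mvnKernel p (y - t) - mvnKernel p y) ^ 2 = (t ^ p) ^ 2 *
      (mvnKernel p (t⁻¹ * y - 1) - mvnKernel p (t⁻¹ * y)) ^ 2 := by
    intro y
    have e1 : mvnKernel p (y - t) = t ^ p * mvnKernel p (t⁻¹ * y - 1) := by
      rw [← mvnKernel_mul ht]; congr 1; field_simp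
    have e2 : mvnKernel p y = t ^ p * mvnKernel p (t⁻¹ * y) := by
      rw [← mvnKernel_mul ht]; congr 1; field_simp
    simp only [e1, e2]
    ring
  simp_rw [e]
  rw [integral_const_mul, h, inv_inv, abs_of_pos ht, smul_eq_mul, ← mul_assoc]
  congr 1
  rw [Real.rpow_add ht, Real.rpow_one, ← Real.rpow_natCast, ← Real.rpow_mul ht.le]
  congr 2
  push_cast; ring

lemma memLp_mvnKernel_sub {p : ℝ} (hp0 : 0 ≤ p) (hp : p < 1 / 2) {s t : ℝ} :
    MemLp (fun y => mvnKernel p (y - t) - mvnKernel p (y - s)) 2 := by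
  have main : ∀ s t : ℝ, s < t → MemLp (fun y => mvnKernel p (y - t) - mvnKernel p (y - s)) 2 := by
    intro s t hst
    have h := (memLp_mvnKernel_pos hp0 hp (sub_pos.2 hst)).comp_measurePreserving
      (measurePreserving_sub_right volume s)
    refine h.congr_norm ?_ (ae_of_all _ fun y => ?_)
    · exact (((measurable_mvnKernel p).comp (measurable_id.sub_const t)).sub
        ((measurable_mvnKernel p).comp (measurable_id.sub_const s))).aestronglyMeasurable
    · simp only [Function.comp]
      congr 3; ring
  rcases lt_trichotomy s t with h | h | h
  · exact main s t h
  · subst h; simp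
  · have := (main t s h).neg
    refine this.congr_norm ?_ (ae_of_all _ fun y => ?_)
    · exact (((measurable_mvnKernel p).comp (measurable_id.sub_const t)).sub
        ((measurable_mvnKernel p).comp (measurable_id.sub_const s))).aestronglyMeasurable
    · simp

lemma integral_mvnKernel_sub {p : ℝ} (hp0 : 0 ≤ p) (s t : ℝ) :
    ∫ y, (mvnKernel p (y - t) - mvnKernel p (y - s)) ^ 2 =
      |t - s| ^ (2 * p + 1) * ∫ y, (mvnKernel p (y - 1) - mvnKernel p y) ^ 2 := by
  have main : ∀ s t : ℝ, s < t → ∫ y, (mvnKernel p (y - t) - mvnKernel p (y - s)) ^ 2 =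
      |t - s| ^ (2 * p + 1) * ∫ y, (mvnKernel p (y - 1) - mvnKernel p y) ^ 2 := by
    intro s t hst
    rw [abs_of_pos (sub_pos.2 hst), ← integral_mvnKernel_pos (sub_pos.2 hst),
      ← integral_sub_right_eq_self
        (fun y => (mvnKernel p (y - (t - s)) - mvnKernel p y) ^ 2) s]
    congr 1; ext y
    congr 3; ring
  rcases lt_trichotomy s t with h | h | h
  · exact main s t h
  · subst h
    simp [Real.zero_rpow (by linarith : 2 * p + 1 ≠ 0)]
  · rw [abs_sub_comm, ← main t s h]
    congr 1; ext y; ring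

/-- A Hilbert space model of the fractional Brownian motion covariance with one-sided strong local
nondeterminism. -/
lemma exists_fbm_model {H : ℝ} (hH : 1 / 2 ≤ H) (hH1 : H < 1) :
    ∃ F : ℝ → Lp ℝ 2 (volume : Measure ℝ), ∃ c > 0,
      (∀ s t, 0 ≤ s → 0 ≤ t → inner ℝ (F s) (F t) = fbmCov H s t) ∧
      ∀ r u, 0 ≤ r → r < u → ∀ f ∈ Submodule.span ℝ (F '' Set.Icc 0 r),
        c * (u - r) ^ (2 * H) ≤ ‖F u - f‖ ^ 2 := by
  obtain ⟨p, hp⟩ : ∃ p, p = H - 1 / 2 := ⟨_, rfl⟩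
  have hp0 : 0 ≤ p := by linarith
  have hp1 : p < 1 / 2 := by linarith
  have h2H : 2 * p + 1 = 2 * H := by rw [hp]; ring
  set κ := ∫ y, (mvnKernel p (y - 1) - mvnKernel p y) ^ 2 with hκ
  have hm : ∀ t, MemLp (fun y => mvnKernel p (y - t) - mvnKernel p (y - 0)) 2 :=
    fun t => memLp_mvnKernel_sub hp0 hp1
  set F0 : ℝ → Lp ℝ 2 (volume : Measure ℝ) := fun t => (hm t).toLp with hF0
  have hdist : ∀ s t, ‖F0 t - F0 s‖ ^ 2 = κ * |t - s| ^ (2 * H) := by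
    intro s t
    rw [← real_inner_self_eq_norm_sq, L2.inner_def, ← h2H, mul_comm, ← integral_mvnKernel_sub hp0]
    refine integral_congr_ae ?_
    filter_upwards [Lp.coeFn_sub (F0 t) (F0 s), (hm t).coeFn_toLp, (hm s).coeFn_toLp]
      with y h1 h2 h3
    rw [h1, Pi.sub_apply, h2, h3]
    simp [sq]
  have hF00 : F0 0 = 0 := by
    simp only [hF0]
    rw [← MemLp.toLp_zero (MemLp.zero : MemLp (0 : ℝ → ℝ) 2 volume)]
    exact MemLp.toLp_congr _ _ (ae_of_all _ fun y => by simp)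
  have hnorm : ∀ t, 0 ≤ t → ‖F0 t‖ ^ 2 = κ * t ^ (2 * H) := by
    intro t ht
    have := hdist 0 t
    rwa [hF00, sub_zero, sub_zero, abs_of_nonneg ht] at this
  have hvan : ∀ r, 0 ≤ r → ∀ f ∈ Submodule.span ℝ (F0 '' Set.Icc 0 r),
      (f : ℝ → ℝ) =ᵐ[volume.restrict (Set.Ioi r)] 0 := by
    intro r hr f hf
    induction hf using Submodule.span_induction with
    | mem x hx =>
      obtain ⟨s, hs, rfl⟩ := hx
      filter_upwards [ae_restrict_of_ae (hm s).coeFn_toLp, ae_restrict_mem measurableSet_Ioi]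
        with y h1 h2
      rw [hF0, h1]
      have : r < y := h2
      have hs2 := hs.2
      simp only [mvnKernel, Pi.zero_apply]
      rw [if_neg (by linarith), if_neg (by linarith), sub_zero]
    | zero => exact ae_restrict_of_ae (Lp.coeFn_zero _ _ _)
    | add x y _ _ hx hy =>
      filter_upwards [ae_restrict_of_ae (Lp.coeFn_add x y), hx, hy] with z h1 h2 h3
      rw [h1, Pi.add_apply, h2, h3]; simp
    | smul a x _ hx =>
      filter_upwards [ae_restrict_of_ae (Lp.coeFn_smul a x), hx] with z h1 h2
      rw [h1, Pi.smul_apply, h2]; simp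
  have hlow : ∀ r u, 0 ≤ r → r < u → ∀ f ∈ Submodule.span ℝ (F0 '' Set.Icc 0 r),
      (2 * H)⁻¹ * (u - r) ^ (2 * H) ≤ ‖F0 u - f‖ ^ 2 := by
    intro r u hr hru f hf
    rw [← real_inner_self_eq_norm_sq, L2.inner_def]
    have hint : Integrable (fun y => inner ℝ ((F0 u - f : Lp ℝ 2 volume) y)
      ((F0 u - f : Lp ℝ 2 volume) y)) := L2.integrable_inner _ _
    have h1 : ∫ y in Set.Ioc r u, inner ℝ ((F0 u - f : Lp ℝ 2 volume) y)
      ((F0 u - f : Lp ℝ 2 volume) y) ≤ ∫ y, inner ℝ ((F0 u - f : Lp ℝ 2 volume) y)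
      ((F0 u - f : Lp ℝ 2 volume) y) :=
      setIntegral_le_integral hint (ae_of_all _ fun y => real_inner_self_nonneg)
    refine le_trans (le_of_eq ?_) h1
    have h2 : ∫ y in Set.Ioc r u, inner ℝ ((F0 u - f : Lp ℝ 2 volume) y)
      ((F0 u - f : Lp ℝ 2 volume) y) = ∫ y in Set.Ioc r u, (u - y) ^ (2 * H - 1) := by
      refine integral_congr_ae ?_
      have hv := ae_restrict_of_ae_restrict_of_subset
        (Set.Ioc_subset_Ioi_self : Set.Ioc r u ⊆ Set.Ioi r)
        (hvan r hr f hf)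
      have hu : ∀ᵐ y ∂(volume.restrict (Set.Ioc r u)), y ≠ u := by
        refine ae_restrict_of_ae ?_
        exact (measure_eq_zero_iff_ae_notMem.1 (measure_singleton u)).mono fun y hy => hy
      filter_upwards [ae_restrict_of_ae (Lp.coeFn_sub (F0 u) f),
        ae_restrict_of_ae (hm u).coeFn_toLp, hv, hu, ae_restrict_mem measurableSet_Ioc]
        with y h1 h2 h3 h4 h5
      have hyu : y < u := lt_of_le_of_ne h5.2 h4
      rw [h1, Pi.sub_apply, h3, h2]
      simp only [Pi.zero_apply, sub_zero]
      have e : mvnKernel p (y - u) - mvnKernel p y = (u - y) ^ p := by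
        simp only [mvnKernel]
        rw [if_pos (by linarith), if_neg (by linarith [h5.1]), sub_zero, neg_sub]
      rw [e]
      have : 2 * H - 1 = p + p := by rw [hp]; ring
      rw [this, Real.rpow_add (by linarith)]
      simp [sq]
    rw [h2, ← intervalIntegral.integral_of_le hru.le,
      intervalIntegral.integral_comp_sub_left (fun z => z ^ (2 * H - 1)) u, sub_self,
      integral_rpow (Or.inl (by linarith))]
    have : 2 * H - 1 + 1 = 2 * H := by ring
    rw [this, Real.zero_rpow (by linarith), sub_zero]
    field_simp
  have hκpos : 0 < κ := by
    have h1 := hlow 0 1 le_rfl one_pos 0 (Submodule.zero_mem _)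
    have h2 : ‖F0 1 - 0‖ ^ 2 = κ := by
      have := hdist 0 1
      rwa [hF00, sub_zero (1 : ℝ), abs_one, Real.one_rpow, mul_one] at this
    rw [h2, sub_zero, Real.one_rpow, mul_one] at h1
    refine lt_of_lt_of_le ?_ h1
    positivity
  have hsq : √κ * √κ = κ := Real.mul_self_sqrt hκpos.le
  have hsqpos : 0 < √κ := Real.sqrt_pos.2 hκpos
  refine ⟨fun t => (√κ)⁻¹ • F0 t, κ⁻¹ * (2 * H)⁻¹, by positivity, ?_, ?_⟩
  · intro s t hs ht
    have h1 := hdist s t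
    rw [norm_sub_sq_real, hnorm s hs, hnorm t ht, real_inner_comm] at h1
    rw [real_inner_smul_left, real_inner_smul_right, fbmCov]
    have : inner ℝ (F0 s) (F0 t) = κ * ((s ^ (2 * H) + t ^ (2 * H) - |t - s| ^ (2 * H)) / 2) := by
      linarith
    rw [this, ← mul_assoc, ← mul_assoc, ← mul_inv, hsq, inv_mul_cancel₀ hκpos.ne', one_mul]
  · intro r u hr hru f hf
    have hf' : √κ • f ∈ Submodule.span ℝ (F0 '' Set.Icc 0 r) := by
      refine Submodule.smul_mem _ _ (Submodule.span_le.2 ?_ hf)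
      rintro _ ⟨s, hs, rfl⟩
      exact Submodule.smul_mem _ _ (Submodule.subset_span ⟨s, hs, rfl⟩)
    have h1 := hlow r u hr hru _ hf'
    have h2 : F0 u - √κ • f = √κ • ((√κ)⁻¹ • F0 u - f) := by
      rw [smul_sub, smul_smul, mul_inv_cancel₀ hsqpos.ne', one_smul]
    rw [h2, norm_smul, mul_pow, Real.norm_eq_abs, sq_abs, Real.sq_sqrt hκpos.le] at h1
    rw [mul_assoc, inv_mul_le_iff₀ hκpos]
    exact h1

open ProbabilityTheory in
lemma integral_exp_gaussian {Ω : Type*} [MeasureSpace Ω] {d : ℕ} {H : ℝ} {W : Ω → ℝ → Euc d}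
    (hW : IsFBM d H W) {F : ℝ → Lp ℝ 2 (volume : Measure ℝ)}
    (hF : ∀ s t, 0 ≤ s → 0 ≤ t → inner ℝ (F s) (F t) = fbmCov H s t)
    {ι : Type*} [Fintype ι] (t : ι → ℝ) (ht : ∀ i, t i ∈ Set.Icc (0 : ℝ) 1) (η : ι → Euc d) :
    ∫ ω, Complex.exp (Complex.I * Complex.ofReal (∑ i, inner ℝ (η i) (W ω (t i)))) =
      Complex.ofReal (Real.exp (-(∑ j, ‖∑ i, η i j • F (t i)‖ ^ 2) / 2)) := by
  classical
  let e : Fin (Fintype.card (ι × Fin d)) ≃ ι × Fin d := (Fintype.equivFin _).symm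
  have h := hW.2.2.2 _ (fun k => η (e k).1 (e k).2) (fun k => t (e k).1) (fun k => (e k).2)
    (fun k => ht _)
  have hsum : ∀ ω, ∑ k, η (e k).1 (e k).2 * W ω (t (e k).1) (e k).2 =
      ∑ i, inner ℝ (η i) (W ω (t i)) := by
    intro ω
    rw [Equiv.sum_comp e (fun x : ι × Fin d => η x.1 x.2 * W ω (t x.1) x.2),
      Fintype.sum_prod_type]
    refine Finset.sum_congr rfl fun i _ => ?_
    rw [PiLp.inner_apply]
    refine Finset.sum_congr rfl fun j _ => ?_
    simp [mul_comm]
  have hvar : (∑ k, ∑ l, η (e k).1 (e k).2 * η (e l).1 (e l).2 *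
      (if (e k).2 = (e l).2 then fbmCov H (t (e k).1) (t (e l).1) else 0)) =
      ∑ j, ‖∑ i, η i j • F (t i)‖ ^ 2 := by
    have e1 : ∀ k, ∑ l, η (e k).1 (e k).2 * η (e l).1 (e l).2 *
        (if (e k).2 = (e l).2 then fbmCov H (t (e k).1) (t (e l).1) else 0) =
        ∑ y : ι × Fin d, η (e k).1 (e k).2 * η y.1 y.2 *
        (if (e k).2 = y.2 then fbmCov H (t (e k).1) (t y.1) else 0) := fun k =>
      Equiv.sum_comp e (fun y : ι × Fin d => η (e k).1 (e k).2 * η y.1 y.2 *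
        (if (e k).2 = y.2 then fbmCov H (t (e k).1) (t y.1) else 0))
    simp_rw [e1]
    rw [Equiv.sum_comp e (fun x : ι × Fin d => ∑ y : ι × Fin d, η x.1 x.2 * η y.1 y.2 *
        (if x.2 = y.2 then fbmCov H (t x.1) (t y.1) else 0)), Fintype.sum_prod_type,
        Finset.sum_comm]
    refine Finset.sum_congr rfl fun j _ => ?_
    rw [← real_inner_self_eq_norm_sq, sum_inner]
    refine Finset.sum_congr rfl fun i _ => ?_
    rw [inner_sum, Fintype.sum_prod_type]
    refine Finset.sum_congr rfl fun i' _ => ?_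
    rw [Finset.sum_eq_single j]
    · rw [if_pos rfl, real_inner_smul_left, real_inner_smul_right, hF _ _ (ht i).1 (ht i').1]
      ring
    · intro b _ hb
      rw [if_neg (Ne.symm hb), mul_zero]
    · simp
  rw [hvar] at h
  simp_rw [hsum] at h
  have hmeas : Measurable fun ω => ∑ i, inner ℝ (η i) (W ω (t i)) := by
    refine Finset.measurable_sum _ fun i _ => ?_
    exact (measurable_const).inner (hW.2.1 (t i))
  have h1 : charFun (Measure.map (fun ω => ∑ i, inner ℝ (η i) (W ω (t i))) volume) 1 =
      ∫ ω, Complex.exp (Complex.I * Complex.ofReal (∑ i, inner ℝ (η i) (W ω (t i)))) := by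
    rw [charFun_apply_real, integral_map hmeas.aemeasurable (by fun_prop)]
    refine integral_congr_ae (ae_of_all _ fun ω => ?_)
    simp only
    congr 1
    push_cast
    ring
  rw [← h1, h, charFun_gaussianReal, Complex.ofReal_exp]
  congr 1
  have : 0 ≤ ∑ j, ‖∑ i, η i j • F (t i)‖ ^ 2 := by positivity
  rw [Real.coe_toNNReal _ this]
  push_cast
  ring

/-- Conditional decay of characteristic functions given finitely many past values. -/
lemma norm_integral_mul_exp_le {Ω : Type*} [MeasureSpace Ω]
    [IsProbabilityMeasure (volume : Measure Ω)] {d : ℕ} {H : ℝ} {W : Ω → ℝ → Euc d}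
    (hW : IsFBM d H W) {F : ℝ → Lp ℝ 2 (volume : Measure ℝ)} {c : ℝ}
    (hF : ∀ s t, 0 ≤ s → 0 ≤ t → inner ℝ (F s) (F t) = fbmCov H s t)
    (hc : ∀ r u, 0 ≤ r → r < u → ∀ f ∈ Submodule.span ℝ (F '' Set.Icc 0 r),
        c * (u - r) ^ (2 * H) ≤ ‖F u - f‖ ^ 2)
    {ι : Type*} [Fintype ι] (t : ι → ℝ) {r u : ℝ} (hr : 0 ≤ r) (hru : r < u) (hu : u ≤ 1)
    (ht : ∀ i, t i ∈ Set.Icc (0 : ℝ) r) (ξ : Euc d) {G : Ω → ℂ}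
    (hG : Measurable[MeasurableSpace.comap (fun ω i => W ω (t i)) inferInstance] G) :
    ‖∫ ω, G ω * Complex.exp (Complex.I * Complex.ofReal (inner ℝ ξ (W ω u)))‖ ≤
      Real.exp (-(c * ‖ξ‖ ^ 2 * (u - r) ^ (2 * H)) / 2) * ∫ ω, ‖G ω‖ := by
  classical
  have ht1 : ∀ i, t i ∈ Set.Icc (0 : ℝ) 1 := fun i => ⟨(ht i).1, (ht i).2.trans (hru.le.trans hu)⟩
  have hu1 : u ∈ Set.Icc (0 : ℝ) 1 := ⟨hr.trans hru.le, hu⟩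
  -- orthogonal projection of `F u` onto the past
  let S : Submodule ℝ (Lp ℝ 2 (volume : Measure ℝ)) := Submodule.span ℝ (Set.range fun i => F (t i))
  have : FiniteDimensional ℝ S := FiniteDimensional.span_of_finite ℝ (Set.finite_range _)
  have hPm : S.starProjection (F u) ∈ S := Submodule.starProjection_apply_mem S (F u)
  obtain ⟨a, ha⟩ := (Submodule.mem_span_range_iff_exists_fun ℝ).1 hPm
  obtain ⟨ρ, hρ⟩ : ∃ ρ, ρ = F u - ∑ i, a i • F (t i) := ⟨_, rfl⟩
  have horth : ∀ i, inner ℝ (F (t i)) ρ = 0 := by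
    intro i
    rw [hρ, ha]
    exact Submodule.sub_starProjection_mem_orthogonal (K := S) (F u) _
      (Submodule.subset_span ⟨i, rfl⟩)
  have hρn : c * (u - r) ^ (2 * H) ≤ ‖ρ‖ ^ 2 := by
    rw [hρ]
    refine hc r u hr hru _ ?_
    exact Submodule.sum_mem _ fun i _ => Submodule.smul_mem _ _
      (Submodule.subset_span ⟨t i, ht i, rfl⟩)
  let U : Ω → EuclideanSpace ℝ (ι × Fin d) := fun ω => WithLp.toLp 2 fun x => W ω (t x.1) x.2
  let Z : Ω → ℝ := fun ω => inner ℝ ξ (W ω u) - ∑ i, a i * inner ℝ ξ (W ω (t i))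
  have hWm : ∀ s, Measurable fun ω => W ω s := hW.2.1
  have hWc : ∀ s j, Measurable fun ω => W ω s j := fun s j =>
    (EuclideanSpace.proj (𝕜 := ℝ) j).continuous.measurable.comp (hWm s)
  have hUm : Measurable U := by
    refine (PiLp.continuous_toLp 2 _).measurable.comp ?_
    exact measurable_pi_lambda _ fun x => hWc _ _
  have hin : ∀ s, Measurable fun ω => inner ℝ ξ (W ω s) := fun s => measurable_const.inner (hWm s)
  have hZm : Measurable Z := (hin u).sub
    (Finset.measurable_sum _ fun i _ => (hin (t i)).const_mul (a i))
  -- joint characteristic function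
  have hjoint : ∀ (η : EuclideanSpace ℝ (ι × Fin d)) (z : ℝ),
      ∫ ω, Complex.exp (Complex.I * Complex.ofReal (inner ℝ η (U ω) + z * Z ω)) =
      Complex.ofReal (Real.exp (-(∑ j, ‖∑ i, η (i, j) • F (t i)‖ ^ 2) / 2)) *
        Complex.ofReal (Real.exp (-(z ^ 2 * ‖ξ‖ ^ 2 * ‖ρ‖ ^ 2) / 2)) := by
    intro η z
    have h := integral_exp_gaussian hW hF (ι := Option ι) (fun o => o.elim u t)
      (by rintro (_ | i); exacts [hu1, ht1 i])
      (fun o => o.elim (z • ξ) (fun i => WithLp.toLp 2 (fun j => η (i, j)) - (z * a i) • ξ))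
    rw [← Complex.ofReal_mul, ← Real.exp_add]
    convert h using 2
    · ext ω
      congr 3
      rw [Fintype.sum_option]
      simp only [Option.elim_none, Option.elim_some, inner_sub_left, real_inner_smul_left,
        Finset.sum_sub_distrib, Z, U]
      rw [PiLp.inner_apply, Fintype.sum_prod_type, mul_sub, Finset.mul_sum]
      simp only [PiLp.inner_apply]
      have : ∀ i, z * a i * ∑ j, inner ℝ (ξ j) (W ω (t i) j) =
        z * (a i * ∑ j, inner ℝ (ξ j) (W ω (t i) j)) := fun i => by ring
      simp only [this]
      ring
    · congr 1
      rw [← add_div, ← neg_add]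
      congr 2
      have hξ : ‖ξ‖ ^ 2 = ∑ j, ξ j ^ 2 := by
        rw [EuclideanSpace.norm_sq_eq]; simp
      rw [hξ, Finset.mul_sum, Finset.sum_mul, ← Finset.sum_add_distrib]
      refine Finset.sum_congr rfl fun j _ => ?_
      rw [Fintype.sum_option]
      simp only [Option.elim_none, Option.elim_some, PiLp.smul_apply, PiLp.sub_apply, smul_eq_mul]
      have e1 : (z * ξ j) • F u + ∑ i, (η (i, j) - z * a i * ξ j) • F (t i) =
          (∑ i, η (i, j) • F (t i)) + (z * ξ j) • ρ := by
        rw [hρ, smul_sub, Finset.smul_sum]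
        simp only [sub_smul, Finset.sum_sub_distrib, smul_smul]
        have : ∀ i, z * a i * ξ j = z * ξ j * a i := fun i => by ring
        simp only [this]
        abel
      rw [e1, norm_add_sq_real, inner_smul_right, sum_inner]
      have e2 : ∑ i, inner ℝ (η (i, j) • F (t i)) ρ = 0 := by
        refine Finset.sum_eq_zero fun i _ => ?_
        rw [real_inner_smul_left, horth, mul_zero]
      rw [e2, norm_smul, mul_pow, Real.norm_eq_abs, sq_abs]
      ring
  have hind : ProbabilityTheory.IndepFun U Z (volume : Measure Ω) := by
    rw [ProbabilityTheory.indepFun_iff_charFun_prod hUm.aemeasurable hZm.aemeasurable]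
    intro x
    rw [charFun_apply, charFun_apply, charFun_apply_real, integral_map (by fun_prop) (by fun_prop),
      integral_map (by fun_prop) (by fun_prop), integral_map (by fun_prop) (by fun_prop)]
    have h1 := hjoint x.fst x.snd
    have h2 := hjoint x.fst 0
    have h3 := hjoint 0 x.snd
    simp only [zero_mul, add_zero, inner_zero_left, zero_add, PiLp.zero_apply, zero_smul,
      Finset.sum_const_zero, norm_zero, ne_eq, OfNat.ofNat_ne_zero, not_false_eq_true, zero_pow,
      neg_zero, zero_div, Real.exp_zero, Complex.ofReal_one, one_mul, mul_one] at h2 h3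
    rw [← h2, ← h3] at h1
    convert h1 using 2
    · ext ω
      rw [mul_comm]
      congr 3
      rw [WithLp.prod_inner_apply, real_inner_comm]
      simp [mul_comm]
    · refine integral_congr_ae (ae_of_all _ fun ω => ?_)
      simp only
      rw [mul_comm, real_inner_comm]; rfl
    · refine integral_congr_ae (ae_of_all _ fun ω => ?_)
      simp only
      rw [mul_comm]; push_cast; rfl
  -- factorisation
  have hcomap : MeasurableSpace.comap (fun ω i => W ω (t i)) inferInstance ≤
      MeasurableSpace.comap U inferInstance := by
    have : (fun ω i => W ω (t i)) = (fun v : EuclideanSpace ℝ (ι × Fin d) =>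
        fun i => (WithLp.toLp 2 fun j => v (i, j) : Euc d)) ∘ U := rfl
    rw [this, ← MeasurableSpace.comap_comp]
    refine MeasurableSpace.comap_mono ?_
    rw [← measurable_iff_comap_le]
    refine measurable_pi_lambda _ fun i => ?_
    refine (PiLp.continuous_toLp 2 _).measurable.comp (measurable_pi_lambda _ fun j => ?_)
    exact (EuclideanSpace.proj (𝕜 := ℝ) (i, j)).continuous.measurable
  let A : Ω → ℂ := fun ω => G ω * Complex.exp (Complex.I * Complex.ofReal
    (∑ i, a i * inner ℝ ξ (W ω (t i))))
  have hAm : Measurable[MeasurableSpace.comap U inferInstance] A := by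
    refine (hG.mono hcomap le_rfl).mul ?_
    refine Complex.measurable_exp.comp (measurable_const.mul (Complex.measurable_ofReal.comp ?_))
    refine Finset.measurable_sum _ fun i _ => measurable_const.mul ?_
    have h1 : Measurable[MeasurableSpace.comap (fun ω i => W ω (t i)) inferInstance]
        (fun ω => inner ℝ ξ (W ω (t i))) := by
      have hξ : Measurable fun x : Euc d => (inner ℝ ξ x : ℝ) := by fun_prop
      exact (hξ.comp (measurable_pi_apply i)).comp (comap_measurable fun ω i => W ω (t i))
    exact h1.mono hcomap le_rfl
  have hAm' : Measurable A := hAm.mono hUm.comap_le le_rfl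
  let E : Ω → ℂ := fun ω => Complex.exp (Complex.I * Complex.ofReal (Z ω))
  have hEm : Measurable[MeasurableSpace.comap Z inferInstance] E := by
    refine Complex.measurable_exp.comp (measurable_const.mul (Complex.measurable_ofReal.comp ?_))
    exact comap_measurable Z
  have hEm' : Measurable E := hEm.mono hZm.comap_le le_rfl
  have hindAE : ProbabilityTheory.IndepFun A E (volume : Measure Ω) := by
    rw [ProbabilityTheory.IndepFun_iff_Indep] at hind ⊢
    exact ProbabilityTheory.indep_of_indep_of_le_left
      (ProbabilityTheory.indep_of_indep_of_le_right hind hEm.comap_le) hAm.comap_le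
  have hprod : ∫ ω, G ω * Complex.exp (Complex.I * Complex.ofReal (inner ℝ ξ (W ω u))) =
      (∫ ω, A ω) * ∫ ω, E ω := by
    rw [← hindAE.integral_fun_mul_eq_mul_integral hAm'.aestronglyMeasurable
      hEm'.aestronglyMeasurable]
    refine integral_congr_ae (ae_of_all _ fun ω => ?_)
    simp only [A, E, Z]
    rw [mul_assoc, ← Complex.exp_add]
    congr 2
    push_cast; ring
  have hEval : ∫ ω, E ω = Complex.ofReal (Real.exp (-(‖ξ‖ ^ 2 * ‖ρ‖ ^ 2) / 2)) := by
    have h3 := hjoint 0 1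
    simpa [E] using h3
  rw [hprod, hEval, norm_mul, mul_comm]
  have hAn : ‖∫ ω, A ω‖ ≤ ∫ ω, ‖G ω‖ := by
    refine (norm_integral_le_integral_norm _).trans (le_of_eq ?_)
    refine integral_congr_ae (ae_of_all _ fun ω => ?_)
    simp only [A]
    rw [norm_mul, mul_comm Complex.I, Complex.norm_exp_ofReal_mul_I, mul_one]
  refine mul_le_mul ?_ hAn (norm_nonneg _) (Real.exp_pos _).le
  rw [Complex.norm_real, Real.norm_eq_abs, abs_of_pos (Real.exp_pos _)]
  refine Real.exp_le_exp.2 ?_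
  have := mul_le_mul_of_nonneg_left hρn (sq_nonneg ‖ξ‖)
  nlinarith

/-- One step of the exponential moment recursion. -/
lemma integral_exp_two_step_le {Ω : Type*} [MeasureSpace Ω]
    [IsProbabilityMeasure (volume : Measure Ω)] {S U V : Ω → ℝ} {lam l δ K : ℝ}
    (hSm : Measurable S) (hUm : Measurable U) (hVm : Measurable V) (hSb : ∀ ω, |S ω| ≤ K)
    (hU : ∀ ω, |U ω| ≤ l) (hV : ∀ ω, |V ω| ≤ l) (hlam : 0 ≤ lam) (hl : 0 ≤ l)
    (hlam1 : lam * l ≤ 1) (hδ : 0 ≤ δ)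
    (hcond : ∫ ω, Real.exp (lam * S ω) * V ω ≤ δ * l * ∫ ω, Real.exp (lam * S ω)) :
    ∫ ω, Real.exp (lam * (S ω + U ω + V ω)) ≤
      (∫ ω, Real.exp (lam * (S ω + U ω))) *
        Real.exp (7 * (lam * l) ^ 2 + 3 * δ * (lam * l)) := by
  have hint : ∀ f : Ω → ℝ, Measurable f → (∃ D, ∀ ω, |f ω| ≤ D) → Integrable f := by
    rintro f hf ⟨D, hD⟩
    exact Integrable.of_bound hf.aestronglyMeasurable D (ae_of_all _ hD)
  have hK : ∀ ω, lam * S ω ≤ lam * K := fun ω =>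
    mul_le_mul_of_nonneg_left ((le_abs_self _).trans (hSb ω)) hlam
  have hlU : ∀ ω, |lam * U ω| ≤ lam * l := fun ω => by
    rw [abs_mul, abs_of_nonneg hlam]; exact mul_le_mul_of_nonneg_left (hU ω) hlam
  have hlV : ∀ ω, |lam * V ω| ≤ lam * l := fun ω => by
    rw [abs_mul, abs_of_nonneg hlam]; exact mul_le_mul_of_nonneg_left (hV ω) hlam
  have i1 : Integrable fun ω => Real.exp (lam * S ω) := by
    refine hint _ (by fun_prop) ⟨Real.exp (lam * K), fun ω => ?_⟩
    rw [abs_of_pos (Real.exp_pos _)]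
    exact Real.exp_le_exp.2 (hK ω)
  have i2 : Integrable fun ω => Real.exp (lam * (S ω + U ω)) := by
    refine hint _ (by fun_prop) ⟨Real.exp (lam * K + 1), fun ω => ?_⟩
    rw [abs_of_pos (Real.exp_pos _)]
    refine Real.exp_le_exp.2 ?_
    linarith [hK ω, (le_abs_self _).trans (hlU ω)]
  have i3 : Integrable fun ω => Real.exp (lam * S ω) * V ω := by
    refine hint _ (by fun_prop) ⟨Real.exp (lam * K) * l, fun ω => ?_⟩
    rw [abs_mul, abs_of_pos (Real.exp_pos _)]
    exact mul_le_mul (Real.exp_le_exp.2 (hK ω)) (hV ω) (abs_nonneg _) (Real.exp_pos _).le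
  have i4 : Integrable fun ω => Real.exp (lam * (S ω + U ω + V ω)) := by
    refine hint _ (by fun_prop) ⟨Real.exp (lam * K + 1 + 1), fun ω => ?_⟩
    rw [abs_of_pos (Real.exp_pos _)]
    refine Real.exp_le_exp.2 ?_
    linarith [hK ω, (le_abs_self _).trans (hlU ω), (le_abs_self _).trans (hlV ω)]
  have hcomp : ∀ ω, Real.exp (lam * S ω) ≤ 3 * Real.exp (lam * (S ω + U ω)) := by
    intro ω
    have h1 : Real.exp (lam * S ω) ≤ Real.exp 1 * Real.exp (lam * (S ω + U ω)) := by
      rw [← Real.exp_add]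
      exact Real.exp_le_exp.2 (by linarith [(neg_le_abs _).trans (hlU ω)])
    have := Real.exp_one_lt_d9
    nlinarith [Real.exp_pos (lam * (S ω + U ω))]
  have hpt : ∀ ω, Real.exp (lam * (S ω + U ω + V ω)) ≤
      (1 + (lam * l) ^ 2) * Real.exp (lam * (S ω + U ω)) +
        (lam * (Real.exp (lam * S ω) * V ω) + 2 * (lam * l) ^ 2 * Real.exp (lam * S ω)) := by
    intro ω
    have e1 : Real.exp (lam * (S ω + U ω + V ω)) =
      Real.exp (lam * (S ω + U ω)) * Real.exp (lam * V ω) := by rw [← Real.exp_add]; ring_nf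
    have e2 : Real.exp (lam * (S ω + U ω)) = Real.exp (lam * S ω) * Real.exp (lam * U ω) := by
      rw [← Real.exp_add]; ring_nf
    have b1 : Real.exp (lam * V ω) ≤ 1 + lam * V ω + (lam * l) ^ 2 := by
      have := Real.abs_exp_sub_one_sub_id_le (x := lam * V ω) ((hlV ω).trans hlam1)
      have h2 : (lam * V ω) ^ 2 ≤ (lam * l) ^ 2 := by
        rw [← sq_abs]; exact pow_le_pow_left₀ (abs_nonneg _) (hlV ω) 2
      linarith [(le_abs_self _).trans this]
    have b2 : |Real.exp (lam * U ω) - 1| ≤ 2 * (lam * l) := by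
      refine (Real.abs_exp_sub_one_le ((hlU ω).trans hlam1)).trans ?_
      linarith [hlU ω]
    have b3 : (Real.exp (lam * U ω) - 1) * (lam * V ω) ≤ 2 * (lam * l) ^ 2 := by
      refine (le_abs_self _).trans ?_
      rw [abs_mul]
      calc _ ≤ (2 * (lam * l)) * (lam * l) :=
            mul_le_mul b2 (hlV ω) (abs_nonneg _) (by positivity)
        _ = _ := by ring
    have p1 := Real.exp_pos (lam * (S ω + U ω))
    have p2 := Real.exp_pos (lam * S ω)
    rw [e1]
    calc _ ≤ Real.exp (lam * (S ω + U ω)) * (1 + lam * V ω + (lam * l) ^ 2) :=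
          mul_le_mul_of_nonneg_left b1 p1.le
      _ = (1 + (lam * l) ^ 2) * Real.exp (lam * (S ω + U ω)) +
          (lam * (Real.exp (lam * S ω) * V ω) +
            ((Real.exp (lam * U ω) - 1) * (lam * V ω)) * Real.exp (lam * S ω)) := by
          rw [e2]; ring
      _ ≤ _ := by gcongr
  have hI := integral_mono i4 ((i2.const_mul _).add ((i3.const_mul _).add (i1.const_mul _))) hpt
  rw [integral_add' (i2.const_mul _) ((i3.const_mul _).add (i1.const_mul _)),
    integral_add' (i3.const_mul _) (i1.const_mul _)] at hI
  simp only [integral_const_mul] at hI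
  have hcompI : ∫ ω, Real.exp (lam * S ω) ≤ 3 * ∫ ω, Real.exp (lam * (S ω + U ω)) := by
    rw [← integral_const_mul]
    exact integral_mono i1 (i2.const_mul _) hcomp
  have hA : 0 ≤ ∫ ω, Real.exp (lam * (S ω + U ω)) := integral_nonneg fun ω => (Real.exp_pos _).le
  generalize (∫ ω, Real.exp (lam * (S ω + U ω))) = A at *
  generalize (∫ ω, Real.exp (lam * S ω)) = A0 at *
  refine hI.trans ?_
  have e1 := Real.add_one_le_exp (7 * (lam * l) ^ 2 + 3 * δ * (lam * l))
  calc _ ≤ (1 + (lam * l) ^ 2) * A + (lam * (δ * l * A0) + 2 * (lam * l) ^ 2 * A0) := by gcongr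
    _ = (1 + (lam * l) ^ 2) * A + (δ * (lam * l) + 2 * (lam * l) ^ 2) * A0 := by ring
    _ ≤ (1 + (lam * l) ^ 2) * A + (δ * (lam * l) + 2 * (lam * l) ^ 2) * (3 * A) := by gcongr
    _ = A * (7 * (lam * l) ^ 2 + 3 * δ * (lam * l) + 1) := by ring
    _ ≤ _ := mul_le_mul_of_nonneg_left e1 hA

lemma integral_exp_sum_le {Ω : Type*} [MeasureSpace Ω]
    [IsProbabilityMeasure (volume : Measure Ω)] {R : ℕ → Ω → ℝ} {lam l δ : ℝ}
    (hRm : ∀ k, Measurable (R k)) (hR : ∀ k ω, |R k ω| ≤ l) (hlam : 0 ≤ lam) (hl : 0 ≤ l)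
    (hlam1 : lam * l ≤ 1) (hδ : 0 ≤ δ) (N : ℕ)
    (hcond : ∀ k, k + 1 < N → ∫ ω, Real.exp (lam * ∑ i ∈ Finset.range k, R i ω) * R (k + 1) ω ≤
      δ * l * ∫ ω, Real.exp (lam * ∑ i ∈ Finset.range k, R i ω)) :
    ∫ ω, Real.exp (lam * ∑ i ∈ Finset.range N, R i ω) ≤
      3 * Real.exp (N * (7 * (lam * l) ^ 2 + 3 * δ * (lam * l))) := by
  have hx : 0 ≤ 7 * (lam * l) ^ 2 + 3 * δ * (lam * l) := by positivity
  have hSm : ∀ k, Measurable fun ω => ∑ i ∈ Finset.range k, R i ω := fun k =>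
    Finset.measurable_sum _ fun i _ => hRm i
  have hSb : ∀ k ω, |∑ i ∈ Finset.range k, R i ω| ≤ k * l := fun k ω => by
    refine (Finset.abs_sum_le_sum_abs _ _).trans ?_
    refine (Finset.sum_le_sum fun i _ => hR i ω).trans ?_
    simp
  induction N with
  | zero => simp
  | succ N ih =>
    rcases N with _ | N
    · simp only [zero_add, Finset.range_one, Finset.sum_singleton]
      have h1 : ∫ ω, Real.exp (lam * R 0 ω) ≤ ∫ _ω : Ω, (3 : ℝ) := by
        have hb : ∀ ω, Real.exp (lam * R 0 ω) ≤ 3 := fun ω => by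
          have : lam * R 0 ω ≤ 1 :=
            (mul_le_mul_of_nonneg_left ((le_abs_self _).trans (hR 0 ω)) hlam).trans hlam1
          linarith [Real.exp_le_exp.2 this, Real.exp_one_lt_d9]
        refine integral_mono ?_ (integrable_const _) hb
        refine Integrable.of_bound ((hRm 0).const_mul lam).exp.aestronglyMeasurable 3
          (ae_of_all _ fun ω => ?_)
        rw [Real.norm_eq_abs, abs_of_pos (Real.exp_pos _)]
        exact hb ω
      refine h1.trans ?_
      simp only [integral_const, probReal_univ, smul_eq_mul, one_mul]
      have := Real.one_le_exp (x := ((0 : ℕ) + 1 : ℕ) * (7 * (lam * l) ^ 2 + 3 * δ * (lam * l)))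
        (by positivity)
      push_cast at this ⊢
      linarith
    · have ih' := ih (fun k hk => hcond k (by omega))
      have h2 := integral_exp_two_step_le (hSm N) (hRm N) (hRm (N + 1)) (hSb N) (hR N)
        (hR (N + 1)) hlam hl hlam1 hδ (hcond N (by omega))
      simp only [Finset.sum_range_succ] at ih' ⊢
      refine h2.trans ?_
      refine (mul_le_mul_of_nonneg_right ih' (Real.exp_pos _).le).trans (le_of_eq ?_)
      rw [mul_assoc, ← Real.exp_add]
      congr 2
      push_cast
      ring

lemma norm_pow_le_sum_exp (p : ℕ) (z : ℂ) :
    ‖z‖ ^ p ≤ 2 ^ p * p.factorial * (Real.exp z.re + Real.exp (-z.re) +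
      (Real.exp z.im + Real.exp (-z.im))) := by
  have key : ∀ x : ℝ, |x| ^ p ≤ p.factorial * (Real.exp x + Real.exp (-x)) := by
    intro x
    have h := Real.pow_div_factorial_le_exp |x| (abs_nonneg x) p
    rw [div_le_iff₀ (by positivity)] at h
    have h2 : Real.exp |x| ≤ Real.exp x + Real.exp (-x) := by
      rcases abs_cases x with ⟨h, _⟩ | ⟨h, _⟩ <;> rw [h] <;>
        linarith [Real.exp_pos x, Real.exp_pos (-x)]
    calc _ ≤ _ := h
      _ ≤ (Real.exp x + Real.exp (-x)) * p.factorial := by gcongr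
      _ = _ := mul_comm _ _
  have h1 : ‖z‖ ≤ 2 * max |z.re| |z.im| := by
    refine (Complex.norm_le_abs_re_add_abs_im z).trans ?_
    linarith [le_max_left |z.re| |z.im|, le_max_right |z.re| |z.im|]
  calc ‖z‖ ^ p ≤ (2 * max |z.re| |z.im|) ^ p := pow_le_pow_left₀ (norm_nonneg _) h1 p
    _ = 2 ^ p * max |z.re| |z.im| ^ p := mul_pow _ _ _
    _ ≤ 2 ^ p * (|z.re| ^ p + |z.im| ^ p) := by
        gcongr
        rcases max_cases |z.re| |z.im| with ⟨h, _⟩ | ⟨h, _⟩ <;> rw [h] <;>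
          linarith [pow_nonneg (abs_nonneg z.re) p, pow_nonneg (abs_nonneg z.im) p]
    _ ≤ 2 ^ p * (p.factorial * (Real.exp z.re + Real.exp (-z.re)) +
        p.factorial * (Real.exp z.im + Real.exp (-z.im))) := by
        gcongr <;> exact key _
    _ = _ := by ring

/-- Moment bound for sums of bounded variables with exponentially small conditional means
given the past up to the last but one index. -/
lemma integral_norm_sum_pow_le {Ω : Type*} [MeasureSpace Ω]
    [IsProbabilityMeasure (volume : Measure Ω)] {X : ℕ → Ω → ℂ} {l δ : ℝ}
    (hXm : ∀ k, Measurable (X k)) (hX : ∀ k ω, ‖X k ω‖ ≤ l) (hl : 0 < l) (hδ : 0 ≤ δ)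
    (N : ℕ) (hN : 0 < N)
    (hcond : ∀ k, k + 1 < N → ∀ (c : ℂ) (lam : ℝ),
      ‖∫ ω, (Real.exp (lam * ∑ i ∈ Finset.range k, (c * X i ω).re) : ℂ) * X (k + 1) ω‖ ≤
      δ * l * ∫ ω, Real.exp (lam * ∑ i ∈ Finset.range k, (c * X i ω).re)) (p : ℕ) :
    ∫ ω, ‖∑ k ∈ Finset.range N, X k ω‖ ^ p ≤
      2 ^ p * p.factorial * 12 * Real.exp (7 + 3 * δ * Real.sqrt N) * (l * Real.sqrt N) ^ p := by
  obtain ⟨lam, hlamdef⟩ : ∃ lam, lam = (l * Real.sqrt N)⁻¹ := ⟨_, rfl⟩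
  have hsN : 1 ≤ Real.sqrt N := Real.one_le_sqrt.2 (by exact_mod_cast hN)
  have hlam : 0 < lam := by rw [hlamdef]; positivity
  have hll : lam * l = (Real.sqrt N)⁻¹ := by rw [hlamdef]; field_simp
  have hlam1 : lam * l ≤ 1 := by rw [hll]; exact inv_le_one_of_one_le₀ hsN
  have hexp : ∀ c : ℂ, ‖c‖ = 1 → ∫ ω, Real.exp (lam * ∑ i ∈ Finset.range N, (c * X i ω).re) ≤
      3 * Real.exp (7 + 3 * δ * Real.sqrt N) := by
    intro c hc
    have hre : ∀ k ω, |(c * X k ω).re| ≤ l := fun k ω => by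
      refine (Complex.abs_re_le_norm _).trans ?_
      rw [norm_mul, hc, one_mul]; exact hX k ω
    have h := integral_exp_sum_le (R := fun k ω => (c * X k ω).re) (lam := lam) (l := l) (δ := δ)
      (fun k => Complex.measurable_re.comp ((hXm k).const_mul c)) hre hlam.le hl.le hlam1 hδ N ?_
    · refine h.trans (le_of_eq ?_)
      congr 2
      rw [hll]
      have h0 : Real.sqrt N ≠ 0 := by positivity
      have h1 : (N : ℝ) = Real.sqrt N ^ 2 := (Real.sq_sqrt (by positivity)).symm
      generalize Real.sqrt N = s at *
      rw [h1]
      field_simp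
    · intro k hk
      have hG : Integrable fun ω => (Real.exp (lam * ∑ i ∈ Finset.range k, (c * X i ω).re) : ℂ) *
          X (k + 1) ω := by
        refine Integrable.of_bound (C := Real.exp (lam * (k * l)) * l) ?_ (ae_of_all _ fun ω => ?_)
        · refine Measurable.aestronglyMeasurable ?_
          refine (Complex.measurable_ofReal.comp (Real.measurable_exp.comp
            (measurable_const.mul (Finset.measurable_sum _ fun i _ => ?_)))).mul (hXm _)
          exact Complex.measurable_re.comp ((hXm i).const_mul c)
        · rw [norm_mul, Complex.norm_real, Real.norm_eq_abs, abs_of_pos (Real.exp_pos _)]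
          refine mul_le_mul (Real.exp_le_exp.2 (mul_le_mul_of_nonneg_left ?_ hlam.le)) (hX _ _)
            (norm_nonneg _) (Real.exp_pos _).le
          refine (Finset.sum_le_sum fun i _ => (le_abs_self _).trans (hre i ω)).trans ?_
          simp
      have e1 : ∫ ω, Real.exp (lam * ∑ i ∈ Finset.range k, (c * X i ω).re) * (c * X (k + 1) ω).re =
          (c * ∫ ω, (Real.exp (lam * ∑ i ∈ Finset.range k, (c * X i ω).re) : ℂ) *
            X (k + 1) ω).re := by
        rw [← integral_const_mul]
        have := (Complex.reCLM.integral_comp_comm (hG.const_mul c))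
        simp only [Complex.reCLM_apply] at this
        rw [← this]
        refine integral_congr_ae (ae_of_all _ fun ω => ?_)
        simp only
        rw [mul_left_comm, Complex.re_ofReal_mul]
      rw [e1]
      refine (Complex.re_le_norm _).trans ?_
      rw [norm_mul, hc, one_mul]
      exact hcond k hk c lam
  have hint : ∀ c : ℂ, Integrable fun ω =>
      Real.exp (lam * ∑ i ∈ Finset.range N, (c * X i ω).re) := by
    intro c
    refine Integrable.of_bound (C := Real.exp (lam * (N * (‖c‖ * l)))) ?_ (ae_of_all _ fun ω => ?_)
    · refine Measurable.aestronglyMeasurable ?_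
      refine Real.measurable_exp.comp
        (measurable_const.mul (Finset.measurable_sum _ fun i _ => ?_))
      exact Complex.measurable_re.comp ((hXm i).const_mul c)
    · rw [Real.norm_eq_abs, abs_of_pos (Real.exp_pos _)]
      refine Real.exp_le_exp.2 (mul_le_mul_of_nonneg_left ?_ hlam.le)
      refine (Finset.sum_le_sum fun i _ => (Complex.re_le_norm _).trans
        ((norm_mul_le _ _).trans (mul_le_mul_of_nonneg_left (hX i ω) (norm_nonneg _)))).trans ?_
      simp
  have hpt : ∀ ω, ‖∑ k ∈ Finset.range N, X k ω‖ ^ p ≤ (l * Real.sqrt N) ^ p *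
      (2 ^ p * p.factorial * (Real.exp (lam * ∑ i ∈ Finset.range N, ((1 : ℂ) * X i ω).re) +
        Real.exp (lam * ∑ i ∈ Finset.range N, ((-1 : ℂ) * X i ω).re) +
        (Real.exp (lam * ∑ i ∈ Finset.range N, (-Complex.I * X i ω).re) +
        Real.exp (lam * ∑ i ∈ Finset.range N, (Complex.I * X i ω).re)))) := by
    intro ω
    have h := norm_pow_le_sum_exp p ((lam : ℂ) * ∑ k ∈ Finset.range N, X k ω)
    rw [norm_mul, mul_pow, Complex.norm_real, Real.norm_eq_abs, abs_of_pos hlam, hlamdef,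
      inv_pow, inv_mul_le_iff₀ (by positivity), ← hlamdef] at h
    refine h.trans (le_of_eq ?_)
    congr 2
    simp only [Complex.re_ofReal_mul, Complex.im_ofReal_mul, Complex.re_sum, Complex.im_sum,
      one_mul, neg_mul, Complex.neg_re, Complex.I_mul_re, neg_neg, Finset.sum_neg_distrib, mul_neg]
  have hpos : 0 ≤ (l * Real.sqrt N) ^ p := by positivity
  refine (integral_mono_of_nonneg (ae_of_all _ fun ω => by positivity)
    (((((hint 1).add (hint (-1))).add ((hint (-Complex.I)).add (hint Complex.I))).const_mul
      (2 ^ p * p.factorial : ℝ)).const_mul _) (ae_of_all _ hpt)).trans ?_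
  rw [integral_const_mul, integral_const_mul, integral_add' ((hint _).add (hint _))
    ((hint _).add (hint _)), integral_add' (hint _) (hint _), integral_add' (hint _) (hint _)]
  have h1 := hexp 1 (by simp)
  have h2 := hexp (-1) (by simp)
  have h3 := hexp (-Complex.I) (by simp)
  have h4 := hexp Complex.I (by simp)
  calc _ ≤ (l * Real.sqrt N) ^ p * (2 ^ p * p.factorial *
        (3 * Real.exp (7 + 3 * δ * Real.sqrt N) + 3 * Real.exp (7 + 3 * δ * Real.sqrt N) +
        (3 * Real.exp (7 + 3 * δ * Real.sqrt N) + 3 * Real.exp (7 + 3 * δ * Real.sqrt N)))) := by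
        gcongr
    _ = _ := by ring

open ProbabilityTheory in
lemma eLpNorm_increment_le {Ω : Type*} [MeasureSpace Ω] {d : ℕ} {H : ℝ} {W : Ω → ℝ → Euc d}
    (hW : IsFBM d H W) (hH : 0 < H) (p : ℕ) (hp : 1 ≤ p) :
    ∃ C : ℝ, 0 ≤ C ∧ ∀ s ∈ Set.Icc (0 : ℝ) 1, ∀ t ∈ Set.Icc (0 : ℝ) 1,
      eLpNorm (fun ω => W ω t - W ω s) p volume ≤ ENNReal.ofReal (C * |t - s| ^ H) := by
  have hfin : eLpNorm (id : ℝ → ℝ) p (gaussianReal 0 1) < ⊤ :=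
    (memLp_id_gaussianReal (μ := 0) (v := 1) (p : ℝ≥0)).2
  refine ⟨d * (eLpNorm (id : ℝ → ℝ) p (gaussianReal 0 1)).toReal, by positivity, ?_⟩
  intro s hs t ht
  have hWc : ∀ s j, Measurable fun ω => W ω s j := fun s j =>
    (EuclideanSpace.proj (𝕜 := ℝ) j).continuous.measurable.comp (hW.2.1 s)
  have hcoord : ∀ j, eLpNorm (fun ω => W ω t j - W ω s j) p volume ≤
      ENNReal.ofReal (|t - s| ^ H) * eLpNorm (id : ℝ → ℝ) p (gaussianReal 0 1) := by
    intro j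
    have h := hW.2.2.2 2 ![1, -1] ![t, s] ![j, j] (by
      intro k; fin_cases k <;> simp only <;> assumption)
    have hv : (∑ k, ∑ l, (![1, -1] : Fin 2 → ℝ) k * (![1, -1] : Fin 2 → ℝ) l *
          (if (![j, j] : Fin 2 → Fin d) k = (![j, j] : Fin 2 → Fin d) l then
            fbmCov H ((![t, s] : Fin 2 → ℝ) k) ((![t, s] : Fin 2 → ℝ) l) else 0)) =
        (|t - s| ^ H) ^ 2 := by
      have h0 : (0 : ℝ) ^ (2 * H) = 0 := Real.zero_rpow (by positivity)
      have h2 : |t - s| ^ (2 * H) = (|t - s| ^ H) ^ 2 := by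
        rw [mul_comm, Real.rpow_mul (abs_nonneg _)]; norm_cast
      simp only [Fin.sum_univ_two, Matrix.cons_val_zero, Matrix.cons_val_one, if_true, fbmCov,
        sub_self, abs_zero, h0, abs_sub_comm s t, ← h2]
      ring
    rw [hv] at h
    have hf : (fun ω => ∑ k, (![1, -1] : Fin 2 → ℝ) k *
        W ω ((![t, s] : Fin 2 → ℝ) k) ((![j, j] : Fin 2 → Fin d) k)) =
        fun ω => W ω t j - W ω s j := by
      ext ω; simp [Fin.sum_univ_two]; ring
    rw [hf] at h
    have hmap : gaussianReal 0 (Real.toNNReal ((|t - s| ^ H) ^ 2)) =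
        (gaussianReal 0 1).map (fun x => |t - s| ^ H * x) := by
      rw [gaussianReal_map_const_mul, mul_zero, mul_one]
      congr 1
      rw [Real.toNNReal_of_nonneg (sq_nonneg _)]
    have e1 : eLpNorm (fun ω => W ω t j - W ω s j) p volume =
        eLpNorm (id : ℝ → ℝ) p (Measure.map (fun ω => W ω t j - W ω s j) volume) := by
      have hm : AEMeasurable (fun ω => W ω t j - W ω s j) := ((hWc t j).sub (hWc s j)).aemeasurable
      exact (eLpNorm_map_measure (g := (id : ℝ → ℝ)) measurable_id.aestronglyMeasurable hm).symm
    rw [e1, h, hmap, eLpNorm_map_measure (by fun_prop) (by fun_prop)]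
    have e2 : (id ∘ fun x : ℝ => |t - s| ^ H * x) = (|t - s| ^ H) • (id : ℝ → ℝ) := by
      ext x; simp
    rw [e2, eLpNorm_const_smul, Real.enorm_eq_ofReal (by positivity)]
  have hpt : ∀ ω, ‖W ω t - W ω s‖ ≤ ‖∑ j, |W ω t j - W ω s j|‖ := fun ω => by
    rw [Real.norm_eq_abs, abs_of_nonneg (by positivity), EuclideanSpace.norm_eq]
    refine Real.sqrt_le_iff.2 ⟨by positivity, ?_⟩
    refine (Finset.sum_sq_le_sq_sum_of_nonneg fun i _ => norm_nonneg _).trans (le_of_eq ?_)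
    simp
  calc eLpNorm (fun ω => W ω t - W ω s) p volume
      ≤ eLpNorm (fun ω => ∑ j, |W ω t j - W ω s j|) p volume := eLpNorm_mono hpt
    _ ≤ ∑ j, eLpNorm (fun ω => |W ω t j - W ω s j|) p volume := by
        have := eLpNorm_sum_le (s := Finset.univ) (p := (p : ℝ≥0∞)) (μ := (volume : Measure Ω))
          (f := fun j ω => |W ω t j - W ω s j|)
          (fun j _ => ((hWc t j).sub (hWc s j)).abs.aestronglyMeasurable) (by exact_mod_cast hp)
        refine le_trans (le_of_eq ?_) this
        congr 1; ext ω; simp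
    _ ≤ ∑ _j : Fin d, ENNReal.ofReal (|t - s| ^ H) *
          eLpNorm (id : ℝ → ℝ) p (gaussianReal 0 1) := by
        refine Finset.sum_le_sum fun j _ => ?_
        refine le_trans (le_of_eq ?_) (hcoord j)
        exact eLpNorm_congr_norm_ae (ae_of_all _ fun ω => by simp)
    _ = _ := by
        rw [Finset.sum_const, Finset.card_univ, Fintype.card_fin, nsmul_eq_mul,
          ENNReal.ofReal_mul (by positivity), ENNReal.ofReal_mul (by positivity),
          ENNReal.ofReal_toReal hfin.ne, ENNReal.ofReal_natCast]
        ring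

/-- The space-time character with frequency `p`. -/
def chi {d : ℕ} (p : ℝ × Euc d) (t : ℝ) (x : Euc d) : ℂ :=
  Complex.exp (Complex.I * Complex.ofReal (p.1 * t + inner ℝ p.2 x))

/-- The field with (operator valued) Fourier transform `L`. -/
def fld {d : ℕ} (L : ℝ × Euc d → ℂ →L[ℝ] Euc d) (t : ℝ) (x : Euc d) : Euc d :=
  ∫ p, L p (chi p t x)

/-- Fourier transforms whose modulus is integrable against `(1 + |ξ|) ^ β`. -/
structure Adm {d : ℕ} (β : ℝ) (L : ℝ × Euc d → ℂ →L[ℝ] Euc d) : Prop where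
  meas : StronglyMeasurable L
  int : Integrable fun p => ‖L p‖ * (1 + ‖p.2‖) ^ β

/-- Restriction of the Fourier transform to spatial frequencies at most `R`. -/
def trunc {d : ℕ} (L : ℝ × Euc d → ℂ →L[ℝ] Euc d) (R : ℝ) : ℝ × Euc d → ℂ →L[ℝ] Euc d :=
  {p : ℝ × Euc d | ‖p.2‖ ≤ R}.indicator L

section
variable {d : ℕ} {β : ℝ} {L : ℝ × Euc d → ℂ →L[ℝ] Euc d}

lemma norm_chi (p : ℝ × Euc d) (t : ℝ) (x : Euc d) : ‖chi p t x‖ = 1 := by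
  rw [chi, mul_comm, Complex.norm_exp_ofReal_mul_I]

lemma norm_exp_sub_exp_le (u v : ℝ) :
    ‖Complex.exp (Complex.I * u) - Complex.exp (Complex.I * v)‖ ≤ |u - v| := by
  have h : Complex.exp (Complex.I * u) - Complex.exp (Complex.I * v) =
      Complex.exp (v * Complex.I) * (Complex.exp (Complex.I * (u - v : ℝ)) - 1) := by
    rw [mul_sub, ← Complex.exp_add, mul_one]
    push_cast
    ring_nf
  rw [h, norm_mul, Complex.norm_exp_ofReal_mul_I, one_mul]
  exact Real.norm_exp_I_mul_ofReal_sub_one_le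

lemma norm_exp_sub_exp_le_rpow (hβ0 : 0 ≤ β) (hβ1 : β ≤ 1) (u v : ℝ) :
    ‖Complex.exp (Complex.I * u) - Complex.exp (Complex.I * v)‖ ≤ 2 * |u - v| ^ β := by
  rcases le_total |u - v| 1 with h | h
  · have h1 := Real.rpow_le_rpow_of_exponent_ge_of_imp (abs_nonneg (u - v)) h hβ1
      (by intro h0 h2; linarith)
    have := norm_exp_sub_exp_le u v
    rw [Real.rpow_one] at h1
    linarith [Real.rpow_nonneg (abs_nonneg (u - v)) β]
  · have h1 := Real.one_le_rpow h hβ0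
    have h2 : ‖Complex.exp (Complex.I * u) - Complex.exp (Complex.I * v)‖ ≤ 2 := by
      refine (norm_sub_le _ _).trans ?_
      rw [mul_comm, Complex.norm_exp_ofReal_mul_I, mul_comm, Complex.norm_exp_ofReal_mul_I]
      norm_num
    linarith

lemma Adm.integrable_norm (hL : Adm β L) (hβ0 : 0 ≤ β) : Integrable fun p => ‖L p‖ := by
  refine hL.int.mono' hL.meas.norm.aestronglyMeasurable (ae_of_all _ fun p => ?_)
  rw [norm_norm]
  exact le_mul_of_one_le_right (norm_nonneg _)
    (Real.one_le_rpow (by linarith [norm_nonneg p.2]) hβ0)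

lemma Adm.aestronglyMeasurable_apply (hL : Adm β L) {g : ℝ × Euc d → ℂ} (hg : Measurable g) :
    AEStronglyMeasurable (fun p => L p (g p)) volume := by
  have h : Continuous fun q : (ℂ →L[ℝ] Euc d) × ℂ => q.1 q.2 := by fun_prop
  exact (h.comp_stronglyMeasurable
    (hL.meas.prodMk hg.stronglyMeasurable)).aestronglyMeasurable

lemma measurable_chi (t : ℝ) (x : Euc d) : Measurable fun p => chi p t x := by
  unfold chi
  fun_prop

lemma Adm.integrable (hL : Adm β L) (hβ0 : 0 ≤ β) (t : ℝ) (x : Euc d) :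
    Integrable fun p => L p (chi p t x) := by
  refine (hL.integrable_norm hβ0).mono' (hL.aestronglyMeasurable_apply (measurable_chi t x))
    (ae_of_all _ fun p => ?_)
  refine (ContinuousLinearMap.le_opNorm _ _).trans ?_
  rw [norm_chi, mul_one]

lemma Adm.trunc (hL : Adm β L) (R : ℝ) : Adm β (trunc L R) := by
  have hs : MeasurableSet {p : ℝ × Euc d | ‖p.2‖ ≤ R} :=
    (measurable_snd.norm measurableSet_Iic)
  refine ⟨hL.meas.indicator hs, ?_⟩
  refine hL.int.mono' ?_ (ae_of_all _ fun p => ?_)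
  · exact ((hL.meas.indicator hs).norm.mul (by
      refine Measurable.stronglyMeasurable ?_
      fun_prop)).aestronglyMeasurable
  · rw [norm_mul, norm_norm, Real.norm_eq_abs, abs_of_nonneg (by positivity)]
    gcongr
    exact norm_indicator_le_norm_self _ _

lemma Adm.norm_fld_le (t : ℝ) (x : Euc d) (hL : Adm β L) (hβ0 : 0 ≤ β) :
    ‖fld L t x‖ ≤ ∫ p, ‖L p‖ * (1 + ‖p.2‖) ^ β := by
  refine norm_integral_le_of_norm_le hL.int (ae_of_all _ fun p => ?_)
  refine (ContinuousLinearMap.le_opNorm _ _).trans ?_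
  rw [norm_chi, mul_one]
  exact le_mul_of_one_le_right (norm_nonneg _)
    (Real.one_le_rpow (by linarith [norm_nonneg p.2]) hβ0)

lemma Adm.continuous_fld (hL : Adm β L) (hβ0 : 0 ≤ β) :
    Continuous fun q : ℝ × Euc d => fld L q.1 q.2 := by
  refine continuous_of_dominated (bound := fun p => ‖L p‖)
    (fun q => (hL.integrable hβ0 q.1 q.2).aestronglyMeasurable)
    (fun q => ae_of_all _ fun p => ?_) (hL.integrable_norm hβ0) (ae_of_all _ fun p => ?_)
  · refine (ContinuousLinearMap.le_opNorm _ _).trans ?_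
    rw [norm_chi, mul_one]
  · refine (L p).continuous.comp ?_
    unfold chi
    fun_prop

lemma Adm.norm_fld_sub_le (hL : Adm β L) (hβ0 : 0 ≤ β) (hβ1 : β ≤ 1) (t : ℝ) (x y : Euc d) :
    ‖fld L t x - fld L t y‖ ≤ 2 * (∫ p, ‖L p‖ * (1 + ‖p.2‖) ^ β) * ‖x - y‖ ^ β := by
  rw [fld, fld, ← integral_sub (hL.integrable hβ0 _ _) (hL.integrable hβ0 _ _)]
  have : 2 * (∫ p, ‖L p‖ * (1 + ‖p.2‖) ^ β) * ‖x - y‖ ^ β =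
      ∫ p, 2 * ‖x - y‖ ^ β * (‖L p‖ * (1 + ‖p.2‖) ^ β) := by
    rw [integral_const_mul]; ring
  rw [this]
  refine norm_integral_le_of_norm_le (hL.int.const_mul _) (ae_of_all _ fun p => ?_)
  rw [← map_sub]
  refine (ContinuousLinearMap.le_opNorm _ _).trans ?_
  have h1 : ‖chi p t x - chi p t y‖ ≤ 2 * ‖x - y‖ ^ β * (1 + ‖p.2‖) ^ β := by
    refine (norm_exp_sub_exp_le_rpow hβ0 hβ1 _ _).trans ?_
    rw [add_sub_add_left_eq_sub, ← inner_sub_right, mul_assoc, ← Real.mul_rpow (by positivity)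
      (by positivity)]
    gcongr
    refine (abs_real_inner_le_norm _ _).trans ?_
    nlinarith [norm_nonneg (x - y), norm_nonneg p.2]
  calc _ ≤ ‖L p‖ * (2 * ‖x - y‖ ^ β * (1 + ‖p.2‖) ^ β) := by gcongr
    _ = _ := by ring

lemma Adm.norm_fld_trunc_sub_le (hL : Adm β L) (hβ0 : 0 ≤ β) {R : ℝ} (hR : 0 ≤ R) (t : ℝ)
    (x y : Euc d) :
    ‖fld (FBMReg.trunc L R) t x - fld (FBMReg.trunc L R) t y‖ ≤ R * (∫ p, ‖L p‖) * ‖x - y‖ := by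
  have hT := hL.trunc R
  rw [fld, fld, ← integral_sub (hT.integrable hβ0 _ _) (hT.integrable hβ0 _ _)]
  have : R * (∫ p, ‖L p‖) * ‖x - y‖ = ∫ p, R * ‖x - y‖ * ‖L p‖ := by
    rw [integral_const_mul]; ring
  rw [this]
  refine norm_integral_le_of_norm_le ((hL.integrable_norm hβ0).const_mul _)
    (ae_of_all _ fun p => ?_)
  rw [← map_sub]
  by_cases hp : ‖p.2‖ ≤ R
  · refine (ContinuousLinearMap.le_opNorm _ _).trans ?_
    have h1 : ‖chi p t x - chi p t y‖ ≤ R * ‖x - y‖ := by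
      refine (norm_exp_sub_exp_le _ _).trans ?_
      rw [add_sub_add_left_eq_sub, ← inner_sub_right]
      exact (abs_real_inner_le_norm _ _).trans (by gcongr)
    have h2 : FBMReg.trunc L R p = L p := Set.indicator_of_mem (by exact hp) _
    rw [h2, mul_comm]
    gcongr
  · have h2 : FBMReg.trunc L R p = 0 := Set.indicator_of_notMem (by exact hp) _
    rw [h2]
    simp only [zero_apply, norm_zero]
    positivity

lemma Adm.norm_fld_sub_trunc_le (hL : Adm β L) (hβ0 : 0 ≤ β) (R t : ℝ) (x : Euc d) :
    ‖fld L t x - fld (FBMReg.trunc L R) t x‖ ≤ ∫ p, ‖L p - FBMReg.trunc L R p‖ := by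
  have hT := hL.trunc R
  rw [fld, fld, ← integral_sub (hL.integrable hβ0 _ _) (hT.integrable hβ0 _ _)]
  refine norm_integral_le_of_norm_le ?_ (ae_of_all _ fun p => ?_)
  · refine Integrable.norm (Integrable.sub ?_ ?_)
    · exact (integrable_norm_iff hL.meas.aestronglyMeasurable).1 (hL.integrable_norm hβ0)
    · exact (integrable_norm_iff hT.meas.aestronglyMeasurable).1 (hT.integrable_norm hβ0)
  · rw [← sub_apply]
    refine (ContinuousLinearMap.le_opNorm _ _).trans ?_
    rw [norm_chi, mul_one]

lemma Adm.tendsto_trunc (hL : Adm β L) (hβ0 : 0 ≤ β) {R : ℕ → ℝ} (hR : Tendsto R atTop atTop) :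
    Tendsto (fun n => ∫ p, ‖L p - FBMReg.trunc L (R n) p‖) atTop (𝓝 0) := by
  have h := tendsto_integral_of_dominated_convergence
    (F := fun n p => ‖L p - FBMReg.trunc L (R n) p‖) (f := fun _ => (0 : ℝ)) (μ := volume) (fun p => ‖L p‖)
    (fun n => (hL.meas.sub (hL.trunc (R n)).meas).norm.aestronglyMeasurable)
    (hL.integrable_norm hβ0) (fun n => ae_of_all _ fun p => ?_) (ae_of_all _ fun p => ?_)
  · simpa using h
  · rw [norm_norm]
    by_cases hp : ‖p.2‖ ≤ R n
    · have h2 : FBMReg.trunc L (R n) p = L p := Set.indicator_of_mem (by exact hp) _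
      rw [h2]; simp
    · have h2 : FBMReg.trunc L (R n) p = 0 := Set.indicator_of_notMem (by exact hp) _
      rw [h2, sub_zero]
  · refine tendsto_const_nhds.congr' ?_
    filter_upwards [hR.eventually_ge_atTop ‖p.2‖] with n hn
    have h2 : FBMReg.trunc L (R n) p = L p := Set.indicator_of_mem (by exact hn) _
    rw [h2]; simp

end

lemma ae_sin_ne_zero {d : ℕ} {τ : ℝ} (hτ : τ ≠ 0) (y : Euc d) :
    ∀ᵐ p : ℝ × Euc d, Real.sin (p.1 * τ + inner ℝ p.2 y) ≠ 0 := by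
  have hm : MeasurableSet {p : ℝ × Euc d | Real.sin (p.1 * τ + inner ℝ p.2 y) = 0} :=
    measurableSet_eq_fun (by fun_prop) (by fun_prop)
  rw [ae_iff]
  simp only [ne_eq, not_not]
  rw [Measure.volume_eq_prod, Measure.prod_apply_symm hm]
  refine (lintegral_congr fun ξ => ?_).trans lintegral_zero
  refine Set.Countable.measure_zero ?_ _
  refine (Set.countable_range fun k : ℤ => (k * Real.pi - inner ℝ ξ y) / τ).mono ?_
  intro ω hω
  obtain ⟨k, hk⟩ := Real.sin_eq_zero_iff.1 hω
  refine ⟨k, ?_⟩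
  simp only at hk ⊢
  rw [hk]
  field_simp
  ring

/-- A scalar Fourier transform can be replaced by a measurable one for all but at most one
time, even if it is not assumed measurable. -/
lemma exists_measurable_scalar {d : ℕ} {β : ℝ} (f : ℝ × Euc d → ℂ)
    (hf : ∫⁻ p, ENNReal.ofReal (‖f p‖ * (1 + ‖p.2‖) ^ β) < ⊤) :
    ∃ g : ℝ × Euc d → ℂ, Measurable g ∧ Integrable (fun p => ‖g p‖ * (1 + ‖p.2‖) ^ β) ∧
      ∃ T : Set ℝ, T.Countable ∧ ∀ t ∉ T, ∀ x,
        ∫ p, (f p * chi p t x).re = ∫ p, (g p * chi p t x).re := by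
  by_cases hm : AEMeasurable f
  · refine ⟨hm.mk f, hm.measurable_mk, ?_, ∅, Set.countable_empty, fun t _ x => ?_⟩
    · refine ⟨(Measurable.mul hm.measurable_mk.norm (by fun_prop)).aestronglyMeasurable, ?_⟩
      rw [hasFiniteIntegral_iff_ofReal (ae_of_all _ fun p => by positivity)]
      refine lt_of_eq_of_lt (lintegral_congr_ae ?_) hf
      filter_upwards [hm.ae_eq_mk] with p hp
      rw [hp]
    · refine integral_congr_ae ?_
      filter_upwards [hm.ae_eq_mk] with p hp
      rw [← hp]
  · refine ⟨0, measurable_zero, by simp, {t | ∃ x, AEMeasurable fun p => (f p * chi p t x).re},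
      Set.Subsingleton.countable ?_, fun t ht x => ?_⟩
    · rintro t₁ ⟨x₁, h₁⟩ t₂ ⟨x₂, h₂⟩
      by_contra hne
      refine hm ?_
      let φ : ℝ × Euc d → ℝ := fun p => p.1 * (t₁ - t₂) + inner ℝ p.2 (x₁ - x₂)
      have hφ : Measurable φ := by fun_prop
      have hG : AEMeasurable (fun p => (starRingEnd ℂ) (chi p t₁ x₁) *
          (((f p * chi p t₁ x₁).re : ℝ) + Complex.I * ((((f p * chi p t₂ x₂).re -
            (f p * chi p t₁ x₁).re * Real.cos (φ p)) / Real.sin (φ p) : ℝ) : ℂ))) := by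
        refine AEMeasurable.mul (Complex.continuous_conj.measurable.comp
          (measurable_chi t₁ x₁)).aemeasurable ?_
        refine (Complex.measurable_ofReal.comp_aemeasurable h₁).add (aemeasurable_const.mul
          (Complex.measurable_ofReal.comp_aemeasurable ?_))
        exact (h₂.sub (h₁.mul hφ.cos.aemeasurable)).div hφ.sin.aemeasurable
      refine hG.congr ?_
      filter_upwards [ae_sin_ne_zero (sub_ne_zero.2 hne) (x₁ - x₂)] with p hp
      have hconj : (starRingEnd ℂ) (chi p t₁ x₁) * chi p t₁ x₁ = 1 := by
        rw [mul_comm, Complex.mul_conj, Complex.normSq_eq_norm_sq, norm_chi]; simp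
      have hrel : chi p t₂ x₂ = chi p t₁ x₁ * (Real.cos (φ p) - Real.sin (φ p) * Complex.I) := by
        have : (Real.cos (φ p) - Real.sin (φ p) * Complex.I : ℂ) =
            Complex.exp (Complex.I * ((-φ p : ℝ) : ℂ)) := by
          rw [mul_comm Complex.I, Complex.exp_mul_I]
          push_cast
          rw [Complex.cos_neg, Complex.sin_neg]; ring
        rw [this, chi, chi, ← Complex.exp_add]
        congr 1
        simp only [φ, inner_sub_right]
        push_cast
        ring
      have hz : f p = (starRingEnd ℂ) (chi p t₁ x₁) * (f p * chi p t₁ x₁) := by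
        rw [mul_left_comm, hconj, mul_one]
      have hu2 : (f p * chi p t₂ x₂).re = (f p * chi p t₁ x₁).re * Real.cos (φ p) +
          (f p * chi p t₁ x₁).im * Real.sin (φ p) := by
        rw [hrel, ← mul_assoc]
        simp only [Complex.mul_re, Complex.sub_re, Complex.sub_im, Complex.ofReal_re,
          Complex.ofReal_im, Complex.I_re, Complex.I_im, Complex.mul_im]
        ring
      conv_rhs => rw [hz]
      congr 1
      rw [hu2, add_sub_cancel_left, mul_div_cancel_right₀ _ hp, mul_comm Complex.I]
      exact Complex.re_add_im _
    · simp only [Pi.zero_apply, zero_mul, Complex.zero_re, integral_zero]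
      refine integral_undef fun h => ht ⟨x, h.aestronglyMeasurable.aemeasurable⟩

lemma exists_adm {d : ℕ} {α β : ℝ} {bhat : ℝ × Euc d → Fin d → ℂ}
    (hb : FLnorm d (α + 1) bhat < ⊤) (hβ0 : 0 ≤ β) (hβ : β ≤ α + 1) :
    ∃ L : ℝ × Euc d → ℂ →L[ℝ] Euc d, Adm β L ∧ ∃ T : Set ℝ, T.Countable ∧
      ∀ t ∉ T, ∀ x, fieldOf bhat t x = fld L t x := by
  have hcomp : ∀ i, ∫⁻ p, ENNReal.ofReal (‖bhat p i‖ * (1 + ‖p.2‖) ^ β) < ⊤ := by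
    intro i
    refine lt_of_le_of_lt (lintegral_mono fun p => ENNReal.ofReal_le_ofReal ?_) hb
    have h1 : ‖bhat p i‖ ≤ ‖bhat p‖ := norm_le_pi_norm _ _
    have h2 : (1 + ‖p.2‖) ^ β ≤ (1 + ‖p.2‖) ^ (α + 1) :=
      Real.rpow_le_rpow_of_exponent_le (by linarith [norm_nonneg p.2]) hβ
    have h3 : 1 ≤ 1 + Real.sqrt (Real.log (1 + |p.1|)) := by
      linarith [Real.sqrt_nonneg (Real.log (1 + |p.1|))]
    calc _ ≤ ‖bhat p‖ * (1 + ‖p.2‖) ^ (α + 1) := by gcongr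
      _ ≤ _ := le_mul_of_one_le_right (by positivity) h3
  choose g hgm hgi T hTc hT using fun i => exists_measurable_scalar _ (hcomp i)
  let M : Fin d → ℂ → ℂ →L[ℝ] Euc d := fun i c =>
    (ContinuousLinearMap.toSpanSingleton ℝ (EuclideanSpace.single i (1 : ℝ) : Euc d)).comp
      (Complex.reCLM.comp (ContinuousLinearMap.mul ℝ ℂ c))
  have hMc : ∀ i, Continuous (M i) := fun i =>
    continuous_const.clm_comp (continuous_const.clm_comp (ContinuousLinearMap.mul ℝ ℂ).continuous)
  have hMa : ∀ i c z, M i c z = (c * z).re • (EuclideanSpace.single i (1 : ℝ) : Euc d) :=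
    fun i c z => rfl
  have hMn : ∀ i c, ‖M i c‖ ≤ ‖c‖ := fun i c => by
    refine ContinuousLinearMap.opNorm_le_bound _ (norm_nonneg _) fun z => ?_
    rw [hMa, norm_smul, PiLp.norm_single, norm_one, mul_one, ← norm_mul]
    exact Complex.abs_re_le_norm _
  have hAdm : Adm β fun p => ∑ i, M i (g i p) := by
    have hmeas : StronglyMeasurable fun p => ∑ i, M i (g i p) :=
      Finset.stronglyMeasurable_fun_sum _ fun i _ =>
        (hMc i).comp_stronglyMeasurable (hgm i).stronglyMeasurable
    refine ⟨hmeas, ?_⟩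
    refine (integrable_finsetSum Finset.univ fun i _ => hgi i).mono'
      (hmeas.norm.mul (Measurable.stronglyMeasurable (by fun_prop))).aestronglyMeasurable
      (ae_of_all _ fun p => ?_)
    rw [norm_mul, norm_norm, Real.norm_eq_abs, abs_of_nonneg (by positivity), ← Finset.sum_mul]
    gcongr
    exact (norm_sum_le _ _).trans (Finset.sum_le_sum fun i _ => hMn i _)
  refine ⟨_, hAdm, ⋃ i, T i, Set.countable_iUnion hTc, fun t ht x => ?_⟩
  simp only [Set.mem_iUnion, not_exists] at ht
  ext i
  have h1 : fld (fun p => ∑ i, M i (g i p)) t x i =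
      ∫ p, ((∑ i, M i (g i p)) (chi p t x)) i :=
    ((EuclideanSpace.proj (𝕜 := ℝ) i).integral_comp_comm (hAdm.integrable hβ0 t x)).symm
  rw [h1]
  refine (hT i t (ht i) x).trans (integral_congr_ae (ae_of_all _ fun p => ?_))
  simp only [sum_apply, hMa, WithLp.ofLp_sum, Finset.sum_apply, PiLp.smul_apply, smul_eq_mul,
    PiLp.single_apply, mul_ite, mul_one, mul_zero, Finset.sum_ite_eq, Finset.mem_univ, if_true]

/-- Dyadic points. -/
def dy (n k : ℕ) : ℝ := k / 2 ^ n

lemma dy_nonneg (n k : ℕ) : 0 ≤ dy n k := by unfold dy; positivity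

lemma dy_le_one {n k : ℕ} (h : k ≤ 2 ^ n) : dy n k ≤ 1 := by
  unfold dy
  rw [div_le_one (by positivity)]
  exact_mod_cast h

lemma dy_mono (n : ℕ) {k l : ℕ} (h : k ≤ l) : dy n k ≤ dy n l := by
  unfold dy
  gcongr

lemma dy_add_sub (n k l : ℕ) : dy n (k + l) - dy n k = l * (1 / 2 ^ n) := by
  unfold dy
  push_cast
  ring

/-- Euler scheme for the drift part of the solution on the dyadic grid of level `n`. -/
def euler {d : ℕ} (b : ℝ → Euc d → Euc d) (x₀ : Euc d) (n : ℕ) (w : ℝ → Euc d) : ℕ → Euc d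
  | 0 => x₀
  | k + 1 => euler b x₀ n w k +
      ∫ r in dy n k..dy n (k + 1), b r (euler b x₀ n w k + w (dy n k))

/-- Euler scheme for the solution. -/
def eulerX {d : ℕ} (b : ℝ → Euc d → Euc d) (x₀ : Euc d) (n : ℕ) (w : ℝ → Euc d) (k : ℕ) : Euc d :=
  euler b x₀ n w k + w (dy n k)

/-- The drift at the grid point `u` if the position is frozen at the grid point `q`. -/
def frozen {d : ℕ} (b : ℝ → Euc d → Euc d) (x₀ : Euc d) (n : ℕ) (w : ℝ → Euc d) (q u : ℕ) :
    Euc d :=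
  euler b x₀ n w q + ∫ r in dy n q..dy n u, b r (eulerX b x₀ n w q)

section
variable {d : ℕ} {b : ℝ → Euc d → Euc d} {x₀ : Euc d} {n : ℕ}

lemma continuous_integral_field (hb : Continuous fun q : ℝ × Euc d => b q.1 q.2) (s t : ℝ) :
    Continuous fun x => ∫ r in s..t, b r x :=
  intervalIntegral.continuous_parametric_intervalIntegral_of_continuous' (by
    exact hb.comp continuous_swap) s t

lemma measurable_euler {Ω : Type*} {m : MeasurableSpace Ω} {W : Ω → ℝ → Euc d}
    (hb : Continuous fun q : ℝ × Euc d => b q.1 q.2) {k : ℕ}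
    (hW : ∀ i < k, Measurable fun ω => W ω (dy n i)) :
    Measurable fun ω => euler b x₀ n (W ω) k := by
  induction k with
  | zero => exact measurable_const
  | succ k ih =>
    have h := ih fun i hi => hW i (by omega)
    exact h.add ((continuous_integral_field hb _ _).measurable.comp (h.add (hW k (by omega))))

lemma measurable_eulerX {Ω : Type*} {m : MeasurableSpace Ω} {W : Ω → ℝ → Euc d}
    (hb : Continuous fun q : ℝ × Euc d => b q.1 q.2) {k : ℕ}
    (hW : ∀ i ≤ k, Measurable fun ω => W ω (dy n i)) :
    Measurable fun ω => eulerX b x₀ n (W ω) k :=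
  (measurable_euler hb fun i hi => hW i hi.le).add (hW k le_rfl)

lemma measurable_frozen {Ω : Type*} {m : MeasurableSpace Ω} {W : Ω → ℝ → Euc d}
    (hb : Continuous fun q : ℝ × Euc d => b q.1 q.2) {q : ℕ}
    (hW : ∀ i ≤ q, Measurable fun ω => W ω (dy n i)) (u : ℕ) :
    Measurable fun ω => frozen b x₀ n (W ω) q u :=
  (measurable_euler hb fun i hi => hW i hi.le).add
    ((continuous_integral_field hb _ _).measurable.comp (measurable_eulerX hb hW))

lemma norm_euler_sub_le {Cb : ℝ} (hbound : ∀ t x, ‖b t x‖ ≤ Cb) (w : ℝ → Euc d) (q a : ℕ) :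
    ‖euler b x₀ n w (q + a) - euler b x₀ n w q‖ ≤ Cb * (a * (1 / 2 ^ n)) := by
  induction a with
  | zero => simp
  | succ a ih =>
    have h1 : ‖∫ r in dy n (q + a)..dy n (q + a + 1), b r (euler b x₀ n w (q + a) +
        w (dy n (q + a)))‖ ≤ Cb * |dy n (q + a + 1) - dy n (q + a)| :=
      intervalIntegral.norm_integral_le_of_norm_le_const fun r _ => hbound _ _
    rw [dy_add_sub, abs_of_nonneg (by positivity)] at h1
    rw [← add_assoc, euler, add_sub_right_comm]
    refine (norm_add_le _ _).trans ?_
    push_cast at *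
    linarith

lemma norm_euler_sub_frozen_le {Cb β : ℝ} (hb : Continuous fun q : ℝ × Euc d => b q.1 q.2)
    (hholder : ∀ t x y, ‖b t x - b t y‖ ≤ Cb * ‖x - y‖ ^ β) (w : ℝ → Euc d) (q a : ℕ) :
    ‖euler b x₀ n w (q + a) - frozen b x₀ n w q (q + a)‖ ≤ ∑ i ∈ Finset.range a,
      1 / 2 ^ n * Cb * ‖eulerX b x₀ n w (q + i) - eulerX b x₀ n w q‖ ^ β := by
  have hci : ∀ (x : Euc d) s t, IntervalIntegrable (fun r => b r x) volume s t := fun x s t =>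
    Continuous.intervalIntegrable (hb.comp (continuous_id.prodMk continuous_const)) _ _
  induction a with
  | zero => simp [frozen]
  | succ a ih =>
    have e1 : euler b x₀ n w (q + a + 1) - frozen b x₀ n w q (q + a + 1) =
        (euler b x₀ n w (q + a) - frozen b x₀ n w q (q + a)) +
        ∫ r in dy n (q + a)..dy n (q + a + 1), (b r (eulerX b x₀ n w (q + a)) -
          b r (eulerX b x₀ n w q)) := by
      rw [intervalIntegral.integral_sub (hci _ _ _) (hci _ _ _), frozen, frozen, euler,
        ← intervalIntegral.integral_add_adjacent_intervals (hci _ (dy n q) (dy n (q + a)))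
          (hci _ (dy n (q + a)) (dy n (q + a + 1)))]
      simp only [eulerX]
      abel
    have h1 : ‖∫ r in dy n (q + a)..dy n (q + a + 1), (b r (eulerX b x₀ n w (q + a)) -
          b r (eulerX b x₀ n w q))‖ ≤ (Cb * ‖eulerX b x₀ n w (q + a) - eulerX b x₀ n w q‖ ^ β) *
          |dy n (q + a + 1) - dy n (q + a)| :=
      intervalIntegral.norm_integral_le_of_norm_le_const fun r _ => hholder _ _ _
    rw [dy_add_sub, abs_of_nonneg (by positivity)] at h1
    rw [← add_assoc, e1, Finset.sum_range_succ]
    refine (norm_add_le _ _).trans (add_le_add ih (h1.trans (le_of_eq ?_)))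
    push_cast
    ring

end

lemma eLpNorm_le_card_mul {Ω E ι : Type*} [MeasureSpace Ω] [NormedAddCommGroup E] {J : Finset ι}
    {f : Ω → E} {g : ι → Ω → ℝ} {p : ℝ≥0∞} (hp : 1 ≤ p) {c : ℝ}
    (hg : ∀ j ∈ J, AEStronglyMeasurable (g j) volume) (hf : ∀ ω, ‖f ω‖ ≤ ∑ j ∈ J, g j ω)
    (hgc : ∀ j ∈ J, eLpNorm (g j) p volume ≤ ENNReal.ofReal c) :
    eLpNorm f p volume ≤ ENNReal.ofReal (J.card * c) := by
  calc eLpNorm f p volume ≤ eLpNorm (∑ j ∈ J, g j) p volume :=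
        eLpNorm_mono fun ω => (hf ω).trans (by
          rw [Finset.sum_apply]; exact le_abs_self _)
    _ ≤ ∑ j ∈ J, eLpNorm (g j) p volume := eLpNorm_sum_le hg hp
    _ ≤ ∑ _j ∈ J, ENNReal.ofReal c := Finset.sum_le_sum hgc
    _ = _ := by
      rw [Finset.sum_const, nsmul_eq_mul, ENNReal.ofReal_mul (by positivity),
        ENNReal.ofReal_natCast]

/-- The character `e^{i ξ·x}`. -/
def ee {d : ℕ} (ξ x : Euc d) : ℂ := Complex.exp (Complex.I * Complex.ofReal (inner ℝ ξ x))

lemma norm_ee {d : ℕ} (ξ x : Euc d) : ‖ee ξ x‖ = 1 := by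
  rw [ee, mul_comm, Complex.norm_exp_ofReal_mul_I]

lemma ee_add {d : ℕ} (ξ x y : Euc d) : ee ξ (x + y) = ee ξ x * ee ξ y := by
  rw [ee, ee, ee, ← Complex.exp_add, inner_add_right]
  congr 1
  push_cast
  ring

lemma norm_ee_sub_le {d : ℕ} (ξ x y : Euc d) : ‖ee ξ x - ee ξ y‖ ≤ ‖ξ‖ * ‖x - y‖ := by
  refine (norm_exp_sub_exp_le _ _).trans ?_
  rw [← inner_sub_right]
  exact abs_real_inner_le_norm _ _

lemma continuous_ee {d : ℕ} : Continuous fun q : Euc d × Euc d => ee q.1 q.2 := by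
  unfold ee
  fun_prop

lemma measurable_ee {d : ℕ} (ξ : Euc d) : Measurable (ee ξ) :=
  (continuous_ee.comp (Continuous.prodMk_right ξ)).measurable

/-- Block sums of the Euler scheme, each block (but the initial one) being computed with the
drift frozen at the beginning of the previous block. -/
def blockX {d : ℕ} (b : ℝ → Euc d → Euc d) (x₀ : Euc d) (n : ℕ) (ξ : Euc d) (m : ℕ → ℂ)
    (s₀ M : ℕ) (w : ℝ → Euc d) : ℕ → ℂ
  | 0 => ∑ v ∈ Finset.range M, ee ξ (eulerX b x₀ n w (s₀ + v)) * m (s₀ + v)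
  | k + 1 => ∑ v ∈ Finset.range M, ee ξ (frozen b x₀ n w (s₀ + k * M) (s₀ + k * M + (M + v)) +
      w (dy n (s₀ + k * M + (M + v)))) * m (s₀ + k * M + (M + v))

/-- Weighted sums of characters along the Euler scheme. -/
def eulerSum {d : ℕ} (b : ℝ → Euc d → Euc d) (x₀ : Euc d) (n : ℕ) (ξ : Euc d) (m : ℕ → ℂ)
    (s₀ l : ℕ) (w : ℝ → Euc d) : ℂ :=
  ∑ u ∈ Finset.range l, ee ξ (eulerX b x₀ n w (s₀ + u)) * m (s₀ + u)

section
variable {d : ℕ} {b : ℝ → Euc d → Euc d} {x₀ : Euc d} {n : ℕ} {ξ : Euc d} {m : ℕ → ℂ} {s₀ M : ℕ}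

lemma eulerSum_mul (N : ℕ) (w : ℝ → Euc d) :
    eulerSum b x₀ n ξ m s₀ (N * M) w = ∑ k ∈ Finset.range N,
      eulerSum b x₀ n ξ m (s₀ + k * M) M w := by
  induction N with
  | zero => simp [eulerSum]
  | succ N ih =>
    rw [Finset.sum_range_succ, ← ih, add_mul, one_mul]
    unfold eulerSum
    rw [Finset.sum_range_add]
    simp only [add_assoc]

lemma norm_eulerSum_le (hm : ∀ u, ‖m u‖ ≤ 1 / 2 ^ n) (l : ℕ) (w : ℝ → Euc d) :
    ‖eulerSum b x₀ n ξ m s₀ l w‖ ≤ l * (1 / 2 ^ n) := by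
  refine (norm_sum_le _ _).trans ?_
  refine (Finset.sum_le_sum (g := fun _ => (1 / 2 ^ n : ℝ)) fun u _ => ?_).trans (by simp)
  rw [norm_mul, norm_ee, one_mul]
  exact hm _

lemma norm_blockX_le (hm : ∀ u, ‖m u‖ ≤ 1 / 2 ^ n) (k : ℕ) (w : ℝ → Euc d) :
    ‖blockX b x₀ n ξ m s₀ M w k‖ ≤ M * (1 / 2 ^ n) := by
  rcases k with _ | k
  all_goals
    refine (norm_sum_le _ _).trans ?_
    refine (Finset.sum_le_sum (g := fun _ => (1 / 2 ^ n : ℝ)) fun u _ => ?_).trans (by simp)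
    rw [norm_mul, norm_ee, one_mul]
    exact hm _

lemma norm_eulerSum_sub_blockX_le (hm : ∀ u, ‖m u‖ ≤ 1 / 2 ^ n) (k : ℕ) (w : ℝ → Euc d) :
    ‖eulerSum b x₀ n ξ m (s₀ + (k + 1) * M) M w - blockX b x₀ n ξ m s₀ M w (k + 1)‖ ≤
      ∑ v ∈ Finset.range M, 1 / 2 ^ n * ‖ξ‖ * ‖euler b x₀ n w (s₀ + k * M + (M + v)) -
        frozen b x₀ n w (s₀ + k * M) (s₀ + k * M + (M + v))‖ := by
  rw [eulerSum, blockX, ← Finset.sum_sub_distrib]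
  refine (norm_sum_le _ _).trans (Finset.sum_le_sum fun v _ => ?_)
  have : s₀ + (k + 1) * M + v = s₀ + k * M + (M + v) := by ring
  rw [this, ← sub_mul, norm_mul, eulerX]
  refine (mul_le_mul (norm_ee_sub_le _ _ _) (hm _) (norm_nonneg _) (by positivity)).trans
    (le_of_eq ?_)
  rw [add_sub_add_right_eq_sub]
  ring

lemma rpow_le_scaled {β s y : ℝ} (hβ0 : 0 ≤ β) (hβ1 : β ≤ 1) (hs : 0 < s) (hy : 0 ≤ y) :
    y ^ β ≤ s ^ β * (1 + y / s) := by
  have h1 : y ^ β = s ^ β * (y / s) ^ β := by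
    rw [← Real.mul_rpow hs.le (by positivity)]
    congr 1
    field_simp
  rw [h1]
  have h2 : 0 ≤ y / s := by positivity
  gcongr
  rcases le_total (y / s) 1 with h | h
  · linarith [Real.rpow_le_one h2 h hβ0]
  · have := Real.rpow_le_rpow_of_exponent_le h hβ1
    rw [Real.rpow_one] at this
    linarith

/-- `L^p` size of the error made by freezing the drift over two blocks. -/
lemma eLpNorm_euler_sub_frozen_le {Ω : Type*} [MeasureSpace Ω]
    [IsProbabilityMeasure (volume : Measure Ω)] {W : Ω → ℝ → Euc d} {H β Cb Cp : ℝ} {p : ℕ}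
    (hWm : ∀ t, Measurable fun ω => W ω t) (hp : 1 ≤ p) (hCb : 0 ≤ Cb) (hCp : 0 ≤ Cp)
    (hinc : ∀ s ∈ Set.Icc (0 : ℝ) 1, ∀ t ∈ Set.Icc (0 : ℝ) 1,
      eLpNorm (fun ω => W ω t - W ω s) p volume ≤ ENNReal.ofReal (Cp * |t - s| ^ H))
    (hH0 : 0 ≤ H) (hH1 : H ≤ 1) (hβ0 : 0 ≤ β) (hβ1 : β ≤ 1)
    (hb : Continuous fun q : ℝ × Euc d => b q.1 q.2) (hbound : ∀ t x, ‖b t x‖ ≤ Cb)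
    (hholder : ∀ t x y, ‖b t x - b t y‖ ≤ Cb * ‖x - y‖ ^ β) {q a : ℕ} {l : ℝ}
    (hl : l = M * (1 / 2 ^ n)) (hl0 : 0 < l) (hl1 : l ≤ 1) (ha : a ≤ 2 * M)
    (hqa : q + a ≤ 2 ^ n) :
    eLpNorm (fun ω => euler b x₀ n (W ω) (q + a) - frozen b x₀ n (W ω) q (q + a)) p volume ≤
      ENNReal.ofReal (2 * Cb * (1 + 2 * Cb + 2 * Cp) * l ^ (1 + H * β)) := by
  have hp' : (1 : ℝ≥0∞) ≤ p := by exact_mod_cast hp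
  let Z : ℕ → Ω → ℝ := fun i ω => ‖W ω (dy n (q + i)) - W ω (dy n q)‖
  have hZm : ∀ i, AEStronglyMeasurable (Z i) volume := fun i =>
    ((hWm _).sub (hWm _)).norm.aestronglyMeasurable
  let K : ℝ := 1 / 2 ^ n * Cb * l ^ (H * β)
  have hK : 0 ≤ K := by positivity
  have hlH : 0 < l ^ H := by positivity
  let g : ℕ → Ω → ℝ := fun i => (fun _ => K * (1 + 2 * Cb * l / l ^ H)) + (K / l ^ H) • Z i
  have hgm : ∀ i, AEStronglyMeasurable (g i) volume := fun i =>
    aestronglyMeasurable_const.add ((hZm i).const_smul _)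
  have hpt : ∀ ω, ‖euler b x₀ n (W ω) (q + a) - frozen b x₀ n (W ω) q (q + a)‖ ≤
      ∑ i ∈ Finset.range a, g i ω := by
    intro ω
    refine (norm_euler_sub_frozen_le hb hholder (W ω) q a).trans (Finset.sum_le_sum fun i hi => ?_)
    have hi' : (i : ℝ) ≤ 2 * M := by
      have := Finset.mem_range.1 hi
      exact_mod_cast (by omega : i ≤ 2 * M)
    have h1 : ‖eulerX b x₀ n (W ω) (q + i) - eulerX b x₀ n (W ω) q‖ ≤ 2 * Cb * l + Z i ω := by
      rw [eulerX, eulerX, add_sub_add_comm]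
      refine (norm_add_le _ _).trans (add_le_add ((norm_euler_sub_le hbound _ _ _).trans ?_) le_rfl)
      calc Cb * (i * (1 / 2 ^ n)) ≤ Cb * (2 * M * (1 / 2 ^ n)) := by gcongr
        _ = _ := by rw [hl]; ring
    have h2 : ‖eulerX b x₀ n (W ω) (q + i) - eulerX b x₀ n (W ω) q‖ ^ β ≤
        l ^ (H * β) * (1 + (2 * Cb * l + Z i ω) / l ^ H) := by
      refine (Real.rpow_le_rpow (norm_nonneg _) h1 hβ0).trans ?_
      rw [Real.rpow_mul hl0.le]
      exact rpow_le_scaled hβ0 hβ1 hlH (by positivity)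
    calc _ ≤ 1 / 2 ^ n * Cb * (l ^ (H * β) * (1 + (2 * Cb * l + Z i ω) / l ^ H)) := by gcongr
      _ = g i ω := by
        simp only [g, K, Pi.add_apply, Pi.smul_apply, smul_eq_mul]
        ring
  have hgc : ∀ i ∈ Finset.range a, eLpNorm (g i) p volume ≤
      ENNReal.ofReal (K * (1 + 2 * Cb + 2 * Cp)) := by
    intro i hi
    have hi' := Finset.mem_range.1 hi
    refine (eLpNorm_add_le aestronglyMeasurable_const ((hZm i).const_smul _) hp').trans ?_
    rw [eLpNorm_const _ (by positivity) (IsProbabilityMeasure.ne_zero _), measure_univ,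
      ENNReal.one_rpow, mul_one, eLpNorm_const_smul, Real.enorm_eq_ofReal (by positivity),
      Real.enorm_eq_ofReal (by positivity)]
    have h1 : eLpNorm (Z i) p volume ≤ ENNReal.ofReal (Cp * (2 * l ^ H)) := by
      have h2 := hinc (dy n q) ⟨dy_nonneg _ _, dy_le_one (by omega)⟩ (dy n (q + i))
        ⟨dy_nonneg _ _, dy_le_one (by omega)⟩
      rw [← eLpNorm_norm] at h2
      refine h2.trans (ENNReal.ofReal_le_ofReal ?_)
      rw [dy_add_sub, abs_of_nonneg (by positivity)]
      gcongr
      have h3 : (i : ℝ) * (1 / 2 ^ n) ≤ 2 * l := by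
        rw [hl, ← mul_assoc]
        have : (i : ℝ) ≤ 2 * M := by exact_mod_cast (by omega : i ≤ 2 * M)
        gcongr
      refine (Real.rpow_le_rpow (by positivity) h3 hH0).trans ?_
      rw [Real.mul_rpow (by norm_num) hl0.le]
      gcongr
      calc (2 : ℝ) ^ H ≤ 2 ^ (1 : ℝ) := Real.rpow_le_rpow_of_exponent_le (by norm_num) hH1
        _ = 2 := Real.rpow_one 2
    refine (add_le_add le_rfl (mul_le_mul_right h1 _)).trans ?_
    rw [← ENNReal.ofReal_mul (by positivity), ← ENNReal.ofReal_add (by positivity) (by positivity)]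
    refine ENNReal.ofReal_le_ofReal ?_
    have h4 : l / l ^ H ≤ 1 := by
      rw [div_le_one hlH]
      calc l = l ^ (1 : ℝ) := (Real.rpow_one l).symm
        _ ≤ l ^ H := Real.rpow_le_rpow_of_exponent_ge hl0 hl1 hH1
    calc K * (1 + 2 * Cb * l / l ^ H) + K / l ^ H * (Cp * (2 * l ^ H))
        = K * (1 + 2 * Cb * (l / l ^ H) + 2 * Cp) := by field_simp
      _ ≤ K * (1 + 2 * Cb * 1 + 2 * Cp) := by gcongr
      _ = _ := by ring
  refine (eLpNorm_le_card_mul hp' (fun i _ => hgm i) hpt hgc).trans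
    (ENNReal.ofReal_le_ofReal ?_)
  rw [Finset.card_range, Real.rpow_add hl0, Real.rpow_one]
  have ha' : (a : ℝ) ≤ 2 * M := by exact_mod_cast ha
  calc (a : ℝ) * (K * (1 + 2 * Cb + 2 * Cp)) ≤ 2 * M * (K * (1 + 2 * Cb + 2 * Cp)) := by gcongr
    _ = 2 * Cb * (1 + 2 * Cb + 2 * Cp) * ((M * (1 / 2 ^ n)) * l ^ (H * β)) := by
      simp only [K]; ring
    _ = _ := by rw [← hl]

lemma eLpNorm_eulerSum_sub_le {Ω : Type*} [MeasureSpace Ω]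
    [IsProbabilityMeasure (volume : Measure Ω)] {W : Ω → ℝ → Euc d} {H β Cb Cp : ℝ} {p : ℕ}
    (hWm : ∀ t, Measurable fun ω => W ω t) (hp : 1 ≤ p) (hCb : 0 ≤ Cb) (hCp : 0 ≤ Cp)
    (hinc : ∀ s ∈ Set.Icc (0 : ℝ) 1, ∀ t ∈ Set.Icc (0 : ℝ) 1,
      eLpNorm (fun ω => W ω t - W ω s) p volume ≤ ENNReal.ofReal (Cp * |t - s| ^ H))
    (hH0 : 0 ≤ H) (hH1 : H ≤ 1) (hβ0 : 0 ≤ β) (hβ1 : β ≤ 1)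
    (hb : Continuous fun q : ℝ × Euc d => b q.1 q.2) (hbound : ∀ t x, ‖b t x‖ ≤ Cb)
    (hholder : ∀ t x y, ‖b t x - b t y‖ ≤ Cb * ‖x - y‖ ^ β) (hm : ∀ u, ‖m u‖ ≤ 1 / 2 ^ n)
    {N : ℕ} {l : ℝ} (hl : l = M * (1 / 2 ^ n)) (hl0 : 0 < l) (hl1 : l ≤ 1)
    (hN : s₀ + N * M ≤ 2 ^ n) :
    eLpNorm (fun ω => eulerSum b x₀ n ξ m s₀ (N * M) (W ω) -
      ∑ k ∈ Finset.range N, blockX b x₀ n ξ m s₀ M (W ω) k) p volume ≤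
      ENNReal.ofReal (N * l * (‖ξ‖ * (2 * Cb * (1 + 2 * Cb + 2 * Cp) * l ^ (1 + H * β)))) := by
  have hp' : (1 : ℝ≥0∞) ≤ p := by exact_mod_cast hp
  let g : ℕ → Ω → ℝ := fun k ω => ‖eulerSum b x₀ n ξ m (s₀ + k * M) M (W ω) -
    blockX b x₀ n ξ m s₀ M (W ω) k‖
  have hWd : ∀ i, Measurable fun ω => W ω (dy n i) := fun i => hWm _
  have hsm : ∀ s l, Measurable fun ω => eulerSum b x₀ n ξ m s l (W ω) := fun s l =>
    Finset.measurable_fun_sum _ fun u _ =>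
      ((measurable_ee ξ).comp (measurable_eulerX hb fun i _ => hWd i)).mul_const _
  have hfm : ∀ q u, Measurable fun ω => frozen b x₀ n (W ω) q u := fun q u =>
    measurable_frozen hb (fun i _ => hWd i) u
  have hXm : ∀ k, Measurable fun ω => blockX b x₀ n ξ m s₀ M (W ω) k := by
    rintro (_ | k)
    · exact hsm s₀ M
    · exact Finset.measurable_fun_sum _ fun v _ =>
        ((measurable_ee ξ).comp ((hfm _ _).add (hWd _))).mul_const _
  have hA : (0 : ℝ) ≤ ‖ξ‖ * (2 * Cb * (1 + 2 * Cb + 2 * Cp) * l ^ (1 + H * β)) := by positivity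
  have hpt : ∀ ω, ‖eulerSum b x₀ n ξ m s₀ (N * M) (W ω) -
      ∑ k ∈ Finset.range N, blockX b x₀ n ξ m s₀ M (W ω) k‖ ≤ ∑ k ∈ Finset.range N, g k ω := by
    intro ω
    rw [eulerSum_mul, ← Finset.sum_sub_distrib]
    exact norm_sum_le _ _
  have hgc : ∀ k ∈ Finset.range N, eLpNorm (g k) p volume ≤
      ENNReal.ofReal (l * (‖ξ‖ * (2 * Cb * (1 + 2 * Cb + 2 * Cp) * l ^ (1 + H * β)))) := by
    rintro (_ | k) hk
    · have : g 0 = 0 := by ext ω; simp [g, eulerSum, blockX]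
      rw [this, eLpNorm_zero]
      exact zero_le
    · have hk' : k + 2 ≤ N := Finset.mem_range.1 hk
      have hkM : (k + 2) * M ≤ N * M := Nat.mul_le_mul_right _ hk'
      let f : ℕ → Ω → ℝ := fun v => (1 / 2 ^ n * ‖ξ‖) • fun ω =>
        ‖euler b x₀ n (W ω) (s₀ + k * M + (M + v)) -
        frozen b x₀ n (W ω) (s₀ + k * M) (s₀ + k * M + (M + v))‖
      have hem : ∀ v, Measurable fun ω => ‖euler b x₀ n (W ω) (s₀ + k * M + (M + v)) -
          frozen b x₀ n (W ω) (s₀ + k * M) (s₀ + k * M + (M + v))‖ := fun v =>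
        ((measurable_euler hb fun i _ => hWd i).sub (hfm _ _)).norm
      have h := eLpNorm_le_card_mul (J := Finset.range M) (f := g (k + 1)) (g := f) hp'
        (c := 1 / 2 ^ n * (‖ξ‖ * (2 * Cb * (1 + 2 * Cb + 2 * Cp) * l ^ (1 + H * β))))
        (fun v _ => ((hem v).const_smul _).aestronglyMeasurable) ?_ ?_
      · refine h.trans (le_of_eq ?_)
        rw [Finset.card_range, hl]
        ring_nf
      · intro ω
        simp only [g, norm_norm]
        exact norm_eulerSum_sub_blockX_le hm k (W ω)
      · intro v hv
        have hv' := Finset.mem_range.1 hv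
        rw [eLpNorm_const_smul, Real.enorm_eq_ofReal (by positivity), eLpNorm_norm, ← mul_assoc,
          ENNReal.ofReal_mul (p := 1 / 2 ^ n * ‖ξ‖) (by positivity)]
        gcongr
        refine eLpNorm_euler_sub_frozen_le hWm hp hCb hCp hinc hH0 hH1 hβ0 hβ1 hb hbound hholder
          hl hl0 hl1 (by omega) ?_
        have : (k + 2) * M = k * M + 2 * M := by ring
        omega
  refine (eLpNorm_le_card_mul hp' (fun k _ =>
    ((hsm _ _).sub (hXm k)).norm.aestronglyMeasurable) hpt hgc).trans (le_of_eq ?_)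
  rw [Finset.card_range, ← mul_assoc (N : ℝ)]

end

section
variable {d : ℕ} {b : ℝ → Euc d → Euc d} {x₀ : Euc d} {n : ℕ} {ξ : Euc d} {m : ℕ → ℂ} {s₀ M : ℕ}

lemma measurable_eulerSum {Ω : Type*} {_ : MeasurableSpace Ω} {W : Ω → ℝ → Euc d}
    (hb : Continuous fun q : ℝ × Euc d => b q.1 q.2) {l : ℕ}
    (hW : ∀ j < s₀ + l, Measurable fun ω => W ω (dy n j)) :
    Measurable fun ω => eulerSum b x₀ n ξ m s₀ l (W ω) :=
  Finset.measurable_fun_sum _ fun u hu => by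
    have := Finset.mem_range.1 hu
    exact ((measurable_ee ξ).comp (measurable_eulerX hb fun i _ => hW i (by omega))).mul_const _

lemma measurable_blockX {Ω : Type*} {_ : MeasurableSpace Ω} {W : Ω → ℝ → Euc d}
    (hb : Continuous fun q : ℝ × Euc d => b q.1 q.2) {k : ℕ}
    (hW : ∀ j < s₀ + (k + 1) * M, Measurable fun ω => W ω (dy n j)) :
    Measurable fun ω => blockX b x₀ n ξ m s₀ M (W ω) k := by
  rcases k with _ | k
  · exact measurable_eulerSum hb (by simpa using hW)
  · refine Finset.measurable_fun_sum _ fun v hv => ?_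
    have hv' := Finset.mem_range.1 hv
    have e : (k + 1 + 1) * M = k * M + (M + M) := by ring
    exact ((measurable_ee ξ).comp ((measurable_frozen hb
      (fun i _ => hW i (by omega)) _).add (hW _ (by omega)))).mul_const _

lemma norm_integral_mul_blockX_le {Ω : Type*} [MeasureSpace Ω]
    [IsProbabilityMeasure (volume : Measure Ω)] {H : ℝ} {W : Ω → ℝ → Euc d}
    (hW : IsFBM d H W) (hH : 0 ≤ H) {F : ℝ → Lp ℝ 2 (volume : Measure ℝ)} {c₀ : ℝ} (hc₀ : 0 ≤ c₀)
    (hF : ∀ s t, 0 ≤ s → 0 ≤ t → inner ℝ (F s) (F t) = fbmCov H s t)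
    (hc : ∀ r u, 0 ≤ r → r < u → ∀ f ∈ Submodule.span ℝ (F '' Set.Icc 0 r),
        c₀ * (u - r) ^ (2 * H) ≤ ‖F u - f‖ ^ 2)
    (hb : Continuous fun q : ℝ × Euc d => b q.1 q.2) (hm : ∀ u, ‖m u‖ ≤ 1 / 2 ^ n) (hM : 0 < M)
    {k : ℕ} (hk : s₀ + (k + 2) * M ≤ 2 ^ n) (c : ℂ) (lam : ℝ) :
    ‖∫ ω, (Real.exp (lam * ∑ i ∈ Finset.range k, (c * blockX b x₀ n ξ m s₀ M (W ω) i).re) : ℂ) *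
        blockX b x₀ n ξ m s₀ M (W ω) (k + 1)‖ ≤
      Real.exp (-(c₀ * ‖ξ‖ ^ 2 * (M * (1 / 2 ^ n)) ^ (2 * H)) / 2) * (M * (1 / 2 ^ n)) *
        ∫ ω, Real.exp (lam * ∑ i ∈ Finset.range k,
          (c * blockX b x₀ n ξ m s₀ M (W ω) i).re) := by
  obtain ⟨E, hE⟩ : ∃ E : Ω → ℝ, E = fun ω => Real.exp (lam * ∑ i ∈ Finset.range k,
          (c * blockX b x₀ n ξ m s₀ M (W ω) i).re) := ⟨_, rfl⟩
  obtain ⟨q, hq⟩ : ∃ q, q = s₀ + k * M := ⟨_, rfl⟩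
  obtain ⟨δ, hδ⟩ : ∃ δ, δ = Real.exp (-(c₀ * ‖ξ‖ ^ 2 * (M * (1 / 2 ^ n)) ^ (2 * H)) / 2) :=
    ⟨_, rfl⟩
  have hEω : ∀ ω, Real.exp (lam * ∑ i ∈ Finset.range k,
          (c * blockX b x₀ n ξ m s₀ M (W ω) i).re) = E ω := fun ω => by rw [hE]
  simp_rw [hEω]
  rw [← hδ]
  have hE0 : ∀ ω, 0 ≤ E ω := fun ω => by rw [hE]; positivity
  let t : Fin (q + 1) → ℝ := fun i => dy n i
  have hWm₀ : ∀ j ≤ q, Measurable[MeasurableSpace.comap (fun ω i => W ω (t i)) inferInstance]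
      fun ω => W ω (dy n j) := fun j hj =>
    (measurable_pi_apply (X := fun _ => Euc d) (⟨j, by omega⟩ : Fin (q + 1))).comp
      (comap_measurable fun ω i => W ω (t i))
  have hEm' : ∀ {m' : MeasurableSpace Ω}, (∀ j ≤ q, Measurable fun ω => W ω (dy n j)) →
      Measurable E := by
    intro m' hm'
    rw [hE]
    refine Real.measurable_exp.comp (Measurable.const_mul ?_ _)
    refine Finset.measurable_fun_sum _ fun i hi => Complex.measurable_re.comp ?_
    have hi' : i + 1 ≤ k := Finset.mem_range.1 hi
    have := Nat.mul_le_mul_right M hi'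
    exact (measurable_blockX hb fun j hj => hm' j (by omega)).const_mul _
  have hEm₀ := hEm' hWm₀
  have hEm : Measurable E := hEm' fun _ _ => hW.2.1 _
  have hEb : ∀ ω, ‖E ω‖ ≤ Real.exp (|lam| * ∑ _i ∈ Finset.range k, (‖c‖ * (M * (1 / 2 ^ n)))) := by
    intro ω
    rw [Real.norm_of_nonneg (hE0 ω), hE]
    refine Real.exp_le_exp.2 ((le_abs_self _).trans ?_)
    rw [abs_mul]
    refine mul_le_mul_of_nonneg_left ?_ (abs_nonneg _)
    refine (Finset.abs_sum_le_sum_abs _ _).trans (Finset.sum_le_sum fun i _ => ?_)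
    refine (Complex.abs_re_le_norm _).trans ?_
    rw [norm_mul]
    exact mul_le_mul_of_nonneg_left (norm_blockX_le hm _ _) (norm_nonneg _)
  have hGi : ∀ {g : Ω → ℂ}, Measurable g → ∀ {C : ℝ}, (∀ ω, ‖g ω‖ ≤ C) →
      Integrable (fun ω => (E ω : ℂ) * g ω) := fun hg C hC =>
    (Integrable.of_bound (hEm.complex_ofReal.aestronglyMeasurable) _
      (ae_of_all _ fun ω => by
        rw [Complex.norm_real]; exact hEb ω)).mul_bdd hg.aestronglyMeasurable (ae_of_all _ hC)
  let Z : ℕ → Ω → ℂ := fun v ω => ee ξ (frozen b x₀ n (W ω) q (q + (M + v)) +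
      W ω (dy n (q + (M + v)))) * m (q + (M + v))
  have hZm : ∀ v, Measurable (Z v) := fun v => ((measurable_ee ξ).comp
    ((measurable_frozen hb (fun i _ => hW.2.1 _) _).add (hW.2.1 _))).mul_const _
  have hZb : ∀ v ω, ‖Z v ω‖ ≤ 1 / 2 ^ n := fun v ω => by
    simp only [Z]
    rw [norm_mul, norm_ee, one_mul]; exact hm _
  have hX : ∀ ω, blockX b x₀ n ξ m s₀ M (W ω) (k + 1) = ∑ v ∈ Finset.range M, Z v ω := fun ω => by
    simp only [Z]
    rw [hq]; rfl
  simp_rw [hX, Finset.mul_sum]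
  rw [integral_finsetSum _ fun v _ => hGi (hZm v) (hZb v)]
  refine (norm_sum_le _ _).trans ?_
  have hterm : ∀ v ∈ Finset.range M, ‖∫ ω, (E ω : ℂ) * Z v ω‖ ≤ δ * (1 / 2 ^ n) * ∫ ω, E ω := by
    intro v hv
    have hv' := Finset.mem_range.1 hv
    have hkM : (k + 2) * M = k * M + (M + M) := by ring
    let G : Ω → ℂ := fun ω => (E ω : ℂ) * (ee ξ (frozen b x₀ n (W ω) q (q + (M + v))) *
      m (q + (M + v)))
    have hG : Measurable[MeasurableSpace.comap (fun ω i => W ω (t i)) inferInstance] G :=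
      (Complex.measurable_ofReal.comp hEm₀).mul
      (((measurable_ee ξ).comp (measurable_frozen hb hWm₀ _)).mul_const _)
    have hsub : dy n (q + (M + v)) - dy n q = ((M + v : ℕ) : ℝ) * (1 / 2 ^ n) := dy_add_sub _ _ _
    have hpos : (0 : ℝ) < ((M + v : ℕ) : ℝ) * (1 / 2 ^ n) := by
      have : (0 : ℝ) < ((M + v : ℕ) : ℝ) := by exact_mod_cast (by omega : 0 < M + v)
      positivity
    have h := norm_integral_mul_exp_le hW hF hc t (r := dy n q) (u := dy n (q + (M + v)))
      (dy_nonneg _ _) (by linarith) (dy_le_one (by omega))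
      (fun i => ⟨dy_nonneg _ _, dy_mono n (by have := i.2; omega)⟩) ξ hG
    have e1 : (fun ω => (E ω : ℂ) * Z v ω) = fun ω => G ω * Complex.exp (Complex.I *
        Complex.ofReal (inner ℝ ξ (W ω (dy n (q + (M + v)))))) := by
      ext ω
      simp only [Z, G, ee_add]
      rw [ee, ee]
      ring
    rw [e1]
    refine h.trans ?_
    have h2 : ∫ ω, ‖G ω‖ ≤ (1 / 2 ^ n) * ∫ ω, E ω := by
      rw [← integral_const_mul]
      have hEint : Integrable E := Integrable.of_bound hEm.aestronglyMeasurable _ (ae_of_all _ hEb)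
      refine integral_mono_of_nonneg (ae_of_all _ fun ω => norm_nonneg _) (hEint.const_mul _)
        (ae_of_all _ fun ω => ?_)
      simp only [G]
      rw [norm_mul, norm_mul, norm_ee, one_mul, Complex.norm_real, Real.norm_of_nonneg (hE0 ω),
        mul_comm]
      exact mul_le_mul_of_nonneg_right (hm _) (hE0 ω)
    have h3 : 0 ≤ ∫ ω, E ω := integral_nonneg hE0
    rw [mul_assoc δ]
    refine mul_le_mul ?_ h2 (integral_nonneg fun _ => norm_nonneg _) (by rw [hδ]; positivity)
    rw [hδ, hsub]
    refine Real.exp_le_exp.2 ?_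
    have : (M : ℝ) ≤ ((M + v : ℕ) : ℝ) := by exact_mod_cast Nat.le_add_right M v
    gcongr
  refine (Finset.sum_le_sum hterm).trans (le_of_eq ?_)
  rw [Finset.sum_const, Finset.card_range, nsmul_eq_mul]
  ring

/-- Moment bound for the weighted sums of characters along the Euler scheme, for an arbitrary
number of blocks. -/
lemma eLpNorm_eulerSum_le {Ω : Type*} [MeasureSpace Ω]
    [IsProbabilityMeasure (volume : Measure Ω)] {W : Ω → ℝ → Euc d} {H β Cb Cp : ℝ} {p : ℕ}
    (hW : IsFBM d H W) {F : ℝ → Lp ℝ 2 (volume : Measure ℝ)} {c₀ : ℝ} (hc₀ : 0 ≤ c₀)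
    (hF : ∀ s t, 0 ≤ s → 0 ≤ t → inner ℝ (F s) (F t) = fbmCov H s t)
    (hc : ∀ r u, 0 ≤ r → r < u → ∀ f ∈ Submodule.span ℝ (F '' Set.Icc 0 r),
        c₀ * (u - r) ^ (2 * H) ≤ ‖F u - f‖ ^ 2)
    (hp : 1 ≤ p) (hCb : 0 ≤ Cb) (hCp : 0 ≤ Cp)
    (hinc : ∀ s ∈ Set.Icc (0 : ℝ) 1, ∀ t ∈ Set.Icc (0 : ℝ) 1,
      eLpNorm (fun ω => W ω t - W ω s) p volume ≤ ENNReal.ofReal (Cp * |t - s| ^ H))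
    (hH0 : 0 ≤ H) (hH1 : H ≤ 1) (hβ0 : 0 ≤ β) (hβ1 : β ≤ 1)
    (hb : Continuous fun q : ℝ × Euc d => b q.1 q.2) (hbound : ∀ t x, ‖b t x‖ ≤ Cb)
    (hholder : ∀ t x y, ‖b t x - b t y‖ ≤ Cb * ‖x - y‖ ^ β) (hm : ∀ u, ‖m u‖ ≤ 1 / 2 ^ n)
    {N : ℕ} {l D : ℝ} (hl : l = M * (1 / 2 ^ n)) (hl0 : 0 < l) (hl1 : l ≤ 1)
    (hN0 : 0 < N) (hN : s₀ + N * M ≤ 2 ^ n)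
    (hD : Real.exp (-(c₀ * ‖ξ‖ ^ 2 * l ^ (2 * H)) / 2) * Real.sqrt N ≤ D) :
    eLpNorm (fun ω => eulerSum b x₀ n ξ m s₀ (N * M) (W ω)) p volume ≤
      ENNReal.ofReal (2 ^ p * p.factorial * 12 * Real.exp (7 + 3 * D) * (l * Real.sqrt N) +
        N * l * (‖ξ‖ * (2 * Cb * (1 + 2 * Cb + 2 * Cp) * l ^ (1 + H * β)))) := by
  have hp' : (1 : ℝ≥0∞) ≤ p := by exact_mod_cast hp
  have hMpos : 0 < M := by
    rcases Nat.eq_zero_or_pos M with h | h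
    · rw [hl, h] at hl0; simp at hl0
    · exact h
  have hXm : ∀ k, Measurable fun ω => blockX b x₀ n ξ m s₀ M (W ω) k := fun k =>
    measurable_blockX hb fun _ _ => hW.2.1 _
  have hSm : Measurable fun ω => ∑ k ∈ Finset.range N, blockX b x₀ n ξ m s₀ M (W ω) k :=
    Finset.measurable_fun_sum _ fun k _ => hXm k
  have hEm : Measurable fun ω => eulerSum b x₀ n ξ m s₀ (N * M) (W ω) :=
    measurable_eulerSum hb fun _ _ => hW.2.1 _
  have h1 := eLpNorm_eulerSum_sub_le (x₀ := x₀) (ξ := ξ) hW.2.1 hp hCb hCp hinc hH0 hH1 hβ0 hβ1 hb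
    hbound hholder hm hl hl0 hl1 hN
  have h2 := integral_norm_sum_pow_le (X := fun k ω => blockX b x₀ n ξ m s₀ M (W ω) k) hXm
    (fun k ω => by rw [hl]; exact norm_blockX_le hm k _) hl0
    (δ := Real.exp (-(c₀ * ‖ξ‖ ^ 2 * l ^ (2 * H)) / 2)) (by positivity) N hN0
    (fun k hk c lam => by
      rw [hl]
      refine norm_integral_mul_blockX_le hW hH0 hc₀ hF hc hb hm hMpos ?_ c lam
      have := Nat.mul_le_mul_right M (show k + 2 ≤ N from hk)
      omega) p
  have hA : (1 : ℝ) ≤ 2 ^ p * p.factorial * 12 * Real.exp (7 + 3 * D) := by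
    have hD0 : 0 ≤ D := le_trans (by positivity) hD
    have e1 : (1 : ℝ) ≤ 2 ^ p := one_le_pow₀ (by norm_num)
    have e2 : (1 : ℝ) ≤ p.factorial := by
      exact_mod_cast Nat.one_le_iff_ne_zero.2 p.factorial_ne_zero
    have e3 : (1 : ℝ) ≤ Real.exp (7 + 3 * D) := Real.one_le_exp (by positivity)
    have e4 : (1 : ℝ) ≤ 2 ^ p * p.factorial := one_le_mul_of_one_le_of_one_le e1 e2
    have e5 : (1 : ℝ) ≤ 2 ^ p * p.factorial * 12 := by linarith
    exact one_le_mul_of_one_le_of_one_le e5 e3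
  have h3 : eLpNorm (fun ω => ∑ k ∈ Finset.range N, blockX b x₀ n ξ m s₀ M (W ω) k) p volume ≤
      ENNReal.ofReal (2 ^ p * p.factorial * 12 * Real.exp (7 + 3 * D) * (l * Real.sqrt N)) := by
    have hpR : (0 : ℝ) < p := by exact_mod_cast hp
    rw [eLpNorm_eq_lintegral_rpow_enorm_toReal (by exact_mod_cast (by omega : p ≠ 0)) (by simp),
      ENNReal.toReal_natCast, one_div, ENNReal.rpow_inv_le_iff hpR, ENNReal.rpow_natCast,
      ← ENNReal.ofReal_pow (by positivity)]
    have e0 : ∀ ω, ‖∑ k ∈ Finset.range N, blockX b x₀ n ξ m s₀ M (W ω) k‖ₑ ^ (p : ℝ) =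
        ENNReal.ofReal (‖∑ k ∈ Finset.range N, blockX b x₀ n ξ m s₀ M (W ω) k‖ ^ p) := fun ω => by
      rw [ENNReal.rpow_natCast, ← ofReal_norm, ENNReal.ofReal_pow (norm_nonneg _)]
    simp_rw [e0]
    rw [← ofReal_integral_eq_lintegral_ofReal _ (ae_of_all _ fun ω => by positivity)]
    · refine ENNReal.ofReal_le_ofReal (h2.trans ?_)
      rw [mul_pow (_ * _ * _ * _ : ℝ)]
      refine mul_le_mul_of_nonneg_right ?_ (by positivity)
      refine le_trans ?_ (le_self_pow₀ hA (by omega : p ≠ 0))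
      have : 3 * Real.exp (-(c₀ * ‖ξ‖ ^ 2 * l ^ (2 * H)) / 2) * Real.sqrt N ≤ 3 * D := by
        rw [mul_assoc]; linarith
      gcongr
    · refine Integrable.of_bound ((hSm.norm.pow_const p).aestronglyMeasurable) ((N * l) ^ p)
        (ae_of_all _ fun ω => ?_)
      rw [Real.norm_of_nonneg (by positivity)]
      refine pow_le_pow_left₀ (norm_nonneg _) ((norm_sum_le _ _).trans ?_) p
      refine (Finset.sum_le_sum (g := fun _ => l) fun k _ => ?_).trans (by simp)
      rw [hl]; exact norm_blockX_le hm k _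
  have h4 := eLpNorm_add_le hSm.aestronglyMeasurable (hEm.sub hSm).aestronglyMeasurable hp'
    (μ := (volume : Measure Ω))
  rw [ENNReal.ofReal_add (by positivity) (by positivity)]
  refine le_trans (le_of_eq ?_) (h4.trans (add_le_add h3 h1))
  congr 1
  ext ω
  simp

end

lemma exists_scale_exponents {H β : ℝ} (hH : 1 / 2 ≤ H) (hβ : 1 - 1 / (2 * H) < β) (hβ1 : β ≤ 1) :
    ∃ κ θ : ℝ, 0 < κ ∧ H * κ < 1 ∧ κ ≤ 2 ∧ 1 / 2 ≤ θ ∧ θ < 1 ∧ 1 - κ * (θ / 2) ≤ β ∧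
      2 - κ * (1 + H * β) ≤ β := by
  have hH0 : 0 < H := by linarith
  have hHβ : 2 * H * (1 - β) < 1 := by
    have : 1 - β < 1 / (2 * H) := by linarith
    rw [lt_div_iff₀ (by positivity)] at this
    linarith
  have hβ0 : 0 < β := by
    have : 1 / (2 * H) ≤ 1 := by rw [div_le_one (by positivity)]; linarith
    linarith
  obtain ⟨κ, hκ1, hκ2⟩ : ∃ κ, max ((2 - β) / (1 + H * β)) (2 * (1 - β)) < κ ∧ κ < 1 / H := by
    refine exists_between (max_lt ?_ ?_)
    · rw [div_lt_div_iff₀ (by positivity) hH0]; nlinarith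
    · rw [lt_div_iff₀ hH0]; linarith
  have h1 := (le_max_left _ _).trans_lt hκ1
  have h2 := (le_max_right _ _).trans_lt hκ1
  have hκ0 : 0 < κ := lt_of_le_of_lt (by positivity [show (0:ℝ) ≤ 2 - β by linarith]) h1
  rw [lt_div_iff₀ hH0] at hκ2
  rw [div_lt_iff₀ (by positivity)] at h1
  refine ⟨κ, max (2 * (1 - β) / κ) (1 / 2), hκ0, by linarith, by nlinarith, le_max_right _ _,
    max_lt (by rwa [div_lt_one hκ0]) (by norm_num), ?_, by linarith⟩
  have h3 : 2 * (1 - β) / κ ≤ max (2 * (1 - β) / κ) (1 / 2) := le_max_left _ _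
  rw [div_le_iff₀ hκ0] at h3
  linarith

lemma exists_exp_neg_mul_rpow_le {c e q : ℝ} (hc : 0 < c) (he : 0 < e) :
    ∃ D : ℝ, 0 ≤ D ∧ ∀ x : ℝ, 1 ≤ x → Real.exp (-(c * x ^ e)) * x ^ q ≤ D := by
  obtain ⟨k, hk⟩ := exists_nat_ge (q / e)
  refine ⟨k.factorial / c ^ k, by positivity, fun x hx => ?_⟩
  have hx0 : 0 < x := by linarith
  have hq : x ^ q ≤ (x ^ e) ^ k := by
    rw [← Real.rpow_natCast, ← Real.rpow_mul hx0.le]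
    refine Real.rpow_le_rpow_of_exponent_le hx ?_
    rw [div_le_iff₀ he] at hk
    linarith
  have h := Real.pow_div_factorial_le_exp (c * x ^ e) (by positivity) k
  rw [Real.exp_neg, inv_mul_le_iff₀ (Real.exp_pos _)]
  rw [div_le_iff₀ (by positivity), mul_pow] at h
  rw [mul_div_assoc', le_div_iff₀ (by positivity)]
  calc x ^ q * c ^ k ≤ (x ^ e) ^ k * c ^ k := by gcongr
    _ ≤ _ := by linarith

set_option maxHeartbeats 1000000 in
/-- Moment bound for the weighted sums of characters along the Euler scheme over dyadic intervals,
uniformly in the level of the scheme. -/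
lemma exists_eLpNorm_eulerSum_le {Ω : Type*} [MeasureSpace Ω]
    [IsProbabilityMeasure (volume : Measure Ω)] {d : ℕ} {H : ℝ} {W : Ω → ℝ → Euc d}
    (hW : IsFBM d H W) (hH : 1 / 2 ≤ H) (hH1 : H < 1) {β : ℝ} (hβ : 1 - 1 / (2 * H) < β)
    (hβ0 : 0 ≤ β) (hβ1 : β ≤ 1) {b : ℝ → Euc d → Euc d} {x₀ : Euc d} {Cb : ℝ} (hCb : 0 ≤ Cb)
    (hb : Continuous fun q : ℝ × Euc d => b q.1 q.2) (hbound : ∀ t x, ‖b t x‖ ≤ Cb)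
    (hholder : ∀ t x y, ‖b t x - b t y‖ ≤ Cb * ‖x - y‖ ^ β) :
    ∃ γ : ℝ, 1 / 2 < γ ∧ γ < 1 ∧ ∀ p : ℕ, 1 ≤ p → ∃ C : ℝ, 0 ≤ C ∧
      ∀ (n i k : ℕ) (ξ : Euc d) (m : ℕ → ℂ), i ≤ n → k < 2 ^ i → ‖ξ‖ ^ 2 ≤ 2 ^ n →
        (∀ u, ‖m u‖ ≤ 1 / 2 ^ n) →
        ENNReal.ofReal ‖ξ‖ * eLpNorm (fun ω => eulerSum b x₀ n ξ m (k * 2 ^ (n - i))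
          (2 ^ (n - i)) (W ω)) p volume ≤
        ENNReal.ofReal (C * (1 + ‖ξ‖) ^ β * (1 / 2 ^ i) ^ γ) := by
  obtain ⟨κ, θ, hκ0, hHκ, hκ2, hθ, hθ1, hκθ, hκβ⟩ := exists_scale_exponents hH hβ hβ1
  obtain ⟨F, c₀, hc₀, hF, hc⟩ := exists_fbm_model hH hH1
  obtain ⟨D, hD0, hD⟩ := exists_exp_neg_mul_rpow_le (c := c₀ / 2) (e := 2 - 2 * H * κ)
    (q := κ / 2) (by positivity) (by linarith)
  refine ⟨1 - θ / 2, by linarith, by linarith, fun p hp => ?_⟩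
  obtain ⟨Cp, hCp, hinc⟩ := eLpNorm_increment_le hW (by linarith) p hp
  obtain ⟨A, hA⟩ : ∃ A : ℝ, A = 2 ^ p * p.factorial * 12 * Real.exp (7 + 3 * D) := ⟨_, rfl⟩
  obtain ⟨K, hK⟩ : ∃ K : ℝ, K = 2 * Cb * (1 + 2 * Cb + 2 * Cp) := ⟨_, rfl⟩
  have hA0 : 0 ≤ A := by rw [hA]; positivity
  have hK0 : 0 ≤ K := by rw [hK]; positivity
  have hp' : (1 : ℝ≥0∞) ≤ p := by exact_mod_cast hp
  refine ⟨2 + 2 * A + 4 * K, by positivity, fun n i k ξ m hin hki hξ hm => ?_⟩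
  obtain ⟨X, hX⟩ : ∃ X : ℝ, X = ‖ξ‖ := ⟨_, rfl⟩
  obtain ⟨I, hI⟩ : ∃ I : ℝ, I = 1 / 2 ^ i := ⟨_, rfl⟩
  rw [← hX, ← hI]
  rw [← hX] at hξ
  have hX0 : 0 ≤ X := by rw [hX]; positivity
  have hI0 : 0 < I := by rw [hI]; positivity
  have hI1 : I ≤ 1 := by
    rw [hI, div_le_one (by positivity)]; exact one_le_pow₀ (by norm_num)
  have hIγ : I ≤ I ^ (1 - θ / 2) := by
    calc I = I ^ (1 : ℝ) := (Real.rpow_one I).symm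
      _ ≤ _ := Real.rpow_le_rpow_of_exponent_ge hI0 hI1 (by linarith)
  have hXβ1 : 1 ≤ (1 + X) ^ β := Real.one_le_rpow (by linarith) hβ0
  have hni : (2 : ℝ) ^ (n - i) * (1 / 2 ^ n) = I := by
    rw [hI, pow_sub₀ _ (by norm_num) hin]; field_simp
  have htriv : eLpNorm (fun ω => eulerSum b x₀ n ξ m (k * 2 ^ (n - i)) (2 ^ (n - i)) (W ω)) p
      volume ≤ ENNReal.ofReal I := by
    have := eLpNorm_le_of_ae_bound (μ := (volume : Measure Ω)) (p := (p : ℝ≥0∞)) (C := I)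
      (f := fun ω => eulerSum b x₀ n ξ m (k * 2 ^ (n - i)) (2 ^ (n - i)) (W ω))
      (ae_of_all _ fun ω => by
        refine (norm_eulerSum_le hm _ _).trans (le_of_eq ?_)
        push_cast; exact hni)
    simpa using this
  suffices h : ∃ B : ℝ, eLpNorm (fun ω => eulerSum b x₀ n ξ m (k * 2 ^ (n - i)) (2 ^ (n - i))
      (W ω)) p volume ≤ ENNReal.ofReal B ∧
      X * B ≤ (2 + 2 * A + 4 * K) * (1 + X) ^ β * I ^ (1 - θ / 2) by
    obtain ⟨B, hB, hXB⟩ := h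
    refine (mul_le_mul_right hB _).trans ?_
    rw [← ENNReal.ofReal_mul hX0]
    exact ENNReal.ofReal_le_ofReal hXB
  rcases le_total X 1 with hX1 | hX1
  · refine ⟨I, htriv, ?_⟩
    calc X * I ≤ 1 * 1 * I ^ (1 - θ / 2) := by
          rw [one_mul]; gcongr
      _ ≤ (2 + 2 * A + 4 * K) * (1 + X) ^ β * I ^ (1 - θ / 2) := by
          gcongr; linarith
  obtain ⟨j, hj1, hj2⟩ := exists_nat_pow_near (Real.one_le_rpow hX1 hκ0.le)
    (by norm_num : (1 : ℝ) < 2)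
  obtain ⟨l, hl⟩ : ∃ l : ℝ, l = 1 / 2 ^ j := ⟨_, rfl⟩
  have hXpos : 0 < X := by linarith
  have hl0 : 0 < l := by rw [hl]; positivity
  have hl1 : l ≤ 1 := by
    rw [hl, div_le_one (by positivity)]; exact one_le_pow₀ (by norm_num)
  have hlX : l ≤ 2 * X ^ (-κ) := by
    rw [hl, Real.rpow_neg hX0, ← div_eq_mul_inv, div_le_div_iff₀ (by positivity) (by positivity)]
    rw [pow_succ] at hj2; linarith
  have hXl : X ^ (-κ) ≤ l := by
    rw [hl, Real.rpow_neg hX0, inv_eq_one_div]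
    exact one_div_le_one_div_of_le (by positivity) hj1
  have hjn : j ≤ n := by
    have h1 : (2 : ℝ) ^ j ≤ 2 ^ n := by
      refine hj1.trans (le_trans ?_ hξ)
      rw [← Real.rpow_natCast X 2]
      exact Real.rpow_le_rpow_of_exponent_le hX1 (by exact_mod_cast hκ2)
    exact (pow_le_pow_iff_right₀ (by norm_num)).1 h1
  have hXββ : X ^ β ≤ (1 + X) ^ β := by gcongr; linarith
  -- powers of `l` compensate powers of `X`
  have hcomp : ∀ s : ℝ, 0 ≤ s → ∀ q : ℝ, q - κ * s ≤ β → X ^ q * l ^ s ≤ 2 ^ s * (1 + X) ^ β := by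
    intro s hs q hq
    calc X ^ q * l ^ s ≤ X ^ q * (2 * X ^ (-κ)) ^ s := by gcongr
      _ = 2 ^ s * X ^ (q - κ * s) := by
        rw [Real.mul_rpow (by norm_num) (by positivity), ← Real.rpow_mul hX0, sub_eq_add_neg,
          Real.rpow_add hXpos]
        ring_nf
      _ ≤ 2 ^ s * X ^ β := by gcongr
      _ ≤ _ := by gcongr
  have hmain : X * l ^ (θ / 2) ≤ 2 * (1 + X) ^ β := by
    have h := hcomp (θ / 2) (by linarith) 1 hκθ
    rw [Real.rpow_one] at h
    refine h.trans ?_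
    gcongr
    calc (2 : ℝ) ^ (θ / 2) ≤ 2 ^ (1 : ℝ) :=
          Real.rpow_le_rpow_of_exponent_le (by norm_num) (by linarith)
      _ = 2 := Real.rpow_one 2
  rcases le_or_gt j i with hji | hij
  · refine ⟨I, htriv, ?_⟩
    have hIl : I ≤ l := by
      rw [hI, hl]
      exact one_div_le_one_div_of_le (by positivity) (pow_le_pow_right₀ (by norm_num) hji)
    have e1 : I = I ^ (θ / 2) * I ^ (1 - θ / 2) := by
      rw [← Real.rpow_add hI0]; simp
    calc X * I = X * (I ^ (θ / 2) * I ^ (1 - θ / 2)) := by rw [← e1]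
      _ ≤ X * (l ^ (θ / 2) * I ^ (1 - θ / 2)) := by gcongr
      _ = X * l ^ (θ / 2) * I ^ (1 - θ / 2) := by ring
      _ ≤ 2 * (1 + X) ^ β * I ^ (1 - θ / 2) := by gcongr
      _ ≤ _ := by gcongr; linarith
  have hlI : l ≤ I := by
    rw [hI, hl]
    exact one_div_le_one_div_of_le (by positivity) (pow_le_pow_right₀ (by norm_num) hij.le)
  have hNM : 2 ^ (j - i) * 2 ^ (n - j) = 2 ^ (n - i) := by
    rw [← pow_add]; congr 1; omega
  have hNl : ((2 ^ (j - i) : ℕ) : ℝ) * l = I := by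
    rw [hI, hl]; push_cast
    rw [pow_sub₀ _ (by norm_num) hij.le]; field_simp
  have hlM : l = ((2 ^ (n - j) : ℕ) : ℝ) * (1 / 2 ^ n) := by
    rw [hl]; push_cast
    rw [pow_sub₀ _ (by norm_num) hjn]; field_simp
  have hsN : l * Real.sqrt ((2 ^ (j - i) : ℕ) : ℝ) ≤ l ^ (θ / 2) * I ^ (1 - θ / 2) := by
    have e1 : ((2 ^ (j - i) : ℕ) : ℝ) = I / l := by rw [← hNl]; field_simp
    have e2 : l = l ^ (θ / 2) * l ^ ((1 - θ) / 2) * l ^ (1 / 2 : ℝ) := by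
      rw [← Real.rpow_add hl0, ← Real.rpow_add hl0]
      rw [show θ / 2 + (1 - θ) / 2 + 1 / 2 = 1 by ring, Real.rpow_one]
    calc l * Real.sqrt ((2 ^ (j - i) : ℕ) : ℝ)
        = l ^ (θ / 2) * l ^ ((1 - θ) / 2) * l ^ (1 / 2 : ℝ) *
            (I ^ (1 / 2 : ℝ) / l ^ (1 / 2 : ℝ)) := by
          rw [← e2, e1, Real.sqrt_eq_rpow, Real.div_rpow hI0.le hl0.le]
      _ = l ^ (θ / 2) * l ^ ((1 - θ) / 2) * I ^ (1 / 2 : ℝ) := by field_simp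
      _ ≤ l ^ (θ / 2) * I ^ ((1 - θ) / 2) * I ^ (1 / 2 : ℝ) := by gcongr
      _ = _ := by rw [mul_assoc, ← Real.rpow_add hI0]; ring_nf
  have hδ : Real.exp (-(c₀ * ‖ξ‖ ^ 2 * l ^ (2 * H)) / 2) *
      Real.sqrt ((2 ^ (j - i) : ℕ) : ℝ) ≤ D := by
    refine le_trans ?_ (hD X hX1)
    refine mul_le_mul (Real.exp_le_exp.2 ?_) ?_ (by positivity) (by positivity)
    · have h1 : X ^ (2 - 2 * H * κ) ≤ X ^ 2 * l ^ (2 * H) := by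
        calc X ^ (2 - 2 * H * κ) = X ^ 2 * (X ^ (-κ)) ^ (2 * H) := by
              rw [← Real.rpow_mul hX0, ← Real.rpow_natCast X 2, ← Real.rpow_add hXpos]
              congr 1; push_cast; ring
          _ ≤ _ := by gcongr
      rw [← hX]
      have := mul_le_mul_of_nonneg_left h1 hc₀.le
      linarith
    · rw [Real.sqrt_eq_rpow, show κ / 2 = κ * (1 / 2) by ring, Real.rpow_mul hX0]
      gcongr
      refine le_trans ?_ hj1
      push_cast
      exact pow_le_pow_right₀ (by norm_num) (Nat.sub_le _ _)
  have hbd := eLpNorm_eulerSum_le (x₀ := x₀) (ξ := ξ) (s₀ := k * 2 ^ (n - i)) (M := 2 ^ (n - j))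
    (N := 2 ^ (j - i)) hW hc₀.le hF hc hp hCb hCp hinc (by linarith) hH1.le hβ0 hβ1 hb hbound
    hholder hm hlM hl0 hl1 (by positivity) (by
      rw [hNM]
      calc k * 2 ^ (n - i) + 2 ^ (n - i) = (k + 1) * 2 ^ (n - i) := by ring
        _ ≤ 2 ^ i * 2 ^ (n - i) := Nat.mul_le_mul_right _ hki
        _ = 2 ^ n := by rw [← pow_add]; congr 1; omega) hδ
  rw [hNM, hNl, ← hA, ← hK, ← hX] at hbd
  refine ⟨_, hbd, ?_⟩
  have herr : X ^ 2 * l ^ (1 + H * β) ≤ 4 * (1 + X) ^ β := by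
    have hHβ1 : H * β ≤ 1 := mul_le_one₀ hH1.le hβ0 hβ1
    have h := hcomp (1 + H * β) (by positivity) 2 hκβ
    rw [Real.rpow_two] at h
    refine h.trans ?_
    gcongr
    calc (2 : ℝ) ^ (1 + H * β) ≤ 2 ^ (2 : ℝ) :=
          Real.rpow_le_rpow_of_exponent_le (by norm_num) (by linarith)
      _ = 4 := by norm_num
  calc X * (A * (l * Real.sqrt ((2 ^ (j - i) : ℕ) : ℝ)) + I * (X * (K * l ^ (1 + H * β))))
      = A * (X * (l * Real.sqrt ((2 ^ (j - i) : ℕ) : ℝ))) + K * (X ^ 2 * l ^ (1 + H * β)) * I := by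
        ring
    _ ≤ A * (X * (l ^ (θ / 2) * I ^ (1 - θ / 2))) + K * (4 * (1 + X) ^ β) * I ^ (1 - θ / 2) := by
        gcongr
    _ = A * (X * l ^ (θ / 2)) * I ^ (1 - θ / 2) + K * (4 * (1 + X) ^ β) * I ^ (1 - θ / 2) := by
        ring
    _ ≤ A * (2 * (1 + X) ^ β) * I ^ (1 - θ / 2) + K * (4 * (1 + X) ^ β) * I ^ (1 - θ / 2) := by
        gcongr
    _ = (0 + 2 * A + 4 * K) * (1 + X) ^ β * I ^ (1 - θ / 2) := by ring
    _ ≤ _ := by gcongr; norm_num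

lemma lintegral_lintegral_pow_le {Ω X : Type*} [MeasurableSpace Ω] [MeasurableSpace X]
    {P : Measure Ω} [SFinite P] {ν : Measure X} [IsFiniteMeasure ν] {g : X → Ω → ℝ≥0∞}
    (hg : Measurable (Function.uncurry g)) {p : ℕ} (hp : 1 ≤ p) {B : ℝ≥0∞}
    (hB : ∀ᵐ x ∂ν, ∫⁻ ω, g x ω ^ p ∂P ≤ B) :
    ∫⁻ ω, (∫⁻ x, g x ω ∂ν) ^ p ∂P ≤ ν Set.univ ^ p * B := by
  have hpR : (0 : ℝ) < p := by exact_mod_cast hp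
  have h1 : ∀ ω, (∫⁻ x, g x ω ∂ν) ^ p ≤ ν Set.univ ^ (p - 1) * ∫⁻ x, g x ω ^ p ∂ν := by
    intro ω
    have hm : Measurable fun x => g x ω := hg.comp measurable_prodMk_right
    have h := eLpNorm_le_eLpNorm_mul_rpow_measure_univ (μ := ν) (f := fun x => g x ω)
      (p := 1) (q := p) (by exact_mod_cast hp) hm.aestronglyMeasurable
    rw [eLpNorm_one_eq_lintegral_enorm, eLpNorm_eq_lintegral_rpow_enorm_toReal
      (by exact_mod_cast (by omega : p ≠ 0)) (by simp), ENNReal.toReal_natCast] at h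
    simp only [enorm_eq_self, ENNReal.toReal_one, ENNReal.rpow_natCast] at h
    calc (∫⁻ x, g x ω ∂ν) ^ p ≤ ((∫⁻ x, g x ω ^ p ∂ν) ^ (1 / (p : ℝ)) *
          ν Set.univ ^ (1 / 1 - 1 / (p : ℝ))) ^ p := by gcongr
      _ = _ := by
        rw [mul_pow, ← ENNReal.rpow_natCast, ← ENNReal.rpow_mul, one_div_mul_cancel hpR.ne',
          ENNReal.rpow_one, ← ENNReal.rpow_natCast, ← ENNReal.rpow_mul, mul_comm,
          ← ENNReal.rpow_natCast, Nat.cast_sub hp]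
        congr 2
        field_simp
        simp
  calc ∫⁻ ω, (∫⁻ x, g x ω ∂ν) ^ p ∂P
      ≤ ∫⁻ ω, ν Set.univ ^ (p - 1) * ∫⁻ x, g x ω ^ p ∂ν ∂P := lintegral_mono h1
    _ = ν Set.univ ^ (p - 1) * ∫⁻ ω, ∫⁻ x, g x ω ^ p ∂ν ∂P := by
      refine lintegral_const_mul _ ?_
      exact Measurable.lintegral_prod_right' (f := fun q : Ω × X => g q.2 q.1 ^ p)
        ((hg.comp measurable_swap).pow_const p)
    _ = ν Set.univ ^ (p - 1) * ∫⁻ x, ∫⁻ ω, g x ω ^ p ∂P ∂ν := by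
      rw [lintegral_lintegral_swap]
      exact ((hg.comp measurable_swap).pow_const p).aemeasurable
    _ ≤ ν Set.univ ^ (p - 1) * ∫⁻ _x, B ∂ν := by
      exact mul_le_mul_right (lintegral_mono_ae hB) _
    _ = ν Set.univ ^ p * B := by
      rw [lintegral_const, mul_comm B, ← mul_assoc, ← pow_succ, Nat.sub_add_cancel hp]

/-- Integrals of the temporal character over the dyadic intervals of level `n`. -/
def charInt (n : ℕ) (τ : ℝ) (u : ℕ) : ℂ :=
  ∫ r in dy n u..dy n (u + 1), Complex.exp (Complex.I * Complex.ofReal (τ * r))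

lemma norm_charInt_le (n : ℕ) (τ : ℝ) (u : ℕ) : ‖charInt n τ u‖ ≤ 1 / 2 ^ n := by
  have h := intervalIntegral.norm_integral_le_of_norm_le_const (a := dy n u) (b := dy n (u + 1))
    (f := fun r : ℝ => Complex.exp (Complex.I * Complex.ofReal (τ * r))) (C := 1) fun r _ => by
      rw [mul_comm, Complex.norm_exp_ofReal_mul_I]
  rw [dy_add_sub, abs_of_nonneg (by positivity)] at h
  simpa [charInt] using h

lemma measurable_charInt (n u : ℕ) : Measurable fun τ => charInt n τ u :=
  (intervalIntegral.continuous_parametric_intervalIntegral_of_continuous' (by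
    fun_prop) _ _).measurable

/-- Lipschitz constant of the field truncated to frequencies at most `R` and averaged along the
Euler scheme of level `n` over the `k`-th dyadic interval of level `i`. -/
def avgLip {d : ℕ} (L : ℝ × Euc d → ℂ →L[ℝ] Euc d) (b : ℝ → Euc d → Euc d) (x₀ : Euc d) (R : ℝ)
    (n i k : ℕ) (w : ℝ → Euc d) : ℝ≥0∞ :=
  ∫⁻ p in {p : ℝ × Euc d | ‖p.2‖ ≤ R}, ‖L p‖ₑ * (ENNReal.ofReal ‖p.2‖ *
    ‖eulerSum b x₀ n p.2 (charInt n p.1) (k * 2 ^ (n - i)) (2 ^ (n - i)) w‖ₑ)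

section
variable {d : ℕ} {β : ℝ} {L : ℝ × Euc d → ℂ →L[ℝ] Euc d} {b : ℝ → Euc d → Euc d} {x₀ : Euc d}

lemma measurable_enorm_eulerSum {Ω : Type*} [MeasurableSpace Ω] {W : Ω → ℝ → Euc d}
    (hb : Continuous fun q : ℝ × Euc d => b q.1 q.2) (hW : ∀ t, Measurable fun ω => W ω t)
    (n s l : ℕ) :
    Measurable fun q : (ℝ × Euc d) × Ω =>
      ‖eulerSum b x₀ n q.1.2 (charInt n q.1.1) s l (W q.2)‖ₑ := by
  unfold eulerSum
  refine Measurable.enorm (Finset.measurable_fun_sum _ fun u _ => ?_)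
  have h0 : Measurable fun q : (ℝ × Euc d) × Ω => eulerX b x₀ n (W q.2) (s + u) :=
    (measurable_eulerX (W := W) hb fun i _ => hW _).comp measurable_snd
  have h1 : Measurable fun q : (ℝ × Euc d) × Ω => q.1.2 := by fun_prop
  have h2 : Measurable fun q : (ℝ × Euc d) × Ω => q.1.1 := by fun_prop
  have h3 : Measurable fun q : Euc d × Euc d => ee q.1 q.2 := continuous_ee.measurable
  have h4 := h3.comp (h1.prodMk h0)
  have h5 := (measurable_charInt n (s + u)).comp h2
  exact h4.mul h5

lemma measurable_avgLip {Ω : Type*} [MeasurableSpace Ω] {W : Ω → ℝ → Euc d} (hL : Adm β L)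
    (hb : Continuous fun q : ℝ × Euc d => b q.1 q.2) (hW : ∀ t, Measurable fun ω => W ω t)
    (R : ℝ) (n i k : ℕ) : Measurable fun ω => avgLip L b x₀ R n i k (W ω) := by
  refine Measurable.lintegral_prod_right' (f := fun q : Ω × (ℝ × Euc d) => ‖L q.2‖ₑ *
    (ENNReal.ofReal ‖q.2.2‖ * ‖eulerSum b x₀ n q.2.2 (charInt n q.2.1) (k * 2 ^ (n - i))
      (2 ^ (n - i)) (W q.1)‖ₑ)) ?_
  have h1 : Measurable fun q : Ω × (ℝ × Euc d) => ENNReal.ofReal ‖q.2.2‖ := by fun_prop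
  have h2 := (measurable_enorm_eulerSum (x₀ := x₀) hb hW n (k * 2 ^ (n - i))
    (2 ^ (n - i))).comp (measurable_swap (α := Ω) (β := ℝ × Euc d))
  have h3 : Measurable fun q : Ω × (ℝ × Euc d) => ‖L q.2‖ₑ := hL.meas.enorm.comp measurable_snd
  exact h3.mul (h1.mul h2)

set_option maxHeartbeats 400000 in
lemma lintegral_avgLip_pow_le {Ω : Type*} [MeasureSpace Ω]
    [IsProbabilityMeasure (volume : Measure Ω)] {W : Ω → ℝ → Euc d} (hL : Adm β L)
    (hb : Continuous fun q : ℝ × Euc d => b q.1 q.2) (hW : ∀ t, Measurable fun ω => W ω t)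
    {p : ℕ} (hp : 1 ≤ p) {R A : ℝ} {n i k : ℕ} (hA : 0 ≤ A)
    (h : ∀ (ξ : Euc d) (m : ℕ → ℂ), ‖ξ‖ ≤ R → (∀ u, ‖m u‖ ≤ 1 / 2 ^ n) →
        ENNReal.ofReal ‖ξ‖ * eLpNorm (fun ω => eulerSum b x₀ n ξ m (k * 2 ^ (n - i))
          (2 ^ (n - i)) (W ω)) p volume ≤ ENNReal.ofReal (A * (1 + ‖ξ‖) ^ β)) :
    ∫⁻ ω, avgLip L b x₀ R n i k (W ω) ^ p ≤
      ENNReal.ofReal (((∫ q, ‖L q‖ * (1 + ‖q.2‖) ^ β) * A) ^ p) := by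
  have hpR : (0 : ℝ) < p := by exact_mod_cast hp
  let a : ℝ × Euc d → ℝ≥0∞ := fun q => ‖L q‖ₑ * ENNReal.ofReal ((1 + ‖q.2‖) ^ β)
  have ham : Measurable a := hL.meas.enorm.mul (by fun_prop)
  have ha : ∫⁻ q, a q = ENNReal.ofReal (∫ q, ‖L q‖ * (1 + ‖q.2‖) ^ β) := by
    rw [ofReal_integral_eq_lintegral_ofReal hL.int (ae_of_all _ fun q => by positivity)]
    refine lintegral_congr fun q => ?_
    rw [ENNReal.ofReal_mul (norm_nonneg _), ofReal_norm]
  have hS : MeasurableSet {q : ℝ × Euc d | ‖q.2‖ ≤ R} := measurable_snd.norm measurableSet_Iic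
  let ν : Measure (ℝ × Euc d) := (volume.withDensity a).restrict {q | ‖q.2‖ ≤ R}
  have hνuniv : ν Set.univ ≤ ENNReal.ofReal (∫ q, ‖L q‖ * (1 + ‖q.2‖) ^ β) := by
    rw [← ha, Measure.restrict_apply_univ]
    refine (measure_mono (Set.subset_univ _)).trans (le_of_eq ?_)
    rw [withDensity_apply _ MeasurableSet.univ, Measure.restrict_univ]
  have : IsFiniteMeasure ν := ⟨hνuniv.trans_lt ENNReal.ofReal_lt_top⟩
  let g : ℝ × Euc d → Ω → ℝ≥0∞ := fun q ω => (ENNReal.ofReal ((1 + ‖q.2‖) ^ β))⁻¹ *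
    (ENNReal.ofReal ‖q.2‖ *
    ‖eulerSum b x₀ n q.2 (charInt n q.1) (k * 2 ^ (n - i)) (2 ^ (n - i)) (W ω)‖ₑ)
  have hg : Measurable (Function.uncurry g) := by
    have h1 : Measurable fun q : (ℝ × Euc d) × Ω => (ENNReal.ofReal ((1 + ‖q.1.2‖) ^ β))⁻¹ := by
      fun_prop
    have h2 : Measurable fun q : (ℝ × Euc d) × Ω => ENNReal.ofReal ‖q.1.2‖ := by fun_prop
    have h3 := measurable_enorm_eulerSum (x₀ := x₀) hb hW n (k * 2 ^ (n - i)) (2 ^ (n - i))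
    exact h1.mul (h2.mul h3)
  have hw0 : ∀ q : ℝ × Euc d, ENNReal.ofReal ((1 + ‖q.2‖) ^ β) ≠ 0 := fun q => by
    rw [Ne, ENNReal.ofReal_eq_zero, not_le]; positivity
  have e1 : ∀ ω, avgLip L b x₀ R n i k (W ω) = ∫⁻ q, g q ω ∂ν := by
    intro ω
    have hgm : Measurable fun q => g q ω := hg.of_uncurry_right
    have e2 : ν = (volume.restrict {q | ‖q.2‖ ≤ R}).withDensity a := restrict_withDensity hS a
    rw [e2, lintegral_withDensity_eq_lintegral_mul _ ham hgm]
    refine lintegral_congr fun q => ?_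
    simp only [Pi.mul_apply, a, g]
    rw [mul_assoc ‖L q‖ₑ, ← mul_assoc (ENNReal.ofReal ((1 + ‖q.2‖) ^ β)),
      ENNReal.mul_inv_cancel (hw0 q) ENNReal.ofReal_ne_top, one_mul]
  have hB : ∀ᵐ q ∂ν, ∫⁻ ω, g q ω ^ p ≤ ENNReal.ofReal (A ^ p) := by
    filter_upwards [ae_restrict_mem hS] with q hq
    have hE : Measurable fun ω => ‖eulerSum b x₀ n q.2 (charInt n q.1) (k * 2 ^ (n - i))
        (2 ^ (n - i)) (W ω)‖ₑ ^ p := by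
      have h3 := (measurable_enorm_eulerSum (x₀ := x₀) hb hW n (k * 2 ^ (n - i))
        (2 ^ (n - i))).comp (measurable_prodMk_left (x := q))
      exact h3.pow_const p
    have h1 := h q.2 (charInt n q.1) hq (norm_charInt_le n q.1)
    rw [eLpNorm_eq_lintegral_rpow_enorm_toReal (by exact_mod_cast (by omega : p ≠ 0)) (by simp),
      ENNReal.toReal_natCast] at h1
    simp only [ENNReal.rpow_natCast] at h1
    simp only [g, mul_pow]
    rw [lintegral_const_mul _ (hE.const_mul _), lintegral_const_mul _ hE]
    have h2 := pow_le_pow_left₀ zero_le h1 p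
    rw [mul_pow, ← ENNReal.rpow_natCast (_ ^ (1 / (p : ℝ))), ← ENNReal.rpow_mul,
      one_div_mul_cancel hpR.ne', ENNReal.rpow_one, ENNReal.ofReal_mul hA, mul_pow,
      ← ENNReal.ofReal_pow hA] at h2
    refine (mul_le_mul_right h2 _).trans (le_of_eq ?_)
    rw [mul_comm (ENNReal.ofReal (A ^ p)), ← mul_assoc, ← mul_pow,
      ENNReal.inv_mul_cancel (hw0 q) ENNReal.ofReal_ne_top, one_pow, one_mul]
  simp_rw [e1]
  refine (lintegral_lintegral_pow_le hg hp hB).trans ?_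
  have hI : 0 ≤ ∫ q, ‖L q‖ * (1 + ‖q.2‖) ^ β := integral_nonneg fun q => by positivity
  rw [mul_pow, ENNReal.ofReal_mul (by positivity), ENNReal.ofReal_pow hI]
  gcongr

set_option maxHeartbeats 400000 in
/-- Outside of a null set of paths, the fields averaged along the Euler scheme are Lipschitz, with
constants controlled uniformly over all dyadic intervals, for infinitely many levels. -/
lemma exists_null_set {Ω : Type*} [MeasureSpace Ω]
    [IsProbabilityMeasure (volume : Measure Ω)] {H : ℝ} {W : Ω → ℝ → Euc d}
    (hW : IsFBM d H W) (hH : 1 / 2 ≤ H) (hH1 : H < 1) (hβ : 1 - 1 / (2 * H) < β)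
    (hβ0 : 0 ≤ β) (hβ1 : β ≤ 1) (hL : Adm β L) {Cb : ℝ} (hCb : 0 ≤ Cb)
    (hb : Continuous fun q : ℝ × Euc d => b q.1 q.2) (hbound : ∀ t x, ‖b t x‖ ≤ Cb)
    (hholder : ∀ t x y, ‖b t x - b t y‖ ≤ Cb * ‖x - y‖ ^ β) :
    ∃ γ : ℝ, 1 / 2 < γ ∧ γ < 1 ∧ ∃ N : Set (ℝ → Euc d), MeasurableSet N ∧
      (volume : Measure Ω) {ω | W ω ∈ N} = 0 ∧ ∀ w ∉ N, ∃ K : ℝ, 0 ≤ K ∧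
        ∃ᶠ n in atTop, ∀ i ≤ n, ∀ k < 2 ^ i,
          avgLip L b x₀ ((2 ^ n) ^ (1 - γ)) n i k w ≤ ENNReal.ofReal (K * (1 / 2 ^ i) ^ γ) := by
  obtain ⟨γ₁, hγ₁, hγ₁', hmom⟩ := exists_eLpNorm_eulerSum_le (x₀ := x₀) hW hH hH1 hβ hβ0 hβ1 hCb hb
    hbound hholder
  obtain ⟨γ, hγ, hγγ₁⟩ := exists_between hγ₁
  obtain ⟨p, hp⟩ := exists_nat_gt (max 1 (1 / (γ₁ - γ)))
  have hp1 : 1 ≤ p := by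
    have := (le_max_left _ _).trans_lt hp
    exact_mod_cast this.le
  have hpR : (0 : ℝ) < p := by exact_mod_cast hp1
  have hpγ : 1 < p * (γ₁ - γ) := by
    have := (le_max_right _ _).trans_lt hp
    rwa [div_lt_iff₀ (by linarith)] at this
  obtain ⟨C, hC, hCmom⟩ := hmom p hp1
  let kol : ℕ → (ℝ → Euc d) → ℝ≥0∞ := fun n w => ∑ i ∈ Finset.range (n + 1),
    ∑ k ∈ Finset.range (2 ^ i), ENNReal.ofReal ((2 ^ i) ^ γ) ^ p *
      avgLip L b x₀ ((2 ^ n) ^ (1 - γ)) n i k w ^ p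
  have hkol : ∀ n, Measurable (kol n) := fun n =>
    Finset.measurable_fun_sum _ fun i _ => Finset.measurable_fun_sum _ fun k _ =>
      ((measurable_avgLip (W := fun w : ℝ → Euc d => w) hL hb
        (fun t => measurable_pi_apply t) _ _ _ _).pow_const p).const_mul _
  have hkolW : ∀ n, Measurable fun ω => kol n (W ω) := fun n =>
    (hkol n).comp (measurable_pi_lambda _ hW.2.1)
  let Q : ℝ := (∫ q, ‖L q‖ * (1 + ‖q.2‖) ^ β) * C
  have hQ0 : 0 ≤ Q := mul_nonneg (integral_nonneg fun q => by positivity) hC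
  let ρ : ℝ := 2 ^ (1 - p * (γ₁ - γ))
  have hρ1 : ρ < 1 := Real.rpow_lt_one_of_one_lt_of_neg (by norm_num) (by linarith)
  have hρ0 : 0 < ρ := by positivity
  have hint : ∀ n, ∫⁻ ω, kol n (W ω) ≤ ENNReal.ofReal (Q ^ p * (1 - ρ)⁻¹) := by
    intro n
    have h1 : ∀ i ∈ Finset.range (n + 1), ∀ k ∈ Finset.range (2 ^ i),
        ∫⁻ ω, ENNReal.ofReal ((2 ^ i) ^ γ) ^ p *
          avgLip L b x₀ ((2 ^ n) ^ (1 - γ)) n i k (W ω) ^ p ≤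
        ENNReal.ofReal (((2 ^ i) ^ γ) ^ p * (Q * (1 / 2 ^ i) ^ γ₁) ^ p) := by
      intro i hi k hk
      rw [lintegral_const_mul _ ((measurable_avgLip hL hb hW.2.1 _ _ _ _).pow_const p),
        ENNReal.ofReal_mul (by positivity), ENNReal.ofReal_pow (by positivity)]
      gcongr
      have := lintegral_avgLip_pow_le (x₀ := x₀) (n := n) (i := i) (k := k)
        (R := (2 ^ n) ^ (1 - γ)) (A := C * (1 / 2 ^ i) ^ γ₁) hL hb hW.2.1 hp1
        (by positivity) ?_
      · simpa only [Q, mul_assoc] using this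
      · intro ξ m hξ hm
        refine (hCmom n i k ξ m (by simpa [Nat.lt_succ_iff] using hi) (by simpa using hk) ?_
          hm).trans (le_of_eq ?_)
        · calc ‖ξ‖ ^ 2 ≤ (((2 : ℝ) ^ n) ^ (1 - γ)) ^ 2 := by gcongr
            _ = ((2 : ℝ) ^ n) ^ ((1 - γ) * 2) := by
              rw [Real.rpow_mul (by positivity), Real.rpow_two]
            _ ≤ ((2 : ℝ) ^ n) ^ (1 : ℝ) := Real.rpow_le_rpow_of_exponent_le
              (one_le_pow₀ (by norm_num)) (by linarith)
            _ = 2 ^ n := Real.rpow_one _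
        · congr 1; ring
    have h2 : ∀ i : ℕ, ((2 : ℝ) ^ i) * (((2 ^ i) ^ γ) ^ p * (Q * (1 / 2 ^ i) ^ γ₁) ^ p) =
        Q ^ p * ρ ^ i := by
      intro i
      have h2i : (0 : ℝ) < 2 ^ i := by positivity
      have e1 : ((2 : ℝ) ^ i) * (((2 ^ i) ^ γ) ^ p * ((1 / 2 ^ i) ^ γ₁) ^ p) = ρ ^ i := by
        rw [← Real.rpow_natCast ((2 ^ i) ^ γ), ← Real.rpow_natCast ((1 / 2 ^ i) ^ γ₁), one_div,
          Real.inv_rpow h2i.le, ← Real.rpow_neg h2i.le, ← Real.rpow_mul h2i.le,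
          ← Real.rpow_mul h2i.le, ← Real.rpow_add h2i]
        nth_rewrite 1 [← Real.rpow_one ((2 : ℝ) ^ i)]
        rw [← Real.rpow_add h2i, ← Real.rpow_natCast 2 i, ← Real.rpow_mul (by norm_num),
          ← Real.rpow_natCast, ← Real.rpow_mul (by norm_num)]
        congr 1
        ring
      rw [← e1, mul_pow]
      ring
    calc ∫⁻ ω, kol n (W ω) = ∑ i ∈ Finset.range (n + 1), ∑ k ∈ Finset.range (2 ^ i),
          ∫⁻ ω, ENNReal.ofReal ((2 ^ i) ^ γ) ^ p *
          avgLip L b x₀ ((2 ^ n) ^ (1 - γ)) n i k (W ω) ^ p := by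
          have hm : ∀ i k, Measurable fun ω => ENNReal.ofReal ((2 ^ i) ^ γ) ^ p *
              avgLip L b x₀ ((2 ^ n) ^ (1 - γ)) n i k (W ω) ^ p := fun i k =>
            ((measurable_avgLip hL hb hW.2.1 _ _ _ _).pow_const p).const_mul _
          rw [lintegral_finsetSum _ fun i _ => Finset.measurable_fun_sum _ fun k _ => hm i k]
          exact Finset.sum_congr rfl fun i _ => lintegral_finsetSum _ fun k _ => hm i k
      _ ≤ ∑ i ∈ Finset.range (n + 1), ∑ k ∈ Finset.range (2 ^ i),
          ENNReal.ofReal (((2 ^ i) ^ γ) ^ p * (Q * (1 / 2 ^ i) ^ γ₁) ^ p) :=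
        Finset.sum_le_sum fun i hi => Finset.sum_le_sum fun k hk => h1 i hi k hk
      _ = ∑ i ∈ Finset.range (n + 1), ENNReal.ofReal (Q ^ p * ρ ^ i) := by
        refine Finset.sum_congr rfl fun i _ => ?_
        rw [Finset.sum_const, Finset.card_range, nsmul_eq_mul, ← h2, ENNReal.ofReal_mul
          (p := 2 ^ i) (by positivity), ← ENNReal.ofReal_natCast]
        push_cast
        rfl
      _ = ENNReal.ofReal (Q ^ p * ∑ i ∈ Finset.range (n + 1), ρ ^ i) := by
        rw [Finset.mul_sum, ENNReal.ofReal_sum_of_nonneg fun i _ => by positivity]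
      _ ≤ _ := by
        refine ENNReal.ofReal_le_ofReal ?_
        gcongr
        rw [← tsum_geometric_of_lt_one hρ0.le hρ1]
        exact (summable_geometric_of_lt_one hρ0.le hρ1).sum_le_tsum _ fun i _ => by positivity
  refine ⟨γ, hγ, by linarith, {w | liminf (fun n => kol n w) atTop = ⊤}, ?_, ?_, ?_⟩
  · exact (Measurable.liminf hkol)
      (measurableSet_singleton ⊤)
  · have h1 : ∫⁻ ω, liminf (fun n => kol n (W ω)) atTop ≠ ⊤ := by
      refine ne_top_of_le_ne_top (ENNReal.ofReal_ne_top (r := Q ^ p * (1 - ρ)⁻¹))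
        ((lintegral_liminf_le hkolW).trans ?_)
      exact liminf_le_of_frequently_le' (Frequently.of_forall hint)
    have h2 := ae_lt_top (Measurable.liminf hkolW) h1
    rw [ae_iff] at h2
    simpa [not_lt, top_le_iff] using h2
  · intro w hw
    have hlt : liminf (fun n => kol n w) atTop < ⊤ := lt_top_iff_ne_top.2 hw
    obtain ⟨K, hK1, hK2⟩ := ENNReal.lt_iff_exists_nnreal_btwn.1 hlt
    refine ⟨max 1 K, by positivity, ?_⟩
    refine (frequently_lt_of_liminf_lt (by isBoundedDefault) hK1).mono fun n hn i hi k hk => ?_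
    have h1 : ENNReal.ofReal ((2 ^ i) ^ γ) ^ p * avgLip L b x₀ ((2 ^ n) ^ (1 - γ)) n i k w ^ p ≤
        K := by
      refine le_trans ?_ hn.le
      refine le_trans ?_ (Finset.single_le_sum (f := fun i => ∑ k ∈ Finset.range (2 ^ i),
        ENNReal.ofReal ((2 ^ i) ^ γ) ^ p * avgLip L b x₀ ((2 ^ n) ^ (1 - γ)) n i k w ^ p)
        (fun _ _ => zero_le) (Finset.mem_range.2 (Nat.lt_succ_of_le hi)))
      exact Finset.single_le_sum (f := fun k => ENNReal.ofReal ((2 ^ i) ^ γ) ^ p *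
        avgLip L b x₀ ((2 ^ n) ^ (1 - γ)) n i k w ^ p)
        (fun _ _ => zero_le) (Finset.mem_range.2 hk)
    rw [← mul_pow] at h1
    have h2 : ENNReal.ofReal ((2 ^ i) ^ γ) * avgLip L b x₀ ((2 ^ n) ^ (1 - γ)) n i k w ≤
        ENNReal.ofReal (max 1 K) := by
      have h3 : (K : ℝ≥0∞) ≤ ENNReal.ofReal (max 1 (K : ℝ)) ^ p := by
        rw [← ENNReal.ofReal_pow (by positivity), ← ENNReal.ofReal_coe_nnreal]
        exact ENNReal.ofReal_le_ofReal ((le_max_right 1 _).trans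
          (le_self_pow₀ (le_max_left 1 (K : ℝ)) (by omega : p ≠ 0)))
      exact (ENNReal.pow_le_pow_left_iff (by omega)).1 (h1.trans h3)
    have h4 : (0 : ℝ) < (2 ^ i) ^ γ := by positivity
    rw [one_div, Real.inv_rpow (by positivity), ← div_eq_mul_inv, ENNReal.ofReal_div_of_pos h4,
      ENNReal.le_div_iff_mul_le (Or.inl (by simpa using h4)) (Or.inl ENNReal.ofReal_ne_top),
      mul_comm]
    exact h2

end

section
variable {E : Type*} [NormedAddCommGroup E] {A : ℕ → ℕ → E → E} {p : ℕ → ℕ → E}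
  {θ K ε B M V : ℝ} {j q : ℕ}

lemma two_mul_div_two_pow_succ (k l : ℕ) : 2 * k / 2 ^ (l + 1) = k / 2 ^ l := by
  rw [pow_succ', Nat.mul_div_mul_left _ _ (by norm_num)]

lemma two_mul_add_one_div_two_pow_succ (k l : ℕ) : (2 * k + 1) / 2 ^ (l + 1) = k / 2 ^ l := by
  rw [pow_succ', ← Nat.div_div_eq_div_mul]
  congr 1
  omega

lemma lt_two_pow_add {k l : ℕ} (hq : q < 2 ^ j) (hk : k / 2 ^ l = q) : k < 2 ^ (j + l) := by
  rw [pow_add]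
  exact (Nat.div_lt_iff_lt_mul (by positivity)).1 (hk ▸ hq)

/-- Sewing estimate on the dyadic subintervals of the `q`-th dyadic interval of level `j`. -/
lemma norm_sub_sub_le_of_dyadic (hθ2 : 2 * θ ^ 2 < 1) (hθ : 0 ≤ θ) (hK : 0 ≤ K)
    (hA : ∀ i k y, A i k y = A (i + 1) (2 * k) y + A (i + 1) (2 * k + 1) y)
    (hAK : ∀ i k, k < 2 ^ i → ∀ y z, ‖A i k y - A i k z‖ ≤ K * θ ^ i * ‖y - z‖)
    (hp : ∀ i k, p (i + 1) (2 * k) = p i k)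
    (hD : ∀ i k, k < 2 ^ i →
      ‖p i (k + 1) - p i k - A i k (p i k)‖ ≤ ε * (1 / 2) ^ i + B * (1 / 4) ^ i)
    (hq : q < 2 ^ j)
    (hV : ∀ l k, k / 2 ^ l = q → ‖p (j + l) (k + 1) - p (j + l) k‖ ≤ V * θ ^ (j + l))
    {l k : ℕ} (hk : k / 2 ^ l = q) :
    ‖p (j + l) (k + 1) - p (j + l) k - A (j + l) k (p (j + l) k)‖ ≤
      θ ^ 2 / (1 - 2 * θ ^ 2) * (K * V) * (θ ^ (j + l)) ^ 2 + ε * (1 / 2) ^ (j + l) := by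
  set c : ℝ := θ ^ 2 / (1 - 2 * θ ^ 2)
  have hc : 2 * θ ^ 2 * c + θ ^ 2 = c := by
    have : 1 - 2 * θ ^ 2 ≠ 0 := by linarith
    simp only [c]
    field_simp
    ring
  have hV0 : 0 ≤ V * θ ^ j := (norm_nonneg _).trans (by simpa using hV 0 q (by simp))
  have hc0 : 0 ≤ c := div_nonneg (by positivity) (by linarith)
  have key : ∀ N l k, k / 2 ^ l = q →
      ‖p (j + l) (k + 1) - p (j + l) k - A (j + l) k (p (j + l) k)‖ ≤
        c * (K * V) * (θ ^ (j + l)) ^ 2 + ε * (1 / 2) ^ (j + l) +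
          B * (1 / 4) ^ (j + l) * (1 / 2) ^ N := by
    intro N
    induction N with
    | zero =>
      intro l k hk
      have hcV : 0 ≤ c * (K * V) * (θ ^ (j + l)) ^ 2 := by
        have : c * (K * V) * (θ ^ (j + l)) ^ 2 = c * K * (V * θ ^ j) * (θ ^ j * (θ ^ l) ^ 2) := by
          ring
        rw [this]
        positivity
      have := hD (j + l) k (lt_two_pow_add hq hk)
      simp only [pow_zero, mul_one]
      linarith
    | succ N ih =>
      intro l k hk
      have h1 := ih (l + 1) (2 * k) ((two_mul_div_two_pow_succ k l).trans hk)
      have hk2 := (two_mul_add_one_div_two_pow_succ k l).trans hk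
      have h2 := ih (l + 1) (2 * k + 1) hk2
      have h3 := hAK (j + (l + 1)) (2 * k + 1) (lt_two_pow_add hq hk2)
        (p (j + (l + 1)) (2 * k + 1)) (p (j + (l + 1)) (2 * k))
      have h4 : ‖p (j + (l + 1)) (2 * k + 1) - p (j + (l + 1)) (2 * k)‖ ≤ V * θ ^ (j + (l + 1)) :=
        hV (l + 1) (2 * k) ((two_mul_div_two_pow_succ k l).trans hk)
      have h5 : K * θ ^ (j + (l + 1)) * ‖p (j + (l + 1)) (2 * k + 1) - p (j + (l + 1)) (2 * k)‖ ≤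
        K * θ ^ (j + (l + 1)) * (V * θ ^ (j + (l + 1))) := by gcongr
      have e1 : p (j + l) k = p (j + (l + 1)) (2 * k) := (hp (j + l) k).symm
      have e2 : p (j + l) (k + 1) = p (j + (l + 1)) (2 * k + 1 + 1) := (hp (j + l) (k + 1)).symm
      have e3 : p (j + l) (k + 1) - p (j + l) k - A (j + l) k (p (j + l) k) =
          (p (j + (l + 1)) (2 * k + 1) - p (j + (l + 1)) (2 * k) -
            A (j + (l + 1)) (2 * k) (p (j + (l + 1)) (2 * k))) +
          (p (j + (l + 1)) (2 * k + 1 + 1) - p (j + (l + 1)) (2 * k + 1) -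
            A (j + (l + 1)) (2 * k + 1) (p (j + (l + 1)) (2 * k + 1))) +
          (A (j + (l + 1)) (2 * k + 1) (p (j + (l + 1)) (2 * k + 1)) -
            A (j + (l + 1)) (2 * k + 1) (p (j + (l + 1)) (2 * k))) := by
        rw [hA (j + l) k, e1, e2, add_assoc j l 1]
        abel
      rw [e3]
      refine (norm_add₃_le).trans ?_
      have e4 : c * (K * V) * (θ ^ (j + l)) ^ 2 =
          2 * (c * (K * V) * (θ ^ (j + (l + 1))) ^ 2) +
            K * θ ^ (j + (l + 1)) * (V * θ ^ (j + (l + 1))) := by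
        have : θ ^ (j + (l + 1)) = θ ^ (j + l) * θ := by ring
        rw [this]
        nth_rewrite 1 [← hc]
        ring
      have e5 : ε * (1 / 2) ^ (j + l) = 2 * (ε * (1 / 2) ^ (j + (l + 1))) := by ring
      have e6 : B * (1 / 4) ^ (j + l) * (1 / 2) ^ (N + 1) =
          2 * (B * (1 / 4) ^ (j + (l + 1)) * (1 / 2) ^ N) := by
        rw [← add_assoc j l 1, pow_succ (1 / 4 : ℝ), pow_succ (1 / 2 : ℝ)]
        ring
      rw [e4, e5, e6]
      linarith
  have hlim : Tendsto (fun N : ℕ => c * (K * V) * (θ ^ (j + l)) ^ 2 + ε * (1 / 2) ^ (j + l) +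
      B * (1 / 4) ^ (j + l) * (1 / 2) ^ N) atTop
      (𝓝 (c * (K * V) * (θ ^ (j + l)) ^ 2 + ε * (1 / 2) ^ (j + l) +
      B * (1 / 4) ^ (j + l) * 0)) :=
    ((tendsto_pow_atTop_nhds_zero_of_lt_one (by norm_num) (by norm_num)).const_mul _).const_add _
  rw [mul_zero, add_zero] at hlim
  exact ge_of_tendsto' hlim fun N => key N l k hk

/-- Chaining along the dyadic points of the `q`-th dyadic interval of level `j`. -/
lemma norm_sub_le_of_dyadic (hθ1 : θ < 1) (hp : ∀ i k, p (i + 1) (2 * k) = p i k)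
    (hV : ∀ l k, k / 2 ^ l = q → ‖p (j + l) (k + 1) - p (j + l) k‖ ≤ V * θ ^ (j + l))
    (hθ : 0 ≤ θ) (hV0 : 0 ≤ V) :
    ∀ l k, k / 2 ^ l = q → ‖p (j + l) k - p j q‖ ≤ V * (θ / (1 - θ)) * (θ ^ j - θ ^ (j + l)) := by
  intro l
  induction l with
  | zero =>
    intro k hk
    rw [pow_zero, Nat.div_one] at hk
    simp [hk]
  | succ l ih =>
    intro k hk
    have e : V * (θ / (1 - θ)) * (θ ^ j - θ ^ (j + (l + 1))) =
        V * (θ / (1 - θ)) * (θ ^ j - θ ^ (j + l)) + V * θ ^ (j + (l + 1)) := by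
      have : 1 - θ ≠ 0 := by linarith
      field_simp
      ring
    rcases Nat.even_or_odd' k with ⟨m, rfl | rfl⟩
    · rw [two_mul_div_two_pow_succ] at hk
      have : p (j + (l + 1)) (2 * m) = p (j + l) m := hp (j + l) m
      rw [this, e]
      exact (ih m hk).trans (le_add_of_nonneg_right (by positivity))
    · have h1 := hV (l + 1) (2 * m) (by
        rw [two_mul_div_two_pow_succ, ← two_mul_add_one_div_two_pow_succ, hk])
      rw [two_mul_add_one_div_two_pow_succ] at hk
      have h2 : p (j + (l + 1)) (2 * m) = p (j + l) m := hp (j + l) m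
      have h3 := ih m hk
      rw [← h2] at h3
      calc ‖p (j + (l + 1)) (2 * m + 1) - p j q‖
          = ‖(p (j + (l + 1)) (2 * m) - p j q) +
            (p (j + (l + 1)) (2 * m + 1) - p (j + (l + 1)) (2 * m))‖ := by congr 1; abel
        _ ≤ _ := (norm_add_le _ _).trans (by rw [e]; exact add_le_add h3 h1)

/-- Discrete stability of Young equations: a function on the dyadic points of the unit interval
that starts at zero and solves a Young equation with Lipschitz increments `A i k` up to an error
`ε` is of size `ε`. -/
lemma exists_forall_norm_le_of_dyadic (hθ2 : 2 * θ ^ 2 < 1) (hθ : 1 / 2 ≤ θ) (hK : 0 ≤ K) :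
    ∃ C : ℝ, ∃ j : ℕ, ∀ (A : ℕ → ℕ → E → E) (p : ℕ → ℕ → E) (ε B M : ℝ),
      (∀ i k y, A i k y = A (i + 1) (2 * k) y + A (i + 1) (2 * k + 1) y) →
      (∀ i k, k < 2 ^ i → ∀ y z, ‖A i k y - A i k z‖ ≤ K * θ ^ i * ‖y - z‖) →
      (∀ i k, A i k 0 = 0) →
      (∀ i k, p (i + 1) (2 * k) = p i k) →
      (∀ i k, k < 2 ^ i →
        ‖p i (k + 1) - p i k - A i k (p i k)‖ ≤ ε * (1 / 2) ^ i + B * (1 / 4) ^ i) →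
      (∀ i k, k < 2 ^ i → ‖p i (k + 1) - p i k‖ ≤ M * (1 / 2) ^ i) →
      p 0 0 = 0 → 0 ≤ ε → ∀ i ≥ j, ∀ k < 2 ^ i, ‖p i k‖ ≤ C * ε := by
  have hθ1 : θ < 1 := by nlinarith
  have hθ0 : 0 < θ := by linarith
  set c : ℝ := θ ^ 2 / (1 - 2 * θ ^ 2) with hc
  set c' : ℝ := θ / (1 - θ) with hc'
  have hc0 : 0 ≤ c := div_nonneg (by positivity) (by linarith)
  have hc'0 : 0 ≤ c' := div_nonneg (by positivity) (by linarith)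
  obtain ⟨j, hj⟩ : ∃ j : ℕ, K * (c + c') * θ ^ j ≤ 1 / 2 := by
    have h := (tendsto_pow_atTop_nhds_zero_of_lt_one hθ0.le hθ1).const_mul (K * (c + c'))
    rw [mul_zero] at h
    exact (h.eventually_le_const (by norm_num)).exists
  refine ⟨(3 + 2 * K) ^ 2 ^ j * (1 + 2 * K * c') + 2 * c', j, ?_⟩
  intro A p ε B M hA hAK hA0 hp hD hM hp0 hε
  have hM0 : 0 ≤ M := (norm_nonneg _).trans (by simpa using hM 0 0 (by norm_num))
  have hinc : ∀ q < 2 ^ j, ∀ l k, k / 2 ^ l = q →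
      ‖p (j + l) (k + 1) - p (j + l) k‖ ≤ 2 * (ε + K * ‖p j q‖) * θ ^ (j + l) := by
    intro q hq
    have hstep : ∀ m : ℕ, ∀ l k, k / 2 ^ l = q → ‖p (j + l) (k + 1) - p (j + l) k‖ ≤
        (M * (1 / 2) ^ m + 2 * (ε + K * ‖p j q‖)) * θ ^ (j + l) := by
      intro m
      induction m with
      | zero =>
        intro l k hk
        refine (hM (j + l) k (lt_two_pow_add hq hk)).trans ?_
        have h1 : (1 / 2 : ℝ) ^ (j + l) ≤ θ ^ (j + l) := by gcongr
        rw [pow_zero, mul_one]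
        have h2 : 0 ≤ 2 * (ε + K * ‖p j q‖) := by positivity
        exact mul_le_mul (by linarith) h1 (by positivity) (by positivity)
      | succ m ih =>
        intro l k hk
        set V := M * (1 / 2) ^ m + 2 * (ε + K * ‖p j q‖) with hV
        have hV0 : 0 ≤ V := by positivity
        have h1 := norm_sub_sub_le_of_dyadic hθ2 hθ0.le hK hA hAK hp hD hq ih hk
        have h2 := norm_sub_le_of_dyadic hθ1 hp ih hθ0.le hV0 l k hk
        have h3 := hAK (j + l) k (lt_two_pow_add hq hk) (p (j + l) k) 0
        rw [hA0, sub_zero, sub_zero] at h3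
        set T := θ ^ (j + l) with hT
        have hT0 : 0 < T := by positivity
        have h4 : ‖p (j + l) k‖ ≤ ‖p j q‖ + V * c' * θ ^ j := by
          have h5 : ‖p (j + l) k‖ ≤ ‖p j q‖ + ‖p (j + l) k - p j q‖ :=
            norm_le_norm_add_norm_sub' _ _
          have h6 : V * c' * (θ ^ j - T) ≤ V * c' * θ ^ j := by
            gcongr
            linarith
          linarith
        have h5 : (1 / 2 : ℝ) ^ (j + l) ≤ T := by simp only [T]; gcongr
        have h6 : T ≤ θ ^ j := pow_le_pow_of_le_one hθ0.le hθ1.le (by omega)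
        calc ‖p (j + l) (k + 1) - p (j + l) k‖
            ≤ ‖p (j + l) (k + 1) - p (j + l) k - A (j + l) k (p (j + l) k)‖ +
              ‖A (j + l) k (p (j + l) k)‖ := norm_le_norm_sub_add _ _
          _ ≤ (c * (K * V) * T ^ 2 + ε * (1 / 2) ^ (j + l)) +
              K * T * (‖p j q‖ + V * c' * θ ^ j) := by
              refine add_le_add h1 (h3.trans ?_)
              gcongr
          _ ≤ (c * (K * V) * (θ ^ j * T) + ε * T) + K * T * (‖p j q‖ + V * c' * θ ^ j) := by
              rw [pow_two T]
              gcongr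
          _ = (V * (K * (c + c') * θ ^ j) + ε + K * ‖p j q‖) * T := by ring
          _ ≤ (V * (1 / 2) + ε + K * ‖p j q‖) * T := by gcongr
          _ = (M * (1 / 2) ^ (m + 1) + 2 * (ε + K * ‖p j q‖)) * T := by
            rw [hV]; ring
    intro l k hk
    have hlim : Tendsto (fun m : ℕ => (M * (1 / 2) ^ m + 2 * (ε + K * ‖p j q‖)) * θ ^ (j + l))
        atTop (𝓝 ((M * 0 + 2 * (ε + K * ‖p j q‖)) * θ ^ (j + l))) :=
      (((tendsto_pow_atTop_nhds_zero_of_lt_one (by norm_num)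
        (by norm_num)).const_mul _).add_const _).mul_const _
    rw [mul_zero, zero_add] at hlim
    exact ge_of_tendsto' hlim fun m => hstep m l k hk
  have hgrid : ∀ q ≤ 2 ^ j, ‖p j q‖ ≤ (3 + 2 * K) ^ q * ε := by
    intro q
    induction q with
    | zero =>
      intro _
      have : ∀ i, p i 0 = 0 := by
        intro i
        induction i with
        | zero => exact hp0
        | succ i ih => rw [← ih]; exact hp i 0
      rw [this]
      simpa using hε
    | succ q ih =>
      intro hq
      have h1 := hinc q (by omega) 0 q (by simp)
      have h2 := ih (by omega)
      have h3 : θ ^ (j + 0) ≤ 1 := pow_le_one₀ hθ0.le hθ1.le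
      rw [add_zero] at h1 h3
      have h4 : ‖p j (q + 1)‖ ≤ ‖p j q‖ + ‖p j (q + 1) - p j q‖ := norm_le_norm_add_norm_sub' _ _
      have h5 : 2 * (ε + K * ‖p j q‖) * θ ^ j ≤ 2 * (ε + K * ‖p j q‖) :=
        mul_le_of_le_one_right (by positivity) h3
      have h6 : (1 : ℝ) ≤ (3 + 2 * K) ^ q := one_le_pow₀ (by linarith)
      have h7 : K * ‖p j q‖ ≤ K * ((3 + 2 * K) ^ q * ε) := by gcongr
      have h8 : ε ≤ (3 + 2 * K) ^ q * ε := le_mul_of_one_le_left hε h6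
      calc ‖p j (q + 1)‖ ≤ (3 + 2 * K) ^ q * ε + 2 * ((3 + 2 * K) ^ q * ε) +
            2 * (K * ((3 + 2 * K) ^ q * ε)) := by linarith
        _ = _ := by ring
  intro i hi k hk
  obtain ⟨l, rfl⟩ := Nat.exists_eq_add_of_le hi
  have hq : k / 2 ^ l < 2 ^ j := by
    rw [Nat.div_lt_iff_lt_mul (by positivity), ← pow_add]
    exact hk
  have h1 := norm_sub_le_of_dyadic hθ1 hp (hinc _ hq) hθ0.le (by positivity) l k rfl
  have h2 := hgrid _ hq.le
  have h3 : ‖p (j + l) k‖ ≤ ‖p j (k / 2 ^ l)‖ + ‖p (j + l) k - p j (k / 2 ^ l)‖ :=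
    norm_le_norm_add_norm_sub' _ _
  have h4 : θ ^ j - θ ^ (j + l) ≤ 1 := by
    have := pow_le_one₀ hθ0.le hθ1.le (n := j)
    have : 0 < θ ^ (j + l) := by positivity
    linarith
  have h5 : (3 + 2 * K) ^ (k / 2 ^ l) ≤ (3 + 2 * K) ^ 2 ^ j :=
    pow_le_pow_right₀ (by linarith) hq.le
  calc ‖p (j + l) k‖ ≤ ‖p j (k / 2 ^ l)‖ + 2 * (ε + K * ‖p j (k / 2 ^ l)‖) * c' * 1 := by
        refine h3.trans (add_le_add le_rfl (h1.trans ?_))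
        gcongr
    _ ≤ (3 + 2 * K) ^ 2 ^ j * ε + 2 * (ε + K * ((3 + 2 * K) ^ 2 ^ j * ε)) * c' * 1 := by
        have h6 : ‖p j (k / 2 ^ l)‖ ≤ (3 + 2 * K) ^ 2 ^ j * ε := h2.trans (by gcongr)
        gcongr
    _ = _ := by ring

end

/-- The Euler scheme of level `n` as a piecewise constant path. -/
def eulerPath {d : ℕ} (b : ℝ → Euc d → Euc d) (x₀ : Euc d) (n : ℕ) (w : ℝ → Euc d) (r : ℝ) :
    Euc d :=
  eulerX b x₀ n w ⌊r * 2 ^ n⌋₊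

/-- The drift accumulated along the path `X`. -/
def drift {d : ℕ} (b : ℝ → Euc d → Euc d) (x₀ : Euc d) (X : ℝ → Euc d) (t : ℝ) : Euc d :=
  x₀ + ∫ r in (0 : ℝ)..t, b r (X r)

section
variable {d : ℕ} {β : ℝ} {L : ℝ × Euc d → ℂ →L[ℝ] Euc d} {b : ℝ → Euc d → Euc d} {x₀ : Euc d}
  {n : ℕ} {w X : ℝ → Euc d} {Cb : ℝ}

lemma measurable_eulerPath : Measurable (eulerPath b x₀ n w) :=
  (measurable_from_nat (f := eulerX b x₀ n w)).comp
    (Nat.measurable_floor.comp (measurable_id.mul_const _))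

lemma eulerPath_eq {u : ℕ} {r : ℝ} (h : r ∈ Set.Ico (dy n u) (dy n (u + 1))) :
    eulerPath b x₀ n w r = eulerX b x₀ n w u := by
  have h2 : (0 : ℝ) < 2 ^ n := by positivity
  have h3 := h.1
  have h4 := h.2
  unfold dy at h3 h4
  rw [div_le_iff₀ h2] at h3
  rw [lt_div_iff₀ h2] at h4
  rw [eulerPath, (Nat.floor_eq_iff ((Nat.cast_nonneg u).trans h3)).2 ⟨h3, by exact_mod_cast h4⟩]

lemma intervalIntegrable_field (hb : Continuous fun q : ℝ × Euc d => b q.1 q.2)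
    (hbound : ∀ t x, ‖b t x‖ ≤ Cb) (hX : Measurable X) (s t : ℝ) :
    IntervalIntegrable (fun r => b r (X r)) volume s t := by
  refine (intervalIntegrable_const (c := Cb)).mono_fun
    (hb.measurable.comp (measurable_id.prodMk hX)).aestronglyMeasurable (ae_of_all _ fun r => ?_)
  exact (hbound _ _).trans (Real.le_norm_self _)

lemma drift_sub_drift (hb : Continuous fun q : ℝ × Euc d => b q.1 q.2)
    (hbound : ∀ t x, ‖b t x‖ ≤ Cb) (hX : Measurable X) (s t : ℝ) :
    drift b x₀ X t - drift b x₀ X s = ∫ r in s..t, b r (X r) := by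
  rw [drift, drift, add_sub_add_left_eq_sub, intervalIntegral.integral_interval_sub_left] <;>
  exact intervalIntegrable_field hb hbound hX _ _

lemma norm_drift_sub_drift_le (hb : Continuous fun q : ℝ × Euc d => b q.1 q.2)
    (hbound : ∀ t x, ‖b t x‖ ≤ Cb) (hX : Measurable X) (s t : ℝ) :
    ‖drift b x₀ X t - drift b x₀ X s‖ ≤ Cb * |t - s| := by
  rw [drift_sub_drift hb hbound hX]
  exact intervalIntegral.norm_integral_le_of_norm_le_const fun r _ => hbound _ _

lemma drift_eulerPath_dy (hb : Continuous fun q : ℝ × Euc d => b q.1 q.2)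
    (hbound : ∀ t x, ‖b t x‖ ≤ Cb) (k : ℕ) :
    drift b x₀ (eulerPath b x₀ n w) (dy n k) = euler b x₀ n w k := by
  induction k with
  | zero => simp [drift, dy, euler]
  | succ k ih =>
    rw [← sub_add_cancel (drift b x₀ (eulerPath b x₀ n w) (dy n (k + 1)))
      (drift b x₀ (eulerPath b x₀ n w) (dy n k)), drift_sub_drift hb hbound measurable_eulerPath,
      ih, euler, add_comm]
    congr 1
    refine intervalIntegral.integral_congr_Ioo_of_le (dy_mono n (by omega)) fun r hr => ?_
    rw [eulerPath_eq ⟨hr.1.le, hr.2⟩, eulerX]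

lemma chi_eq (p : ℝ × Euc d) (t : ℝ) (x : Euc d) :
    chi p t x = ee p.2 x * Complex.exp (Complex.I * Complex.ofReal (p.1 * t)) := by
  rw [chi, ee, ← Complex.exp_add]
  push_cast
  ring_nf

lemma integral_fld_dy (hL : Adm β L) (hβ0 : 0 ≤ β) (n u : ℕ) (x : Euc d) :
    ∫ r in dy n u..dy n (u + 1), fld L r x =
      ∫ p, L p (ee p.2 x * charInt n p.1 u) := by
  have h1 : Measurable fun q : ℝ × (ℝ × Euc d) => chi q.2 q.1 x := by
    unfold chi
    fun_prop
  have h : Continuous fun q : (ℂ →L[ℝ] Euc d) × ℂ => q.1 q.2 := by fun_prop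
  have h2 : StronglyMeasurable fun q : ℝ × (ℝ × Euc d) => L q.2 (chi q.2 q.1 x) :=
    h.comp_stronglyMeasurable ((hL.meas.comp_measurable measurable_snd).prodMk
      h1.stronglyMeasurable)
  have : IsFiniteMeasure (volume.restrict (Set.uIoc (dy n u) (dy n (u + 1)))) :=
    ⟨by rw [Measure.restrict_apply_univ, Set.uIoc]; exact measure_Ioc_lt_top⟩
  have h3 : Integrable (Function.uncurry fun (r : ℝ) (p : ℝ × Euc d) => L p (chi p r x))
      ((volume.restrict (Set.uIoc (dy n u) (dy n (u + 1)))).prod volume) := by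
    refine Integrable.mono' (g := fun q => 1 * ‖L q.2‖)
      ((integrable_const (1 : ℝ)).mul_prod (hL.integrable_norm hβ0)) h2.aestronglyMeasurable
      (ae_of_all _ fun q => ?_)
    refine (ContinuousLinearMap.le_opNorm _ _).trans ?_
    rw [norm_chi, mul_one, one_mul]
  unfold fld
  rw [intervalIntegral_integral_swap h3]
  refine integral_congr_ae (ae_of_all _ fun p => ?_)
  simp only
  have h4 : IntervalIntegrable (fun r => chi p r x) volume (dy n u) (dy n (u + 1)) := by
    refine Continuous.intervalIntegrable ?_ _ _
    unfold chi
    fun_prop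
  rw [(L p).intervalIntegral_comp_comm h4]
  simp only [chi_eq, charInt]
  rw [intervalIntegral.integral_const_mul]

lemma integral_fld_eulerPath (hL : Adm β L) (hβ0 : 0 ≤ β) (n s l : ℕ) (y : Euc d) :
    ∫ r in dy n s..dy n (s + l), fld L r (eulerPath b x₀ n w r + y) =
      ∫ p, L p (eulerSum b x₀ n p.2 (charInt n p.1) s l w * ee p.2 y) := by
  have hcont := hL.continuous_fld hβ0
  have hint : ∀ a c, IntervalIntegrable (fun r => fld L r (eulerPath b x₀ n w r + y)) volume a c :=
    intervalIntegrable_field hcont (fun t x => hL.norm_fld_le t x hβ0)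
      (measurable_eulerPath.add_const y)
  have h1 := intervalIntegral.sum_integral_adjacent_intervals (a := fun u => dy n (s + u)) (n := l)
    (f := fun r => fld L r (eulerPath b x₀ n w r + y)) (μ := volume) fun k _ => hint _ _
  rw [add_zero] at h1
  rw [← h1]
  have h2 : ∀ u, ∫ r in dy n (s + u)..dy n (s + (u + 1)), fld L r (eulerPath b x₀ n w r + y) =
      ∫ p, L p (ee p.2 (eulerX b x₀ n w (s + u)) * charInt n p.1 (s + u) * ee p.2 y) := by
    intro u
    rw [← add_assoc]
    calc _ = ∫ r in dy n (s + u)..dy n (s + u + 1), fld L r (eulerX b x₀ n w (s + u) + y) := by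
          refine intervalIntegral.integral_congr_Ioo_of_le (dy_mono n (by omega)) fun r hr => ?_
          rw [eulerPath_eq ⟨hr.1.le, hr.2⟩]
      _ = _ := by
          rw [integral_fld_dy hL hβ0]
          refine integral_congr_ae (ae_of_all _ fun p => ?_)
          simp only
          rw [ee_add]
          ring_nf
  have hint2 : ∀ u, Integrable fun p : ℝ × Euc d => L p (ee p.2 (eulerX b x₀ n w (s + u)) *
      charInt n p.1 (s + u) * ee p.2 y) := by
    intro u
    have hm : Measurable fun p : ℝ × Euc d => ee p.2 (eulerX b x₀ n w (s + u)) *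
        charInt n p.1 (s + u) * ee p.2 y := by
      have h3 : ∀ z : Euc d, Measurable fun p : ℝ × Euc d => ee p.2 z := fun z => by
        unfold ee
        fun_prop
      exact ((h3 _).mul ((measurable_charInt n (s + u)).comp measurable_fst)).mul (h3 _)
    refine (hL.integrable_norm hβ0).mono' (hL.aestronglyMeasurable_apply hm)
      (ae_of_all _ fun p => ?_)
    refine (ContinuousLinearMap.le_opNorm _ _).trans
      (mul_le_of_le_one_right (norm_nonneg _) ?_)
    rw [norm_mul, norm_mul, norm_ee, norm_ee, one_mul, mul_one]
    refine (norm_charInt_le n p.1 (s + u)).trans ?_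
    rw [div_le_one (by positivity)]
    exact one_le_pow₀ (by norm_num)
  simp only [h2]
  rw [← integral_finsetSum _ fun u _ => hint2 u]
  refine integral_congr_ae (ae_of_all _ fun p => ?_)
  simp only [eulerSum]
  rw [Finset.sum_mul, map_sum]

lemma dy_eq_dy_mul {i n : ℕ} (h : i ≤ n) (k : ℕ) : dy i k = dy n (k * 2 ^ (n - i)) := by
  obtain ⟨l, rfl⟩ := Nat.exists_eq_add_of_le h
  simp only [dy, Nat.add_sub_cancel_left, pow_add]
  push_cast
  field_simp

lemma norm_integral_fld_trunc_le {R A : ℝ} (hL : Adm β L) (hβ0 : 0 ≤ β) {i k : ℕ}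
    (hi : i ≤ n) (hA : 0 ≤ A) (h : avgLip L b x₀ R n i k w ≤ ENNReal.ofReal A) (y z : Euc d) :
    ‖(∫ r in dy i k..dy i (k + 1), fld (trunc L R) r (eulerPath b x₀ n w r + y)) -
      ∫ r in dy i k..dy i (k + 1), fld (trunc L R) r (eulerPath b x₀ n w r + z)‖ ≤
      A * ‖y - z‖ := by
  have hLR := hL.trunc R
  rw [dy_eq_dy_mul hi, dy_eq_dy_mul hi, add_mul, one_mul, integral_fld_eulerPath hLR hβ0,
    integral_fld_eulerPath hLR hβ0]
  set S : ℝ × Euc d → ℂ := fun p =>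
    eulerSum b x₀ n p.2 (charInt n p.1) (k * 2 ^ (n - i)) (2 ^ (n - i)) w
  have hSm : Measurable S := by
    unfold S eulerSum
    refine Finset.measurable_fun_sum _ fun u _ => ?_
    have h3 : Measurable fun p : ℝ × Euc d => ee p.2 (eulerX b x₀ n w (k * 2 ^ (n - i) + u)) := by
      unfold ee
      fun_prop
    have h4 : Measurable fun p : ℝ × Euc d => p.1 := measurable_fst
    have h5 := (measurable_charInt n (k * 2 ^ (n - i) + u)).comp h4
    exact h3.mul h5
  have hSb : ∀ p, ‖S p‖ ≤ 2 ^ (n - i) * (1 / 2 ^ n) := fun p => by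
    simpa using norm_eulerSum_le (fun u => norm_charInt_le n p.1 u) (2 ^ (n - i)) w
  have hint : ∀ y : Euc d, Integrable fun p : ℝ × Euc d => trunc L R p (S p * ee p.2 y) := by
    intro y
    have h3 : Measurable fun p : ℝ × Euc d => ee p.2 y := by
      unfold ee
      fun_prop
    refine ((hLR.integrable_norm hβ0).mul_const (2 ^ (n - i) * (1 / 2 ^ n))).mono'
      (hLR.aestronglyMeasurable_apply (hSm.mul h3)) (ae_of_all _ fun p => ?_)
    refine (ContinuousLinearMap.le_opNorm _ _).trans
      (mul_le_mul_of_nonneg_left ?_ (norm_nonneg _))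
    rw [norm_mul, norm_ee, mul_one]
    exact hSb p
  rw [← integral_sub (hint y) (hint z)]
  have hAy : 0 ≤ A * ‖y - z‖ := by positivity
  rw [← ENNReal.ofReal_le_ofReal_iff hAy, ofReal_norm]
  refine (enorm_integral_le_lintegral_enorm _).trans ?_
  have hS : MeasurableSet {q : ℝ × Euc d | ‖q.2‖ ≤ R} := measurable_snd.norm measurableSet_Iic
  calc ∫⁻ p, ‖trunc L R p (S p * ee p.2 y) - trunc L R p (S p * ee p.2 z)‖ₑ
      ≤ ∫⁻ p, {q : ℝ × Euc d | ‖q.2‖ ≤ R}.indicator (fun p => ‖L p‖ₑ * (ENNReal.ofReal ‖p.2‖ *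
          ‖S p‖ₑ) * ENNReal.ofReal ‖y - z‖) p := by
        refine lintegral_mono fun p => ?_
        by_cases hp : p ∈ {q : ℝ × Euc d | ‖q.2‖ ≤ R}
        · rw [Set.indicator_of_mem hp, trunc, Set.indicator_of_mem hp, ← map_sub, ← mul_sub]
          simp only [← ofReal_norm]
          rw [← ENNReal.ofReal_mul (by positivity), ← ENNReal.ofReal_mul (by positivity),
            ← ENNReal.ofReal_mul (by positivity)]
          refine ENNReal.ofReal_le_ofReal ((ContinuousLinearMap.le_opNorm _ _).trans ?_)
          rw [norm_mul]
          calc ‖L p‖ * (‖S p‖ * ‖ee p.2 y - ee p.2 z‖)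
              ≤ ‖L p‖ * (‖S p‖ * (‖p.2‖ * ‖y - z‖)) := by
                gcongr
                exact norm_ee_sub_le _ _ _
            _ = _ := by ring
        · rw [Set.indicator_of_notMem hp, trunc, Set.indicator_of_notMem hp]
          simp
    _ = avgLip L b x₀ R n i k w * ENNReal.ofReal ‖y - z‖ := by
        rw [lintegral_indicator hS, lintegral_mul_const' _ _ ENNReal.ofReal_ne_top]
        rfl
    _ ≤ ENNReal.ofReal A * ENNReal.ofReal ‖y - z‖ := by gcongr
    _ = _ := (ENNReal.ofReal_mul hA).symm

end

lemma dy_succ_two_mul (i k : ℕ) : dy (i + 1) (2 * k) = dy i k := by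
  simp only [dy, pow_succ]
  push_cast
  field_simp

lemma exists_lt_two_pow_abs_sub_dy_le {t : ℝ} (ht : t ∈ Set.Icc (0 : ℝ) 1) (i : ℕ) :
    ∃ k < 2 ^ i, |t - dy i k| ≤ 1 / 2 ^ i := by
  have h2 : (0 : ℝ) < 2 ^ i := by positivity
  have h2' : 0 < 2 ^ i := by positivity
  rcases ht.2.lt_or_eq with h1 | rfl
  · refine ⟨⌊t * 2 ^ i⌋₊, ?_, ?_⟩
    · rw [Nat.floor_lt (mul_nonneg ht.1 h2.le)]
      push_cast
      nlinarith
    · have h3 := Nat.floor_le (mul_nonneg ht.1 h2.le)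
      have h4 := Nat.lt_floor_add_one (t * 2 ^ i)
      have h5 : t - dy i ⌊t * 2 ^ i⌋₊ = (t * 2 ^ i - ⌊t * 2 ^ i⌋₊) / 2 ^ i := by
        unfold dy
        field_simp
      rw [h5, abs_of_nonneg (div_nonneg (by linarith) h2.le)]
      gcongr
      linarith
  · refine ⟨2 ^ i - 1, by omega, ?_⟩
    have h5 : (1 : ℝ) - dy i (2 ^ i - 1) = 1 / 2 ^ i := by
      unfold dy
      rw [Nat.cast_sub h2']
      push_cast
      field_simp
      ring
    rw [h5, abs_of_nonneg (by positivity)]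

section
variable {d : ℕ} {β γ K : ℝ} {L : ℝ × Euc d → ℂ →L[ℝ] Euc d} {x₀ : Euc d} {w : ℝ → Euc d}

/-- Stability of the equation: paths that solve it approximately stay close to the Euler scheme, for
the levels at which the averaged field is Lipschitz. -/
lemma exists_norm_drift_sub_drift_eulerPath_le (hL : Adm β L) (hβ0 : 0 ≤ β) (hβ1 : β ≤ 1)
    (hγ : 1 / 2 < γ) (hγ1 : γ < 1) (hK : 0 ≤ K) :
    ∃ C : ℝ, ∀ (n : ℕ) (X : ℝ → Euc d) (ρ ρ' : ℝ),
      (∀ i ≤ n, ∀ k < 2 ^ i, avgLip L (fld L) x₀ ((2 ^ n) ^ (1 - γ)) n i k w ≤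
        ENNReal.ofReal (K * (1 / 2 ^ i) ^ γ)) →
      Measurable X →
      (∀ r ∈ Set.Icc (0 : ℝ) 1, ‖X r - (drift (fld L) x₀ X r + w r)‖ ≤ ρ) →
      (∀ r ∈ Set.Icc (0 : ℝ) 1, ‖drift (fld L) x₀ (eulerPath (fld L) x₀ n w) r + w r -
        eulerPath (fld L) x₀ n w r‖ ≤ ρ') →
      ∀ t ∈ Set.Icc (0 : ℝ) 1,
        ‖drift (fld L) x₀ X t - drift (fld L) x₀ (eulerPath (fld L) x₀ n w) t‖ ≤
        C * (2 * (∫ p, ‖L p‖ * (1 + ‖p.2‖) ^ β) * ρ ^ β +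
          2 * (∫ p, ‖L p‖ * (1 + ‖p.2‖) ^ β) * ρ' ^ β +
          2 * ∫ p, ‖L p - trunc L ((2 ^ n) ^ (1 - γ)) p‖) := by
  set θ : ℝ := (1 / 2) ^ γ with hθdef
  have hθpow : ∀ i : ℕ, θ ^ i = (1 / 2 ^ i) ^ γ := fun i => by
    rw [hθdef, ← Real.rpow_natCast, ← Real.rpow_mul (by norm_num), mul_comm γ,
      Real.rpow_mul (by norm_num), Real.rpow_natCast, one_div_pow]
  have hθ : 1 / 2 ≤ θ := by
    have := Real.rpow_le_rpow_of_exponent_ge (x := 1 / 2) (by norm_num) (by norm_num) hγ1.le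
    rwa [Real.rpow_one] at this
  have hθ2 : 2 * θ ^ 2 < 1 := by
    have h1 : θ ^ 2 = (1 / 2) ^ (γ * 2) := by
      rw [Real.rpow_mul (by norm_num), Real.rpow_two]
    have h2 := Real.rpow_lt_rpow_of_exponent_gt (x := 1 / 2) (by norm_num) (by norm_num)
      (show 1 < γ * 2 by linarith)
    rw [Real.rpow_one] at h2
    rw [h1]
    linarith
  set J : ℝ := ∫ p, ‖L p‖ with hJ
  have hJ0 : 0 ≤ J := integral_nonneg fun p => norm_nonneg _
  obtain ⟨C, j, hC⟩ := exists_forall_norm_le_of_dyadic (E := Euc d) (K := K + J) hθ2 hθ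
    (by positivity)
  refine ⟨C, ?_⟩
  intro n X ρ ρ' havg hX hXρ hEρ t ht
  set R : ℝ := (2 ^ n) ^ (1 - γ) with hR
  have hR0 : 0 ≤ R := by positivity
  set Q : ℝ := 2 * ∫ p, ‖L p‖ * (1 + ‖p.2‖) ^ β with hQ
  have hI0 : 0 ≤ ∫ p, ‖L p‖ * (1 + ‖p.2‖) ^ β := integral_nonneg fun p => by positivity
  have hQ0 : 0 ≤ Q := by positivity
  set δ : ℝ := ∫ p, ‖L p - trunc L R p‖ with hδ
  have hδ0 : 0 ≤ δ := integral_nonneg fun p => norm_nonneg _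
  have hρ0 : 0 ≤ ρ := (norm_nonneg _).trans (hXρ 0 (by simp))
  have hρ'0 : 0 ≤ ρ' := (norm_nonneg _).trans (hEρ 0 (by simp))
  set ε : ℝ := Q * ρ ^ β + Q * ρ' ^ β + 2 * δ with hε
  have hε0 : 0 ≤ ε := by positivity
  set Y := eulerPath (fld L) x₀ n w with hY
  have hYm : Measurable Y := measurable_eulerPath
  have hb := hL.continuous_fld hβ0
  have hbd : ∀ t x, ‖fld L t x‖ ≤ ∫ p, ‖L p‖ * (1 + ‖p.2‖) ^ β :=
    fun t x => hL.norm_fld_le t x hβ0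
  have hLR := hL.trunc R
  have hbR := hLR.continuous_fld hβ0
  have hbRd : ∀ t x, ‖fld (trunc L R) t x‖ ≤ ∫ p, ‖trunc L R p‖ * (1 + ‖p.2‖) ^ β :=
    fun t x => hLR.norm_fld_le t x hβ0
  set ψ : ℝ → Euc d := fun t => drift (fld L) x₀ X t - drift (fld L) x₀ Y t with hψ
  have hψlip : ∀ s t, ‖ψ t - ψ s‖ ≤ Q * |t - s| := by
    intro s t
    have h1 := norm_drift_sub_drift_le (x₀ := x₀) hb hbd hX s t
    have h2 := norm_drift_sub_drift_le (x₀ := x₀) hb hbd hYm s t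
    calc ‖ψ t - ψ s‖ = ‖(drift (fld L) x₀ X t - drift (fld L) x₀ X s) -
          (drift (fld L) x₀ Y t - drift (fld L) x₀ Y s)‖ := by congr 1; simp only [ψ]; abel
      _ ≤ _ := (norm_sub_le _ _).trans (by rw [hQ]; linarith)
  have hintR : ∀ (y : Euc d) (s t : ℝ),
      IntervalIntegrable (fun r => fld (trunc L R) r (Y r + y)) volume s t :=
    fun y => intervalIntegrable_field hbR hbRd (hYm.add_const y)
  have hlen : ∀ i k, dy i (k + 1) - dy i k = 1 / 2 ^ i := fun i k => by simp [dy_add_sub]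
  have hgrid := hC
    (fun i k y => (∫ r in dy i k..dy i (k + 1), fld (trunc L R) r (Y r + y)) -
      ∫ r in dy i k..dy i (k + 1), fld (trunc L R) r (Y r + 0))
    (fun i k => ψ (dy i k)) ε (R * J * Q) Q ?_ ?_ ?_ ?_ ?_ ?_ ?_ hε0
  · have hlim : Tendsto (fun i : ℕ => C * ε + Q * (1 / 2) ^ i) atTop (𝓝 (C * ε + Q * 0)) :=
      ((tendsto_pow_atTop_nhds_zero_of_lt_one (by norm_num) (by norm_num)).const_mul _).const_add _
    rw [mul_zero, add_zero] at hlim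
    refine ge_of_tendsto hlim ?_
    filter_upwards [eventually_ge_atTop j] with i hi
    obtain ⟨k, hk, hkt⟩ := exists_lt_two_pow_abs_sub_dy_le ht i
    have h1 := hgrid i hi k hk
    have h2 := hψlip (dy i k) t
    have h3 : ‖ψ t‖ ≤ ‖ψ (dy i k)‖ + ‖ψ t - ψ (dy i k)‖ := norm_le_norm_add_norm_sub' _ _
    rw [one_div_pow]
    have h4 : Q * |t - dy i k| ≤ Q * (1 / 2 ^ i) := by gcongr
    change ‖ψ t‖ ≤ _
    linarith
  · intro i k y
    have h1 : ∀ y, ∫ r in dy i k..dy i (k + 1), fld (trunc L R) r (Y r + y) =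
        (∫ r in dy (i + 1) (2 * k)..dy (i + 1) (2 * k + 1), fld (trunc L R) r (Y r + y)) +
        ∫ r in dy (i + 1) (2 * k + 1)..dy (i + 1) (2 * k + 1 + 1),
          fld (trunc L R) r (Y r + y) := by
      intro y
      rw [intervalIntegral.integral_add_adjacent_intervals (hintR _ _ _) (hintR _ _ _),
        dy_succ_two_mul, show 2 * k + 1 + 1 = 2 * (k + 1) by ring, dy_succ_two_mul]
    simp only [h1]
    abel
  · intro i k hk y z
    simp only [sub_sub_sub_cancel_right]
    rw [hθpow]
    rcases le_or_gt i n with hi | hi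
    · refine (norm_integral_fld_trunc_le hL hβ0 hi (by positivity) (havg i hi k hk) y z).trans ?_
      gcongr
      linarith
    · rw [← intervalIntegral.integral_sub (hintR _ _ _) (hintR _ _ _)]
      have h1 : ∀ r ∈ Set.uIoc (dy i k) (dy i (k + 1)), ‖fld (trunc L R) r (Y r + y) -
          fld (trunc L R) r (Y r + z)‖ ≤ R * J * ‖y - z‖ := fun r _ => by
        simpa using hL.norm_fld_trunc_sub_le hβ0 hR0 r (Y r + y) (Y r + z)
      refine (intervalIntegral.norm_integral_le_of_norm_le_const h1).trans ?_
      rw [hlen, abs_of_nonneg (by positivity)]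
      have h2 : R * (1 / 2 ^ i) ≤ (1 / 2 ^ i) ^ γ := by
        have h3 : R ≤ (2 ^ i) ^ (1 - γ) := by
          rw [hR]
          refine Real.rpow_le_rpow (by positivity) ?_ (by linarith)
          exact pow_le_pow_right₀ (by norm_num) hi.le
        have h4 : ((2 : ℝ) ^ i) ^ (1 - γ) * (1 / 2 ^ i) = (1 / 2 ^ i) ^ γ := by
          have h5 : (0 : ℝ) < 2 ^ i := by positivity
          rw [one_div, Real.inv_rpow h5.le, Real.rpow_sub h5, Real.rpow_one]
          field_simp
        rw [← h4]
        gcongr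
      calc R * J * ‖y - z‖ * (1 / 2 ^ i) = J * (R * (1 / 2 ^ i)) * ‖y - z‖ := by ring
        _ ≤ (K + J) * (1 / 2 ^ i) ^ γ * ‖y - z‖ := by
          gcongr
          linarith
  · intro i k
    simp
  · intro i k
    simp only [dy_succ_two_mul]
  · intro i k hk
    have hsmem : ∀ r ∈ Set.uIoc (dy i k) (dy i (k + 1)), r ∈ Set.Icc (0 : ℝ) 1 ∧
        |r - dy i k| ≤ 1 / 2 ^ i := by
      intro r hr
      rw [Set.uIoc_of_le (dy_mono i (by omega))] at hr
      refine ⟨⟨(dy_nonneg i k).trans hr.1.le, hr.2.trans (dy_le_one (by omega))⟩, ?_⟩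
      rw [abs_of_nonneg (by linarith [hr.1]), ← hlen i k]
      linarith [hr.2]
    have e1 : ψ (dy i (k + 1)) - ψ (dy i k) -
        ((∫ r in dy i k..dy i (k + 1), fld (trunc L R) r (Y r + ψ (dy i k))) -
          ∫ r in dy i k..dy i (k + 1), fld (trunc L R) r (Y r + 0)) =
        ∫ r in dy i k..dy i (k + 1), ((fld L r (X r) - fld L r (Y r)) -
          (fld (trunc L R) r (Y r + ψ (dy i k)) - fld (trunc L R) r (Y r + 0))) := by
      have hiX := intervalIntegrable_field hb hbd hX (dy i k) (dy i (k + 1))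
      have hiY := intervalIntegrable_field hb hbd hYm (dy i k) (dy i (k + 1))
      rw [intervalIntegral.integral_sub (hiX.sub hiY) ((hintR _ _ _).sub (hintR _ _ _)),
        intervalIntegral.integral_sub hiX hiY,
        intervalIntegral.integral_sub (hintR _ _ _) (hintR _ _ _),
        ← drift_sub_drift (x₀ := x₀) hb hbd hX, ← drift_sub_drift (x₀ := x₀) hb hbd hYm]
      simp only [ψ]
      abel
    rw [e1]
    have h1 : ∀ r ∈ Set.uIoc (dy i k) (dy i (k + 1)), ‖(fld L r (X r) - fld L r (Y r)) -
          (fld (trunc L R) r (Y r + ψ (dy i k)) - fld (trunc L R) r (Y r + 0))‖ ≤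
        ε + R * J * Q * (1 / 2 ^ i) := by
      intro r hr
      obtain ⟨hr1, hr2⟩ := hsmem r hr
      have b1 : ‖fld L r (X r) - fld L r (drift (fld L) x₀ X r + w r)‖ ≤ Q * ρ ^ β := by
        refine (hL.norm_fld_sub_le hβ0 hβ1 _ _ _).trans ?_
        gcongr
        exact hXρ r hr1
      have b2 : ‖fld L r (drift (fld L) x₀ X r + w r) - fld L r (Y r + ψ r)‖ ≤ Q * ρ' ^ β := by
        refine (hL.norm_fld_sub_le hβ0 hβ1 _ _ _).trans ?_
        gcongr
        refine le_trans (le_of_eq ?_) (hEρ r hr1)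
        congr 1
        simp only [ψ]
        abel
      have b3 := hL.norm_fld_sub_trunc_le hβ0 R r (Y r + ψ r)
      have b4 : ‖fld (trunc L R) r (Y r + ψ r) - fld (trunc L R) r (Y r + ψ (dy i k))‖ ≤
          R * J * Q * (1 / 2 ^ i) := by
        refine (hL.norm_fld_trunc_sub_le hβ0 hR0 _ _ _).trans ?_
        rw [add_sub_add_left_eq_sub, mul_assoc (R * J)]
        refine mul_le_mul_of_nonneg_left ((hψlip _ _).trans ?_) (by positivity)
        gcongr
      have b5 := hL.norm_fld_sub_trunc_le hβ0 R r (Y r)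
      have e2 : (fld L r (X r) - fld L r (Y r)) -
          (fld (trunc L R) r (Y r + ψ (dy i k)) - fld (trunc L R) r (Y r + 0)) =
          (fld L r (X r) - fld L r (drift (fld L) x₀ X r + w r)) +
          (fld L r (drift (fld L) x₀ X r + w r) - fld L r (Y r + ψ r)) +
          (fld L r (Y r + ψ r) - fld (trunc L R) r (Y r + ψ r)) +
          (fld (trunc L R) r (Y r + ψ r) - fld (trunc L R) r (Y r + ψ (dy i k))) -
          (fld L r (Y r) - fld (trunc L R) r (Y r)) := by
        rw [add_zero]
        abel
      rw [e2]
      refine (norm_sub_le _ _).trans ?_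
      refine (add_le_add norm_add₄_le le_rfl).trans ?_
      linarith
    refine (intervalIntegral.norm_integral_le_of_norm_le_const h1).trans (le_of_eq ?_)
    rw [hlen, abs_of_nonneg (by positivity), one_div_pow, one_div_pow,
      show (4 : ℝ) = 2 * 2 by norm_num, mul_pow]
    field_simp
  · intro i k hk
    refine (hψlip _ _).trans (le_of_eq ?_)
    rw [hlen, abs_of_nonneg (by positivity), one_div_pow]
  · simp [ψ, dy, drift]

end

section
variable {d : ℕ} {β γ K : ℝ} {L : ℝ × Euc d → ℂ →L[ℝ] Euc d} {x₀ : Euc d} {w : ℝ → Euc d}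

lemma eventually_norm_drift_eulerPath_le {b : ℝ → Euc d → Euc d} {Cb : ℝ}
    (hb : Continuous fun q : ℝ × Euc d => b q.1 q.2)
    (hbound : ∀ t x, ‖b t x‖ ≤ Cb) (hw : ContinuousOn w (Set.Icc 0 1)) {σ : ℝ} (hσ : 0 < σ) :
    ∀ᶠ n in atTop, ∀ r ∈ Set.Icc (0 : ℝ) 1,
      ‖drift b x₀ (eulerPath b x₀ n w) r + w r - eulerPath b x₀ n w r‖ ≤ σ := by
  have hCb : 0 ≤ Cb := (norm_nonneg _).trans (hbound 0 0)
  obtain ⟨δ, hδ, hwδ⟩ := Metric.uniformContinuousOn_iff.1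
    (isCompact_Icc.uniformContinuousOn_of_continuous hw) (σ / 2) (by positivity)
  have hlim : Tendsto (fun n : ℕ => (1 / 2 : ℝ) ^ n) atTop (𝓝 0) :=
    tendsto_pow_atTop_nhds_zero_of_lt_one (by norm_num) (by norm_num)
  have hlim' := hlim.const_mul Cb
  rw [mul_zero] at hlim'
  filter_upwards [hlim.eventually_lt_const hδ, hlim'.eventually_lt_const (half_pos hσ)]
    with n hn hn' r hr
  have h2 : (0 : ℝ) < 2 ^ n := by positivity
  rw [one_div_pow] at hn hn'
  set u := ⌊r * 2 ^ n⌋₊ with hu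
  have h3 := Nat.floor_le (mul_nonneg hr.1 h2.le)
  have h4 := Nat.lt_floor_add_one (r * 2 ^ n)
  have h5 : dy n u ≤ r := by
    unfold dy
    rw [div_le_iff₀ h2]
    exact h3
  have h6 : |r - dy n u| ≤ 1 / 2 ^ n := by
    rw [abs_of_nonneg (by linarith), sub_le_iff_le_add', dy, ← add_div, le_div_iff₀ h2]
    exact h4.le
  have h7 : dy n u ∈ Set.Icc (0 : ℝ) 1 := ⟨dy_nonneg n u, h5.trans hr.2⟩
  have e : drift b x₀ (eulerPath b x₀ n w) r + w r - eulerPath b x₀ n w r =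
      (drift b x₀ (eulerPath b x₀ n w) r - drift b x₀ (eulerPath b x₀ n w) (dy n u)) +
      (w r - w (dy n u)) := by
    rw [drift_eulerPath_dy hb hbound, eulerPath, ← hu, eulerX]
    abel
  rw [e]
  refine (norm_add_le _ _).trans ?_
  have h8 := norm_drift_sub_drift_le (x₀ := x₀) hb hbound
    (measurable_eulerPath (b := b) (x₀ := x₀) (n := n) (w := w)) (dy n u) r
  have h9 := hwδ r hr _ h7 (by rw [Real.dist_eq]; exact h6.trans_lt hn)
  rw [dist_eq_norm] at h9
  have h10 : Cb * |r - dy n u| ≤ Cb * (1 / 2 ^ n) := by gcongr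
  linarith

/-- The levels at which the averaged field satisfies the Lipschitz bounds. -/
def goodLevel (L : ℝ × Euc d → ℂ →L[ℝ] Euc d) (x₀ : Euc d) (w : ℝ → Euc d) (γ K : ℝ) (n : ℕ) :
    Prop :=
  ∀ i ≤ n, ∀ k < 2 ^ i, avgLip L (fld L) x₀ ((2 ^ n) ^ (1 - γ)) n i k w ≤
    ENNReal.ofReal (K * (1 / 2 ^ i) ^ γ)

lemma exists_forall_norm_drift_sub_le (hL : Adm β L) (hβ0 : 0 < β) (hβ1 : β ≤ 1)
    (hγ : 1 / 2 < γ) (hγ1 : γ < 1) (hK : 0 ≤ K) (hw : ContinuousOn w (Set.Icc 0 1)) {η : ℝ}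
    (hη : 0 < η) :
    ∃ σ > 0, ∀ᶠ n in atTop, goodLevel L x₀ w γ K n → ∀ X : ℝ → Euc d, Measurable X →
      (∀ r ∈ Set.Icc (0 : ℝ) 1, ‖X r - (drift (fld L) x₀ X r + w r)‖ ≤ σ) →
      ∀ t ∈ Set.Icc (0 : ℝ) 1,
        ‖drift (fld L) x₀ X t - drift (fld L) x₀ (eulerPath (fld L) x₀ n w) t‖ ≤ η := by
  obtain ⟨C, hC⟩ := exists_norm_drift_sub_drift_eulerPath_le (x₀ := x₀) (w := w) hL hβ0.le hβ1 hγ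
    hγ1 hK
  set I : ℝ := ∫ p, ‖L p‖ * (1 + ‖p.2‖) ^ β with hI
  have h1 : Tendsto (fun σ : ℝ => C * (2 * I * σ ^ β + 2 * I * σ ^ β)) (𝓝 0) (𝓝 0) := by
    have : Continuous fun σ : ℝ => C * (2 * I * σ ^ β + 2 * I * σ ^ β) := by
      have := Real.continuous_rpow_const hβ0.le
      fun_prop
    simpa [Real.zero_rpow hβ0.ne'] using this.tendsto 0
  obtain ⟨σ, hσ, hσ0⟩ := ((h1.eventually_lt_const (half_pos hη)).filter_mono
    (nhdsWithin_le_nhds (s := Set.Ioi 0)) |>.and self_mem_nhdsWithin).exists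
  refine ⟨σ, hσ0, ?_⟩
  have hR : Tendsto (fun n : ℕ => ((2 : ℝ) ^ n) ^ (1 - γ)) atTop atTop :=
    (tendsto_rpow_atTop (by linarith)).comp (tendsto_pow_atTop_atTop_of_one_lt (by norm_num))
  have h2 := ((hL.tendsto_trunc hβ0.le hR).const_mul 2).const_mul C
  rw [mul_zero, mul_zero] at h2
  filter_upwards [h2.eventually_lt_const (half_pos hη),
    eventually_norm_drift_eulerPath_le (x₀ := x₀) (hL.continuous_fld hβ0.le)
      (fun t x => hL.norm_fld_le t x hβ0.le) hw hσ0] with n hn hn' hgood X hX hXσ t ht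
  refine (hC n X σ σ hgood hX hXσ hn' t ht).trans ?_
  rw [mul_add]
  linarith

lemma tendsto_drift {b : ℝ → Euc d → Euc d} {Cb : ℝ}
    (hb : Continuous fun q : ℝ × Euc d => b q.1 q.2) (hbound : ∀ t x, ‖b t x‖ ≤ Cb)
    {Y : ℕ → ℝ → Euc d} (hY : ∀ l, Measurable (Y l)) {z : ℝ → Euc d}
    (hlim : ∀ r ∈ Set.Icc (0 : ℝ) 1, Tendsto (fun l => Y l r) atTop (𝓝 (z r))) {t : ℝ}
    (ht : t ∈ Set.Icc (0 : ℝ) 1) :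
    Tendsto (fun l => drift b x₀ (Y l) t) atTop (𝓝 (drift b x₀ z t)) := by
  refine tendsto_const_nhds.add
    (intervalIntegral.tendsto_integral_filter_of_dominated_convergence
    (fun _ => Cb) (Eventually.of_forall fun l => ?_)
    (Eventually.of_forall fun l => ae_of_all _ fun r _ => hbound _ _) intervalIntegrable_const
    (ae_of_all _ fun r hr => ?_))
  · exact (hb.measurable.comp (measurable_id.prodMk (hY l))).aestronglyMeasurable
  · rw [Set.uIoc_of_le ht.1] at hr
    have h1 : Tendsto (fun l => (r, Y l r)) atTop (𝓝 (r, z r)) :=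
      tendsto_const_nhds.prodMk_nhds (hlim r ⟨hr.1.le, hr.2.trans ht.2⟩)
    exact (hb.tendsto (r, z r)).comp h1

/-- Existence for the integral equation. -/
lemma exists_eq_drift_add (hL : Adm β L) (hβ0 : 0 < β) (hβ1 : β ≤ 1)
    (hγ : 1 / 2 < γ) (hγ1 : γ < 1) (hK : 0 ≤ K) (hw : ContinuousOn w (Set.Icc 0 1))
    (hgood : ∃ᶠ n in atTop, goodLevel L x₀ w γ K n) :
    ∃ x : ℝ → Euc d, ContinuousOn x (Set.Icc 0 1) ∧
      ∀ t ∈ Set.Icc (0 : ℝ) 1, x t = drift (fld L) x₀ x t + w t := by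
  obtain ⟨N, hN, hNgood⟩ := extraction_of_frequently_atTop hgood
  have hb := hL.continuous_fld hβ0.le
  obtain ⟨Cb, hbd⟩ : ∃ Cb, ∀ t x, ‖fld L t x‖ ≤ Cb := ⟨_, fun t x => hL.norm_fld_le t x hβ0.le⟩
  have hCb : 0 ≤ Cb := (norm_nonneg _).trans (hbd 0 0)
  set Y : ℕ → ℝ → Euc d := fun l => eulerPath (fld L) x₀ (N l) w with hY
  have hYm : ∀ l, Measurable (Y l) := fun l => measurable_eulerPath
  have happrox : ∀ σ > 0, ∀ᶠ l in atTop, ∀ r ∈ Set.Icc (0 : ℝ) 1,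
      ‖Y l r - (drift (fld L) x₀ (Y l) r + w r)‖ ≤ σ := by
    intro σ hσ
    filter_upwards [hN.tendsto_atTop.eventually
      (eventually_norm_drift_eulerPath_le (x₀ := x₀) hb hbd hw hσ)] with l hl r hr
    rw [norm_sub_rev]
    exact hl r hr
  have hcauchy : ∀ t ∈ Set.Icc (0 : ℝ) 1, ∃ z, Tendsto (fun l => drift (fld L) x₀ (Y l) t) atTop
      (𝓝 z) := by
    intro t ht
    refine cauchySeq_tendsto_of_complete (Metric.cauchySeq_iff'.2 fun η hη => ?_)
    obtain ⟨σ, hσ, hev⟩ := exists_forall_norm_drift_sub_le (x₀ := x₀) hL hβ0 hβ1 hγ hγ1 hK hw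
      (half_pos (half_pos hη))
    obtain ⟨M, hM⟩ := eventually_atTop.1 ((happrox σ hσ).and (hN.tendsto_atTop.eventually hev))
    refine ⟨M, fun m hm => ?_⟩
    have h1 := (hM M le_rfl).2 (hNgood M) (Y m) (hYm m) (hM m hm).1 t ht
    rw [dist_eq_norm]
    exact h1.trans_lt (by linarith)
  choose! φ hφ using hcauchy
  have hφlip : ∀ s ∈ Set.Icc (0 : ℝ) 1, ∀ t ∈ Set.Icc (0 : ℝ) 1,
      ‖φ t - φ s‖ ≤ Cb * |t - s| := fun s hs t ht =>
    le_of_tendsto' ((hφ t ht).sub (hφ s hs)).norm fun l =>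
      norm_drift_sub_drift_le (x₀ := x₀) hb hbd (hYm l) s t
  have hφc : ContinuousOn φ (Set.Icc 0 1) := by
    refine (LipschitzOnWith.of_dist_le_mul (K := ⟨Cb, hCb⟩) fun t ht s hs => ?_).continuousOn
    rw [dist_eq_norm, Real.dist_eq]
    exact hφlip s hs t ht
  refine ⟨fun t => φ t + w t, hφc.add hw, fun t ht => ?_⟩
  have hYlim : ∀ r ∈ Set.Icc (0 : ℝ) 1, Tendsto (fun l => Y l r) atTop (𝓝 (φ r + w r)) := by
    intro r hr
    have h1 : Tendsto (fun l => Y l r - (drift (fld L) x₀ (Y l) r + w r)) atTop (𝓝 0) := by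
      rw [tendsto_zero_iff_norm_tendsto_zero, Metric.tendsto_atTop]
      intro σ hσ
      obtain ⟨M, hM⟩ := eventually_atTop.1 (happrox (σ / 2) (half_pos hσ))
      refine ⟨M, fun l hl => ?_⟩
      rw [Real.dist_eq, sub_zero, abs_norm]
      exact (hM l hl r hr).trans_lt (by linarith)
    simpa using h1.add ((hφ r hr).add_const (w r))
  exact congrArg (· + w t) (tendsto_nhds_unique (hφ t ht) (tendsto_drift hb hbd hYm hYlim ht))

/-- Uniqueness for the integral equation. -/
lemma eq_of_eq_drift_add (hL : Adm β L) (hβ0 : 0 < β) (hβ1 : β ≤ 1)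
    (hγ : 1 / 2 < γ) (hγ1 : γ < 1) (hK : 0 ≤ K) (hw : ContinuousOn w (Set.Icc 0 1))
    (hgood : ∃ᶠ n in atTop, goodLevel L x₀ w γ K n) {x y : ℝ → Euc d}
    (hx : ContinuousOn x (Set.Icc 0 1))
    (hxeq : ∀ t ∈ Set.Icc (0 : ℝ) 1, x t = drift (fld L) x₀ x t + w t)
    (hy : ContinuousOn y (Set.Icc 0 1))
    (hyeq : ∀ t ∈ Set.Icc (0 : ℝ) 1, y t = drift (fld L) x₀ y t + w t)
    {t : ℝ} (ht : t ∈ Set.Icc (0 : ℝ) 1) : x t = y t := by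
  have hext : ∀ z : ℝ → Euc d, ContinuousOn z (Set.Icc 0 1) →
      (∀ t ∈ Set.Icc (0 : ℝ) 1, z t = drift (fld L) x₀ z t + w t) →
      ∃ Z : ℝ → Euc d, Measurable Z ∧ (∀ t ∈ Set.Icc (0 : ℝ) 1, Z t = z t) ∧
        ∀ t ∈ Set.Icc (0 : ℝ) 1, z t = drift (fld L) x₀ Z t + w t := by
    intro z hz hzeq
    have hZ : ∀ t ∈ Set.Icc (0 : ℝ) 1, Set.IccExtend zero_le_one ((Set.Icc 0 1).domRestrict z) t =
        z t := fun t ht => Set.IccExtend_of_mem _ _ ht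
    refine ⟨Set.IccExtend zero_le_one ((Set.Icc 0 1).domRestrict z),
      (continuousOn_iff_continuous_domRestrict.1 hz).Icc_extend'.measurable, hZ, fun t ht => ?_⟩
    rw [hzeq t ht, drift, drift]
    congr 2
    refine intervalIntegral.integral_congr fun r hr => ?_
    rw [Set.uIcc_of_le ht.1] at hr
    simp only [hZ r ⟨hr.1, hr.2.trans ht.2⟩]
  obtain ⟨X, hXm, hXx, hX⟩ := hext x hx hxeq
  obtain ⟨Z, hZm, hZy, hZ⟩ := hext y hy hyeq
  rw [← sub_eq_zero, ← norm_le_zero_iff]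
  refine le_of_forall_pos_le_add fun η hη => ?_
  obtain ⟨σ, hσ, hev⟩ := exists_forall_norm_drift_sub_le (x₀ := x₀) hL hβ0 hβ1 hγ hγ1 hK hw
    (half_pos hη)
  obtain ⟨n, hn, hclose⟩ := (hgood.and_eventually hev).exists
  have h1 := hclose hn X hXm (fun r hr => by simp [hXx r hr, ← hX r hr, hσ.le]) t ht
  have h2 := hclose hn Z hZm (fun r hr => by simp [hZy r hr, ← hZ r hr, hσ.le]) t ht
  rw [hX t ht, hZ t ht, add_sub_add_right_eq_sub, zero_add]
  rw [norm_sub_rev] at h2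
  exact (norm_sub_le_norm_sub_add_norm_sub _ _ _).trans (by linarith)

end

lemma add_integral_eq_drift {d : ℕ} {b c : ℝ → Euc d → Euc d} {T : Set ℝ} (hT : T.Countable)
    (h : ∀ t ∉ T, ∀ x, b t x = c t x) (x₀ : Euc d) (x : ℝ → Euc d) (t : ℝ) :
    x₀ + (∫ s in (0 : ℝ)..t, b s (x s)) = drift c x₀ x t := by
  rw [drift]
  congr 1
  refine intervalIntegral.integral_congr_ae ?_
  filter_upwards [hT.ae_notMem volume] with r hr _
  exact h r hr _

end FBMReg

/-- Path-by-path existence and uniqueness for the ODE driven by a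
fractional Brownian motion of Hurst index `H ∈ [1/2,1)` and a drift `b ∈ FL^{α+1}`,
`α > -1/(2H)`: outside a null set of paths (depending on `b` and `x₀`), the integral
equation has exactly one continuous solution on `[0,1]`. -/
theorem statement0 {Ω : Type*} [MeasureSpace Ω] [IsProbabilityMeasure (volume : Measure Ω)]
    (d : ℕ) (hd : 0 < d) (H : ℝ) (hH : 1 / 2 ≤ H) (hH1 : H < 1)
    (W : Ω → ℝ → Euc d) (hW : IsFBM d H W)
    (α : ℝ) (hα : -1 / (2 * H) < α)
    (bhat : ℝ × Euc d → Fin d → ℂ) (hb : FLnorm d (α + 1) bhat < ⊤)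
    (x₀ : Euc d) :
    ∃ N : Set (ℝ → Euc d), MeasurableSet N ∧ (volume : Measure Ω) {ω | W ω ∈ N} = 0 ∧
      ∀ w : ℝ → Euc d, ContinuousOn w (Set.Icc 0 1) → w ∉ N →
        (∃ x : ℝ → Euc d, ContinuousOn x (Set.Icc 0 1) ∧
          ∀ t ∈ Set.Icc (0 : ℝ) 1,
            x t = x₀ + (∫ s in (0 : ℝ)..t, fieldOf bhat s (x s)) + w t) ∧
        (∀ x y : ℝ → Euc d,
          ContinuousOn x (Set.Icc 0 1) →
          (∀ t ∈ Set.Icc (0 : ℝ) 1,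
            x t = x₀ + (∫ s in (0 : ℝ)..t, fieldOf bhat s (x s)) + w t) →
          ContinuousOn y (Set.Icc 0 1) →
          (∀ t ∈ Set.Icc (0 : ℝ) 1,
            y t = x₀ + (∫ s in (0 : ℝ)..t, fieldOf bhat s (y s)) + w t) →
          ∀ t ∈ Set.Icc (0 : ℝ) 1, x t = y t) := by
  have hH0 : 0 < 2 * H := by linarith
  have hle : 1 / (2 * H) ≤ 1 := by
    rw [div_le_one hH0]
    linarith
  have hβ : 1 - 1 / (2 * H) < min (α + 1) 1 := by
    rw [neg_div] at hα
    have : 0 < 1 / (2 * H) := by positivity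
    exact lt_min (by linarith) (by linarith)
  have hβ0 : 0 < min (α + 1) 1 := by linarith
  have hβ1 : min (α + 1) 1 ≤ 1 := min_le_right _ _
  obtain ⟨L, hL, T, hT, hfld⟩ := FBMReg.exists_adm hb hβ0.le (min_le_left (α + 1) 1)
  simp only [FBMReg.add_integral_eq_drift hT hfld]
  have hI : 0 ≤ ∫ p, ‖L p‖ * (1 + ‖p.2‖) ^ (min (α + 1) 1) :=
    integral_nonneg fun p => by positivity
  obtain ⟨γ, hγ, hγ1, N, hN, hN0, hgood⟩ := FBMReg.exists_null_set (b := FBMReg.fld L) (x₀ := x₀)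
    hW hH hH1 hβ hβ0.le hβ1 hL (mul_nonneg zero_le_two hI) (hL.continuous_fld hβ0.le)
    (fun t x => (hL.norm_fld_le t x hβ0.le).trans (by linarith))
    (fun t x y => hL.norm_fld_sub_le hβ0.le hβ1 t x y)
  refine ⟨N, hN, hN0, fun w hw hwN => ?_⟩
  obtain ⟨K, hK, hfreq⟩ := hgood w hwN
  exact ⟨FBMReg.exists_eq_drift_add hL hβ0 hβ1 hγ hγ1 hK hw hfreq,
    fun x y hx hxeq hy hyeq t ht =>
      FBMReg.eq_of_eq_drift_add hL hβ0 hβ1 hγ hγ1 hK hw hfreq hx hxeq hy hyeq ht⟩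
end
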